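/- Let α ≥ 0, let n ≥ 1 be an integer, let B be the open unit disc of ℝ², and let β > 0 satisfy z_1(β) = z_2(0). Assume n > (2+α)β/2. Let (U_p)_{p∈(1,p_0)} be a family of least energy n-invariant nodal solutions of the Hénon problem. Then ‖U_p‖_∞^{p−1} → ((2+α)/2 · z_2(0))² as p → 1, and for every sequence p_k → 1 there exist a subsequence and a sign ε ∈ {−1, +1} such that along the subsequence U_{p_k}/‖U_{p_k}‖_∞ converges uniformly on B̄ to the radial function x ↦ ε · J_0( z_2(0) |x|^{(2+α)/2} ). -/

import Mathlib

open Real MeasureTheory Metric Filter Topology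

noncomputable section

/-- The Euclidean plane. -/
abbrev E2 := EuclideanSpace ℝ (Fin 2)

/-- The Laplacian of `u : ℝ² → ℝ`. -/
def lap (u : E2 → ℝ) (x : E2) : ℝ :=
  ∑ i : Fin 2, fderiv ℝ (fun y => fderiv ℝ u y (EuclideanSpace.single i 1)) x
    (EuclideanSpace.single i 1)

/-- The sup norm `‖u‖_∞` of `u` over the closed unit disc. -/
def supN (u : E2 → ℝ) : ℝ := sSup ((fun x => |u x|) '' closedBall 0 1)

/-- A classical solution of the planar Hénon problem with parameter `α` and exponent `p`. -/
def IsHenonSol (α p : ℝ) (u : E2 → ℝ) : Prop :=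
  ContDiffOn ℝ 2 u (ball 0 1) ∧ ContinuousOn u (closedBall 0 1) ∧
  (∀ x ∈ ball (0 : E2) 1, -lap u x = ‖x‖ ^ α * |u x| ^ (p - 1) * u x) ∧
  (∀ x : E2, ‖x‖ = 1 → u x = 0)

/-- Rotation of the plane by the angle `φ` about the origin. -/
def rot2 (φ : ℝ) (q : E2) : E2 :=
  (EuclideanSpace.equiv (Fin 2) ℝ).symm
    ![Real.cos φ * q 0 - Real.sin φ * q 1, Real.sin φ * q 0 + Real.cos φ * q 1]

/-- Reflection of the plane across the horizontal axis. -/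
def reflX (q : E2) : E2 :=
  (EuclideanSpace.equiv (Fin 2) ℝ).symm ![q 0, -q 1]

/-- `u` is `n`-invariant: invariant under reflection across the horizontal axis and
rotation by `2π/n`. -/
def nInvariant (n : ℕ) (u : E2 → ℝ) : Prop :=
  (∀ q : E2, u (reflX q) = u q) ∧ (∀ q : E2, u (rot2 (2 * π / n) q) = u q)

/-- The quadratic form associated with the linearization of the Hénon problem at `U`. -/
def quadForm (α p : ℝ) (U ψ : E2 → ℝ) : ℝ :=
  (∫ x in ball (0 : E2) 1, ‖fderiv ℝ ψ x‖ ^ 2) -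
    p * ∫ x in ball (0 : E2) 1, ‖x‖ ^ α * |U x| ^ (p - 1) * ψ x ^ 2

/-- The energy functional of the Hénon problem. -/
def energy (α p : ℝ) (u : E2 → ℝ) : ℝ :=
  (1 / 2) * (∫ x in ball (0 : E2) 1, ‖fderiv ℝ u x‖ ^ 2) -
    (1 / (p + 1)) * ∫ x in ball (0 : E2) 1, ‖x‖ ^ α * |u x| ^ (p + 1)

/-- An `n`-invariant Lipschitz competitor in the nodal Nehari set: it vanishes on `∂B`,
has nontrivial positive and negative parts, and both parts satisfy the Nehari constraint. -/
def IsNehariCompetitor (α p : ℝ) (n : ℕ) (v : E2 → ℝ) : Prop :=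
  nInvariant n v ∧ (∃ K : NNReal, LipschitzOnWith K v (closedBall 0 1)) ∧
  (∀ x : E2, ‖x‖ = 1 → v x = 0) ∧
  (∃ x ∈ ball (0 : E2) 1, 0 < v x) ∧ (∃ x ∈ ball (0 : E2) 1, v x < 0) ∧
  (∫ x in ball (0 : E2) 1, ‖fderiv ℝ (fun y => max (v y) 0) x‖ ^ 2)
    = (∫ x in ball (0 : E2) 1, ‖x‖ ^ α * (max (v x) 0) ^ (p + 1)) ∧
  (∫ x in ball (0 : E2) 1, ‖fderiv ℝ (fun y => max (-v y) 0) x‖ ^ 2)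
    = (∫ x in ball (0 : E2) 1, ‖x‖ ^ α * (max (-v x) 0) ^ (p + 1))

/-- A least energy `n`-invariant nodal solution of the Hénon problem:
an `n`-invariant sign-changing classical solution whose `n`-Morse index is exactly 2 and
which minimizes the energy among `n`-invariant nodal Nehari competitors. -/
def IsLeastEnergyNInvNodal (α p : ℝ) (n : ℕ) (U : E2 → ℝ) : Prop :=
  IsHenonSol α p U ∧ nInvariant n U ∧
  (∃ x ∈ ball (0 : E2) 1, 0 < U x) ∧ (∃ x ∈ ball (0 : E2) 1, U x < 0) ∧
  IsGreatest {d : ℕ | ∃ V : Submodule ℝ (E2 → ℝ), Module.finrank ℝ V = d ∧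
    (∀ ψ ∈ V, ContDiff ℝ 1 ψ ∧ HasCompactSupport ψ ∧ tsupport ψ ⊆ ball 0 1 ∧
      nInvariant n ψ) ∧
    (∀ ψ ∈ V, ψ ≠ 0 → quadForm α p U ψ < 0)} 2 ∧
  (∀ v : E2 → ℝ, IsNehariCompetitor α p n v → energy α p U ≤ energy α p v)

/-- The Bessel function of the first kind of order `β`. -/
def besselJ (β r : ℝ) : ℝ :=
  r ^ β * ∑' k : ℕ,
    ((-1 : ℝ) ^ k / (Nat.factorial k * Real.Gamma ((k : ℝ) + 1 + β))) * (r / 2) ^ (2 * k)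

/-- `z` is the `i`-th positive zero of `J_β`. -/
def IsNthZero (β : ℝ) (i : ℕ) (z : ℝ) : Prop :=
  0 < z ∧ besselJ β z = 0 ∧ {r ∈ Set.Ioo 0 z | besselJ β r = 0}.encard = ((i - 1 : ℕ) : ℕ∞)

/-- The point of the plane with polar coordinates `(r, θ)`. -/
def polar (r θ : ℝ) : E2 :=
  (EuclideanSpace.equiv (Fin 2) ℝ).symm ![r * Real.cos θ, r * Real.sin θ]

/-- Necessary second-order condition at a local maximum on the line. -/
lemma second_deriv_nonpos {g g' : ℝ → ℝ} {a c : ℝ} (hg : ∀ᶠ t in 𝓝 a, HasDerivAt g (g' t) t)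
    (hg' : HasDerivAt g' c a) (hmax : IsLocalMax g a) : c ≤ 0 := by
  by_contra hc
  push Not at hc
  have h1 : deriv g =ᶠ[𝓝 a] g' := hg.mono fun t ht => ht.deriv
  have h2 : deriv (deriv g) a = c := by rw [h1.deriv_eq]; exact hg'.deriv
  have hmin : IsLocalMin g a :=
    isLocalMin_of_deriv_deriv_pos (by rw [h2]; exact hc) hmax.deriv_eq_zero
      hg.self_of_nhds.continuousAt
  have hconst : g =ᶠ[𝓝 a] fun _ => g a := by
    filter_upwards [hmin, hmax] with t h1 h2 using le_antisymm h2 h1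
  have : deriv g =ᶠ[𝓝 a] deriv (fun _ => g a) := hconst.deriv
  have h3 : deriv (deriv g) a = 0 := by
    rw [this.deriv_eq]; simp
  linarith

lemma polar_apply_zero (r θ : ℝ) : polar r θ 0 = r * cos θ := by simp [polar]

lemma polar_apply_one (r θ : ℝ) : polar r θ 1 = r * sin θ := by simp [polar]

lemma norm_polar (r θ : ℝ) : ‖polar r θ‖ = |r| := by
  rw [EuclideanSpace.norm_eq, Fin.sum_univ_two, polar_apply_zero, polar_apply_one]
  rw [← Real.sqrt_sq_eq_abs]
  congr 1
  simp only [Real.norm_eq_abs, sq_abs]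
  nlinarith [Real.sin_sq_add_cos_sq θ]

lemma polar_eq_smul (r θ : ℝ) : polar r θ = r • polar 1 θ := by
  ext i; fin_cases i <;> simp [polar]

lemma polar_one_eq (θ : ℝ) :
    polar 1 θ = cos θ • EuclideanSpace.single 0 1 + sin θ • EuclideanSpace.single 1 1 := by
  ext i; fin_cases i <;> simp [polar]

lemma exists_polar (x : E2) : ∃ θ : ℝ, x = polar ‖x‖ θ := by
  by_cases hx : x = 0
  · exact ⟨0, by subst hx; ext i; fin_cases i <;> simp [polar]⟩
  refine ⟨Complex.arg ⟨x 0, x 1⟩, ?_⟩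
  have hn : ‖(⟨x 0, x 1⟩ : ℂ)‖ = ‖x‖ := by
    rw [EuclideanSpace.norm_eq, Fin.sum_univ_two, Complex.norm_eq_sqrt_sq_add_sq]; simp
  have hz : (⟨x 0, x 1⟩ : ℂ) ≠ 0 := by
    intro h
    rw [h, norm_zero] at hn
    exact hx (norm_eq_zero.1 hn.symm)
  have h0 : ‖x‖ ≠ 0 := norm_ne_zero_iff.2 hx
  ext i; fin_cases i
  · change x 0 = polar _ _ 0
    rw [polar_apply_zero, Complex.cos_arg hz, hn]; field_simp
  · change x 1 = polar _ _ 1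
    rw [polar_apply_one, Complex.sin_arg, hn]; field_simp

lemma hasDerivAt_polar_radius (r θ : ℝ) : HasDerivAt (fun r => polar r θ) (polar 1 θ) r := by
  have : (fun r => polar r θ) = fun r => r • polar 1 θ := by ext1 r; exact polar_eq_smul r θ
  rw [this]
  simpa using (hasDerivAt_id r).smul_const (polar 1 θ)

lemma hasDerivAt_polar_angle (r θ : ℝ) :
    HasDerivAt (fun θ => polar r θ) (polar r (θ + π / 2)) θ := by
  have : (fun θ => polar r θ) = fun θ => r • (cos θ • (EuclideanSpace.single 0 1 : E2)
      + sin θ • EuclideanSpace.single 1 1) := by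
    ext1 θ; rw [polar_eq_smul, polar_one_eq]
  rw [this, polar_eq_smul, polar_one_eq, cos_add_pi_div_two, sin_add_pi_div_two]
  exact (((hasDerivAt_cos θ).smul_const _).add ((hasDerivAt_sin θ).smul_const _)).const_smul r

/-- The Laplacian as the trace of the Hessian in a rotated orthonormal frame. -/
lemma lap_eq_frame {u : E2 → ℝ} {x : E2} (hu : ContDiffAt ℝ 2 u x) (θ : ℝ) :
    lap u x = fderiv ℝ (fderiv ℝ u) x (polar 1 θ) (polar 1 θ)
      + fderiv ℝ (fderiv ℝ u) x (polar 1 (θ + π / 2)) (polar 1 (θ + π / 2)) := by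
  have hd : DifferentiableAt ℝ (fderiv ℝ u) x :=
    (hu.fderiv_right (m := 1) (by norm_num)).differentiableAt (by norm_num)
  have h1 : ∀ v : E2, fderiv ℝ (fun y => fderiv ℝ u y v) x v = fderiv ℝ (fderiv ℝ u) x v v := by
    intro v
    rw [fderiv_clm_apply hd (differentiableAt_const v)]
    simp
  unfold lap
  rw [Fin.sum_univ_two, h1, h1, polar_one_eq, polar_one_eq, cos_add_pi_div_two,
    sin_add_pi_div_two]
  simp only [map_add, map_smul, add_apply, smul_apply,
    smul_eq_mul]
  linear_combination (-(fderiv ℝ (fderiv ℝ u) x (EuclideanSpace.single 0 1)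
    (EuclideanSpace.single 0 1)) - fderiv ℝ (fderiv ℝ u) x (EuclideanSpace.single 1 1)
    (EuclideanSpace.single 1 1)) * sin_sq_add_cos_sq θ

lemma hasDerivAt_comp_curve {u : E2 → ℝ} {γ : ℝ → E2} {v : E2} {t : ℝ}
    (hu : ContDiffAt ℝ 2 u (γ t)) (hγ : HasDerivAt γ v t) :
    HasDerivAt (fun s => u (γ s)) (fderiv ℝ u (γ t) v) t :=
  (hu.differentiableAt (by norm_num)).hasFDerivAt.comp_hasDerivAt t hγ

lemma hasDerivAt_fderiv_comp_curve {u : E2 → ℝ} {γ v : ℝ → E2} {v' a : E2} {t : ℝ}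
    (hu : ContDiffAt ℝ 2 u (γ t)) (hγ : HasDerivAt γ v' t) (hv : HasDerivAt v a t) :
    HasDerivAt (fun s => fderiv ℝ u (γ s) (v s))
      (fderiv ℝ (fderiv ℝ u) (γ t) v' (v t) + fderiv ℝ u (γ t) a) t := by
  have hd : DifferentiableAt ℝ (fderiv ℝ u) (γ t) :=
    (hu.fderiv_right (m := 1) (by norm_num)).differentiableAt (by norm_num)
  exact (hd.hasFDerivAt.comp_hasDerivAt t hγ).clm_apply hv

/-- First and second derivatives of a function along a line. -/
lemma hasDerivAt_line {u : E2 → ℝ} {x : E2} (v : E2)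
    (hu : ∀ᶠ y in 𝓝 x, ContDiffAt ℝ 2 u y) :
    (∀ᶠ t in 𝓝 (0 : ℝ), HasDerivAt (fun t => u (x + t • v)) (fderiv ℝ u (x + t • v) v) t) ∧
    HasDerivAt (fun t : ℝ => fderiv ℝ u (x + t • v) v) (fderiv ℝ (fderiv ℝ u) x v v) 0 := by
  have hl : ∀ t : ℝ, HasDerivAt (fun t : ℝ => x + t • v) v t := fun t => by
    simpa using ((hasDerivAt_id t).smul_const v).const_add x
  have hc : Tendsto (fun t : ℝ => x + t • v) (𝓝 0) (𝓝 x) := by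
    simpa using (hl 0).continuousAt.tendsto
  constructor
  · filter_upwards [hc.eventually hu] with t ht
    exact hasDerivAt_comp_curve (γ := fun t : ℝ => x + t • v) ht (hl t)
  · have := hasDerivAt_fderiv_comp_curve (u := u) (γ := fun t : ℝ => x + t • v)
      (v := fun _ => v) (t := 0) (by simpa using hu.self_of_nhds) (hl 0)
      (hasDerivAt_const (0 : ℝ) v)
    simpa using this

lemma eventually_contDiffAt {u : E2 → ℝ} (hu : ContDiffOn ℝ 2 u (ball 0 1)) {x : E2}
    (hx : x ∈ ball (0 : E2) 1) : ∀ᶠ y in 𝓝 x, ContDiffAt ℝ 2 u y := by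
  filter_upwards [isOpen_ball.mem_nhds hx] with y hy
  exact hu.contDiffAt (isOpen_ball.mem_nhds hy)

lemma lap_nonpos_of_isLocalMax_sub {u : E2 → ℝ} {x : E2} {c k : ℝ}
    (hu : ∀ᶠ y in 𝓝 x, ContDiffAt ℝ 2 u y)
    (hmax : IsLocalMax (fun y => u y - c * (k - ‖y‖ ^ 2)) x) : lap u x + 4 * c ≤ 0 := by
  have key : ∀ θ : ℝ, fderiv ℝ (fderiv ℝ u) x (polar 1 θ) (polar 1 θ) + 2 * c ≤ 0 := by
    intro θ
    set v := polar 1 θ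
    have hv : ‖v‖ = 1 := by rw [norm_polar]; simp
    obtain ⟨h1, h2⟩ := hasDerivAt_line v hu
    have hn : ∀ t : ℝ, ‖x + t • v‖ ^ 2 = ‖x‖ ^ 2 + 2 * t * inner ℝ x v + t ^ 2 := by
      intro t
      rw [norm_add_sq_real, norm_smul, hv, inner_smul_right, Real.norm_eq_abs, mul_one, sq_abs]
      ring
    have hq : ∀ t : ℝ, HasDerivAt (fun t : ℝ => c * (k - ‖x + t • v‖ ^ 2))
        (c * (-(2 * inner ℝ x v + 2 * t))) t := by
      intro t
      simp only [hn]
      have := (((hasDerivAt_id t).const_mul 2).mul_const (inner ℝ x v)).const_add (‖x‖ ^ 2)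
      have h3 := ((this.add ((hasDerivAt_id t).pow 2)).const_sub k).const_mul c
      refine h3.congr_deriv ?_
      simp
    have hg : ∀ᶠ t in 𝓝 (0 : ℝ), HasDerivAt
        (fun t => u (x + t • v) - c * (k - ‖x + t • v‖ ^ 2))
        (fderiv ℝ u (x + t • v) v - c * (-(2 * inner ℝ x v + 2 * t))) t :=
      h1.mono fun t ht => ht.sub (hq t)
    have hg' : HasDerivAt (fun t => fderiv ℝ u (x + t • v) v - c * (-(2 * inner ℝ x v + 2 * t)))
        (fderiv ℝ (fderiv ℝ u) x v v + 2 * c) 0 := by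
      have := (((hasDerivAt_id (0 : ℝ)).const_mul 2).const_add (2 * inner ℝ x v)).neg.const_mul c
      refine (h2.sub this).congr_deriv ?_
      ring
    refine second_deriv_nonpos hg hg' ?_
    have hc : Tendsto (fun t : ℝ => x + t • v) (𝓝 0) (𝓝 x) := by
      have : Continuous (fun t : ℝ => x + t • v) := by fun_prop
      simpa using this.tendsto 0
    have := hc.eventually hmax
    simpa [IsLocalMax, IsMaxFilter] using this
  rw [lap_eq_frame hu.self_of_nhds 0]
  linarith [key 0, key (0 + π / 2)]

lemma lap_neg (u : E2 → ℝ) (x : E2) : lap (fun y => -u y) x = -lap u x := by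
  simp [lap, fderiv_fun_neg, Finset.sum_neg_distrib]

lemma le_barrier {u : E2 → ℝ} {K : ℝ} (hK : 0 < K) (hu : ContDiffOn ℝ 2 u (ball 0 1))
    (hc : ContinuousOn u (closedBall 0 1)) (h0 : ∀ x : E2, ‖x‖ = 1 → u x = 0)
    (hlap : ∀ x ∈ ball (0 : E2) 1, |lap u x| ≤ K) {x : E2} (hx : x ∈ closedBall (0 : E2) 1) :
    u x ≤ K / 2 * (1 - ‖x‖ ^ 2) := by
  obtain ⟨y, hy, hmax⟩ := (isCompact_closedBall (0 : E2) 1).exists_isMaxOn ⟨x, hx⟩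
    (f := fun y => u y - K / 2 * (1 - ‖y‖ ^ 2)) (hc.sub (by fun_prop))
  have hxy := hmax hx
  simp only [Set.mem_ofPred_eq] at hxy
  by_cases hy1 : ‖y‖ = 1
  · rw [h0 y hy1, hy1] at hxy; linarith
  have hyb : y ∈ ball (0 : E2) 1 := by
    rw [mem_ball_zero_iff]; exact lt_of_le_of_ne (by simpa using hy) hy1
  have := lap_nonpos_of_isLocalMax_sub (eventually_contDiffAt hu hyb)
    (hmax.isLocalMax (mem_of_superset (isOpen_ball.mem_nhds hyb) ball_subset_closedBall))
  linarith [neg_abs_le (lap u y), hlap y hyb]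

lemma abs_le_barrier {u : E2 → ℝ} {K : ℝ} (hK : 0 < K) (hu : ContDiffOn ℝ 2 u (ball 0 1))
    (hc : ContinuousOn u (closedBall 0 1)) (h0 : ∀ x : E2, ‖x‖ = 1 → u x = 0)
    (hlap : ∀ x ∈ ball (0 : E2) 1, |lap u x| ≤ K) {x : E2} (hx : x ∈ closedBall (0 : E2) 1) :
    |u x| ≤ K * (1 - ‖x‖) := by
  have h1 := le_barrier hK hu hc h0 hlap hx
  have h2 := le_barrier (u := fun y => -u y) hK hu.neg hc.neg (fun x hx => by simp [h0 x hx])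
    (fun x hx => by rw [lap_neg, abs_neg]; exact hlap x hx) hx
  have hx1 : ‖x‖ ≤ 1 := by simpa using hx
  have h3 : K / 2 * (1 - ‖x‖ ^ 2) ≤ K * (1 - ‖x‖) := by
    nlinarith [mul_nonneg hK.le (sq_nonneg (1 - ‖x‖))]
  exact abs_le.2 ⟨by linarith, by linarith⟩

/-- Global Lipschitz estimate for the Poisson equation with bounded right-hand side, by
doubling of variables. -/
lemma sub_le_of_lap_bounded {u : E2 → ℝ} {K : ℝ} (hK : 0 < K)
    (hu : ContDiffOn ℝ 2 u (ball 0 1))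
    (hc : ContinuousOn u (closedBall 0 1)) (h0 : ∀ x : E2, ‖x‖ = 1 → u x = 0)
    (hlap : ∀ x ∈ ball (0 : E2) 1, |lap u x| ≤ K) {x y : E2} (hx : x ∈ closedBall (0 : E2) 1)
    (hy : y ∈ closedBall (0 : E2) 1) : u x - u y ≤ 2 * K * ‖x - y‖ := by
  suffices h : u x - u y - (2 * K * ‖x - y‖ - K / 2 * ‖x - y‖ ^ 2) ≤ 0 by
    nlinarith [mul_nonneg hK.le (sq_nonneg ‖x - y‖)]
  let Φ : E2 × E2 → ℝ := fun q => u q.1 - u q.2 - (2 * K * ‖q.1 - q.2‖ - K / 2 * ‖q.1 - q.2‖ ^ 2)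
  have hcomp := (isCompact_closedBall (0 : E2) 1).prod (isCompact_closedBall (0 : E2) 1)
  have hΦ : ContinuousOn Φ (closedBall 0 1 ×ˢ closedBall 0 1) := by
    refine ContinuousOn.sub (ContinuousOn.sub ?_ ?_) (by fun_prop)
    · exact hc.comp continuousOn_fst fun q hq => hq.1
    · exact hc.comp continuousOn_snd fun q hq => hq.2
  obtain ⟨⟨a, b⟩, ⟨ha, hb⟩, hmax⟩ := hcomp.exists_isMaxOn ⟨(x, y), hx, hy⟩ hΦ
  refine le_trans (hmax (⟨hx, hy⟩ : (x, y) ∈ closedBall (0 : E2) 1 ×ˢ closedBall (0 : E2) 1)) ?_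
  by_contra hpos
  push Not at hpos
  simp only [Φ] at hpos
  simp only at ha hb
  have ha1 : ‖a‖ ≤ 1 := by simpa using ha
  have hb1 : ‖b‖ ≤ 1 := by simpa using hb
  have hs2 : ‖a - b‖ ≤ 2 := (norm_sub_le a b).trans (by linarith)
  have hs0 : 0 ≤ ‖a - b‖ := norm_nonneg _
  have hω : K * ‖a - b‖ ≤ 2 * K * ‖a - b‖ - K / 2 * ‖a - b‖ ^ 2 := by
    nlinarith [mul_nonneg (mul_nonneg hK.le hs0) (sub_nonneg.2 hs2)]
  have hab : a ≠ b := by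
    rintro rfl; simp at hpos
  have hane : ‖a‖ ≠ 1 := by
    intro h
    have := (abs_le.1 (abs_le_barrier hK hu hc h0 hlap hb)).1
    have h4 : 1 - ‖b‖ ≤ ‖a - b‖ := by rw [← h]; exact norm_sub_norm_le a b
    rw [h0 a h] at hpos
    nlinarith [mul_le_mul_of_nonneg_left h4 hK.le]
  have hbne : ‖b‖ ≠ 1 := by
    intro h
    have := (abs_le.1 (abs_le_barrier hK hu hc h0 hlap ha)).2
    have h4 : 1 - ‖a‖ ≤ ‖a - b‖ := by rw [← h, norm_sub_rev]; exact norm_sub_norm_le b a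
    rw [h0 b h] at hpos
    nlinarith [mul_le_mul_of_nonneg_left h4 hK.le]
  have hab1 : a ∈ ball (0 : E2) 1 := by
    rw [mem_ball_zero_iff]; exact lt_of_le_of_ne ha1 hane
  have hbb1 : b ∈ ball (0 : E2) 1 := by
    rw [mem_ball_zero_iff]; exact lt_of_le_of_ne hb1 hbne
  have hloc : ∀ᶠ q in 𝓝 (a, b), Φ q ≤ Φ (a, b) := by
    have : closedBall (0 : E2) 1 ×ˢ closedBall (0 : E2) 1 ∈ 𝓝 (a, b) :=
      prod_mem_nhds (mem_of_superset (isOpen_ball.mem_nhds hab1) ball_subset_closedBall)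
        (mem_of_superset (isOpen_ball.mem_nhds hbb1) ball_subset_closedBall)
    exact hmax.isLocalMax this
  obtain ⟨θ, hθ⟩ := exists_polar (a - b)
  set s := ‖a - b‖ with hs
  have hspos : 0 < s := norm_pos_iff.2 (sub_ne_zero.2 hab)
  set e := polar 1 θ with he
  set f := polar 1 (θ + π / 2) with hf
  have hnorm : ∀ θ, ‖polar 1 θ‖ = 1 := fun θ => by rw [norm_polar]; simp
  rw [polar_eq_smul] at hθ
  have hlim : ∀ v w : E2, Tendsto (fun t : ℝ => (a + t • v, b + t • w)) (𝓝 0) (𝓝 (a, b)) := by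
    intro v w
    have : Continuous (fun t : ℝ => (a + t • v, b + t • w)) := by fun_prop
    simpa using this.tendsto 0
  obtain ⟨hae, hae'⟩ := hasDerivAt_line e (eventually_contDiffAt hu hab1)
  obtain ⟨hbe, hbe'⟩ := hasDerivAt_line (-e) (eventually_contDiffAt hu hbb1)
  obtain ⟨haf, haf'⟩ := hasDerivAt_line f (eventually_contDiffAt hu hab1)
  obtain ⟨hbf, hbf'⟩ := hasDerivAt_line f (eventually_contDiffAt hu hbb1)
  have key1 : fderiv ℝ (fderiv ℝ u) a e e - fderiv ℝ (fderiv ℝ u) b e e + 4 * K ≤ 0 := by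
    have hω1 : ∀ t : ℝ, HasDerivAt (fun t : ℝ => 2 * K * (s + 2 * t) - K / 2 * (s + 2 * t) ^ 2)
        (4 * K - 2 * K * (s + 2 * t)) t := by
      intro t
      have h1 : HasDerivAt (fun t : ℝ => s + 2 * t) 2 t := by
        simpa using ((hasDerivAt_id t).const_mul 2).const_add s
      refine ((h1.const_mul (2 * K)).sub ((h1.pow 2).const_mul (K / 2))).congr_deriv ?_
      simp; ring
    have hω2 : HasDerivAt (fun t : ℝ => 4 * K - 2 * K * (s + 2 * t)) (-(4 * K)) 0 := by
      have h1 : HasDerivAt (fun t : ℝ => s + 2 * t) 2 0 := by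
        simpa using ((hasDerivAt_id (0 : ℝ)).const_mul 2).const_add s
      refine ((h1.const_mul (2 * K)).const_sub (4 * K)).congr_deriv ?_
      ring
    have hg := (hae.and hbe).mono fun t ht => (ht.1.sub ht.2).sub (hω1 t)
    have := second_deriv_nonpos hg ((hae'.sub hbe').sub hω2) ?_
    · simp only [map_neg, neg_apply, neg_neg] at this
      linarith
    · have hnn : ∀ᶠ t in 𝓝 (0 : ℝ), ‖(a + t • e) - (b + t • (-e))‖ = s + 2 * t := by
        filter_upwards [Ioi_mem_nhds (show -(s / 2) < 0 by linarith)] with t ht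
        have : (a + t • e) - (b + t • (-e)) = (s + 2 * t) • e := by
          rw [add_smul, ← hθ]; module
        rw [this, norm_smul, hnorm, mul_one, Real.norm_eq_abs, abs_of_nonneg]
        have : -(s / 2) < t := ht
        linarith
      filter_upwards [hnn, (hlim e (-e)).eventually hloc] with t h1 h2
      simp only [Φ] at h2
      rw [h1] at h2
      simpa [hs] using h2
  have key2 : fderiv ℝ (fderiv ℝ u) a f f - fderiv ℝ (fderiv ℝ u) b f f ≤ 0 := by
    refine second_deriv_nonpos ((haf.and hbf).mono fun t ht => ht.1.sub ht.2) (haf'.sub hbf') ?_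
    filter_upwards [(hlim f f).eventually hloc] with t h2
    simp only [Φ, add_sub_add_right_eq_sub] at h2
    simpa using h2
  have hla := lap_eq_frame (eventually_contDiffAt hu hab1).self_of_nhds θ
  have hlb := lap_eq_frame (eventually_contDiffAt hu hbb1).self_of_nhds θ
  have h5 := abs_le.1 (hlap a hab1)
  have h6 := abs_le.1 (hlap b hbb1)
  linarith [h5.1, h6.2]

/-- Coefficients of the entire function `jB β` with `J_β(r) = r^β jB β (r²)`. -/
def jCoef (β : ℝ) (k : ℕ) : ℝ :=
  (-1 : ℝ) ^ k / (Nat.factorial k * Real.Gamma ((k : ℝ) + 1 + β)) / 4 ^ k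

/-- The entire part of the Bessel function: `J_β(r) = r^β jB β (r²)`. -/
def jB (β t : ℝ) : ℝ := ∑' k : ℕ, jCoef β k * t ^ k

lemma besselJ_eq (β r : ℝ) : besselJ β r = r ^ β * jB β (r ^ 2) := by
  unfold besselJ jB jCoef
  congr 1
  refine tsum_congr fun k => ?_
  rw [div_pow, pow_mul, pow_mul]
  norm_num
  ring

lemma gamma_nat_add_pos {β : ℝ} (hβ : 0 ≤ β) (k : ℕ) : 0 < Real.Gamma ((k : ℝ) + 1 + β) :=
  Real.Gamma_pos_of_pos (by positivity)

lemma gamma_nat_add_ge {β : ℝ} (hβ : 0 ≤ β) (k : ℕ) :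
    Real.Gamma (1 + β) ≤ Real.Gamma ((k : ℝ) + 1 + β) := by
  induction k with
  | zero => simp
  | succ k ih =>
    have h : ((k + 1 : ℕ) : ℝ) + 1 + β = ((k : ℝ) + 1 + β) + 1 := by push_cast; ring
    rw [h, Real.Gamma_add_one (by positivity)]
    have := gamma_nat_add_pos hβ k
    have hk : (0 : ℝ) ≤ k := by positivity
    nlinarith

lemma abs_jCoef_le {β : ℝ} (hβ : 0 ≤ β) (k : ℕ) :
    |jCoef β k| ≤ (Real.Gamma (1 + β))⁻¹ * (1 / (Nat.factorial k)) := by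
  have h1 := gamma_nat_add_pos hβ k
  have h2 := gamma_nat_add_ge hβ k
  have h3 : 0 < Real.Gamma (1 + β) := Real.Gamma_pos_of_pos (by positivity)
  have h4 : (0 : ℝ) < Nat.factorial k := by positivity
  have h5 : (1 : ℝ) ≤ 4 ^ k := one_le_pow₀ (by norm_num)
  unfold jCoef
  rw [abs_div, abs_div, abs_pow, abs_neg, abs_one, one_pow, abs_of_pos (by positivity : (0 : ℝ) <
    Nat.factorial k * Real.Gamma ((k : ℝ) + 1 + β)), abs_of_pos (by positivity : (0 : ℝ) < 4 ^ k)]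
  rw [div_div, inv_eq_one_div, one_div_mul_one_div]
  apply one_div_le_one_div_of_le (by positivity)
  calc Real.Gamma (1 + β) * (Nat.factorial k) ≤ Real.Gamma ((k : ℝ) + 1 + β) * Nat.factorial k := by
        gcongr
    _ = (Nat.factorial k * Real.Gamma ((k : ℝ) + 1 + β)) * 1 := by ring
    _ ≤ _ := by gcongr

lemma jCoef_succ {β : ℝ} (hβ : 0 ≤ β) (k : ℕ) :
    jCoef β (k + 1) * ((k : ℝ) + 1) = -(1 / 4) * jCoef (β + 1) k := by
  have h1 := (gamma_nat_add_pos hβ (k + 1)).ne'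
  unfold jCoef
  have h : ((k : ℝ) + 1 + (β + 1)) = ((k + 1 : ℕ) : ℝ) + 1 + β := by push_cast; ring
  rw [h, Nat.factorial_succ]
  push_cast at h1 ⊢
  have h4 : (Nat.factorial k : ℝ) ≠ 0 := by positivity
  have h5 : (k : ℝ) + 1 ≠ 0 := by positivity
  field_simp
  ring

lemma jCoef_raise {β : ℝ} (hβ : 0 ≤ β) (k : ℕ) :
    jCoef β k = ((k : ℝ) + 1 + β) * jCoef (β + 1) k := by
  have h1 := (gamma_nat_add_pos hβ k).ne'
  unfold jCoef
  have h : ((k : ℝ) + 1 + (β + 1)) = ((k : ℝ) + 1 + β) + 1 := by ring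
  rw [h, Real.Gamma_add_one (by positivity)]
  have h4 : (Nat.factorial k : ℝ) ≠ 0 := by positivity
  have h5 : (k : ℝ) + 1 + β ≠ 0 := by positivity
  field_simp

lemma summable_jCoef {β : ℝ} (hβ : 0 ≤ β) (t : ℝ) : Summable fun k => jCoef β k * t ^ k := by
  refine Summable.of_norm_bounded
    ((Real.summable_pow_div_factorial |t|).mul_left (Real.Gamma (1 + β))⁻¹) fun k => ?_
  rw [norm_mul, norm_pow, Real.norm_eq_abs, Real.norm_eq_abs]
  calc |jCoef β k| * |t| ^ k ≤ ((Real.Gamma (1 + β))⁻¹ * (1 / (Nat.factorial k))) * |t| ^ k := by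
        gcongr; exact abs_jCoef_le hβ k
    _ = _ := by ring

lemma hasDerivAt_jB {β : ℝ} (hβ : 0 ≤ β) (t : ℝ) :
    HasDerivAt (jB β) (-(1 / 4) * jB (β + 1) t) t := by
  set R := |t| + 1
  have hR : 0 < R := by positivity
  have hsum : Summable fun k : ℕ => |jCoef β k| * (k * R ^ (k - 1)) := by
    rw [← summable_nat_add_iff 1]
    refine Summable.of_norm_bounded ((Real.summable_pow_div_factorial R).mul_left
      (Real.Gamma (1 + β))⁻¹) fun k => ?_
    have h4 : (0 : ℝ) < Nat.factorial k := by positivity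
    have h5 : (0 : ℝ) < (k : ℝ) + 1 := by positivity
    rw [Real.norm_of_nonneg (by positivity), Nat.add_sub_cancel]
    calc |jCoef β (k + 1)| * (((k + 1 : ℕ) : ℝ) * R ^ k)
        ≤ ((Real.Gamma (1 + β))⁻¹ * (1 / (Nat.factorial (k + 1)))) *
            (((k + 1 : ℕ) : ℝ) * R ^ k) := by
          gcongr; exact abs_jCoef_le hβ (k + 1)
      _ = _ := by
          rw [Nat.factorial_succ]; push_cast; field_simp
  have htR : t ∈ ball (0 : ℝ) R := by
    rw [mem_ball_zero_iff, Real.norm_eq_abs]; linarith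
  have hmain := hasDerivAt_tsum_of_isPreconnected (g := fun k (y : ℝ) => jCoef β k * y ^ k)
    (g' := fun k y => jCoef β k * (k * y ^ (k - 1))) (t := ball 0 R) hsum isOpen_ball
    (convex_ball (0 : ℝ) R).isPreconnected
    (fun k y _ => (hasDerivAt_pow k y).const_mul _)
    (fun k y hy => by
      rw [mem_ball_zero_iff, Real.norm_eq_abs] at hy
      rw [norm_mul, norm_mul, norm_pow, Real.norm_eq_abs, Real.norm_eq_abs, Real.norm_eq_abs,
        Nat.abs_cast]
      gcongr)
    htR (summable_jCoef hβ t) htR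
  refine hmain.congr_deriv ?_
  have hs : Summable fun k : ℕ => jCoef β k * (k * t ^ (k - 1)) := by
    refine Summable.of_norm_bounded hsum fun k => ?_
    rw [norm_mul, norm_mul, norm_pow, Real.norm_eq_abs, Real.norm_eq_abs, Real.norm_eq_abs,
      Nat.abs_cast]
    gcongr
    linarith
  rw [hs.tsum_eq_zero_add]
  simp only [Nat.cast_zero, zero_mul, mul_zero, zero_add, Nat.add_sub_cancel]
  unfold jB
  rw [← tsum_mul_left]
  refine tsum_congr fun k => ?_
  push_cast
  linear_combination t ^ k * jCoef_succ hβ k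

lemma continuous_jB {β : ℝ} (hβ : 0 ≤ β) : Continuous (jB β) :=
  continuous_iff_continuousAt.2 fun t => (hasDerivAt_jB hβ t).continuousAt

/-- The Bessel equation in the variable `t = r²`. -/
lemma jB_recurrence {β : ℝ} (hβ : 0 ≤ β) (t : ℝ) :
    t / 4 * jB (β + 2) t - (1 + β) * jB (β + 1) t + jB β t = 0 := by
  have h1 := summable_jCoef (by linarith : 0 ≤ β + 1) t
  have h2 := summable_jCoef (by linarith : 0 ≤ β + 2) t
  have h0 := summable_jCoef hβ t
  have hterm : ∀ k : ℕ, jCoef β k * t ^ k - (1 + β) * (jCoef (β + 1) k * t ^ k) =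
      (k : ℝ) * jCoef (β + 1) k * t ^ k := by
    intro k
    linear_combination t ^ k * jCoef_raise hβ k
  have hd : jB β t - (1 + β) * jB (β + 1) t = ∑' k : ℕ, (k : ℝ) * jCoef (β + 1) k * t ^ k := by
    unfold jB
    rw [← tsum_mul_left, ← h0.tsum_sub (h1.mul_left _)]
    exact tsum_congr hterm
  have hs : Summable fun k : ℕ => (k : ℝ) * jCoef (β + 1) k * t ^ k :=
    (h0.sub (h1.mul_left (1 + β))).congr hterm
  rw [hs.tsum_eq_zero_add] at hd
  have h3 : ∑' k : ℕ, ((k + 1 : ℕ) : ℝ) * jCoef (β + 1) (k + 1) * t ^ (k + 1)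
      = -(t / 4) * jB (β + 2) t := by
    unfold jB
    rw [← tsum_mul_left]
    refine tsum_congr fun k => ?_
    have := jCoef_succ (by linarith : 0 ≤ β + 1) k
    rw [show β + 1 + 1 = β + 2 by ring] at this
    push_cast
    linear_combination t ^ (k + 1) * this
  rw [h3] at hd
  simp at hd
  linarith

lemma jB_zero_pos {β : ℝ} (hβ : 0 ≤ β) : 0 < jB β 0 := by
  unfold jB
  rw [tsum_eq_single 0 (fun k hk => by simp [hk])]
  have := gamma_nat_add_pos hβ 0
  simp only [jCoef, pow_zero, Nat.factorial_zero, Nat.cast_one, one_mul, div_one, mul_one]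
  positivity

lemma jB_zero_zero : jB 0 0 = 1 := by
  unfold jB
  rw [tsum_eq_single 0 (fun k hk => by simp [hk])]
  simp [jCoef]

/-- Derivative of the Bessel-type profile `r ↦ r^b jB β (s r^c)`, `b = β c / 2`. -/
lemma hasDerivAt_profile {β c : ℝ} (hβ : 0 ≤ β) (s : ℝ) {r : ℝ} (hr : 0 < r) :
    HasDerivAt (fun r => r ^ (β * c / 2) * jB β (s * r ^ c))
      (r ^ (β * c / 2) * (β * c / 2 * jB β (s * r ^ c)
        - c / 4 * (s * r ^ c) * jB (β + 1) (s * r ^ c)) / r) r := by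
  have h1 := Real.hasDerivAt_rpow_const (p := β * c / 2) (Or.inl hr.ne')
  have h2 := (Real.hasDerivAt_rpow_const (p := c) (Or.inl hr.ne')).const_mul s
  have h3 := (hasDerivAt_jB hβ (s * r ^ c)).comp r h2
  refine (h1.mul h3).congr_deriv ?_
  rw [Real.rpow_sub hr, Real.rpow_sub hr, Real.rpow_one]
  simp only [Function.comp_apply]
  field_simp
  ring

lemma hasDerivAt_profile_flux {β c : ℝ} (hβ : 0 ≤ β) (s : ℝ) {r : ℝ} (hr : 0 < r) :
    HasDerivAt (fun r => r ^ (β * c / 2) * (β * c / 2 * jB β (s * r ^ c)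
        - c / 4 * (s * r ^ c) * jB (β + 1) (s * r ^ c)))
      (((β * c / 2) ^ 2 - (c / 2) ^ 2 * s * r ^ c) *
        (r ^ (β * c / 2) * jB β (s * r ^ c)) / r) r := by
  have h1 := Real.hasDerivAt_rpow_const (p := β * c / 2) (Or.inl hr.ne')
  have h2 := (Real.hasDerivAt_rpow_const (p := c) (Or.inl hr.ne')).const_mul s
  have h3 := (hasDerivAt_jB hβ (s * r ^ c)).comp r h2
  have h4 := (hasDerivAt_jB (by linarith : 0 ≤ β + 1) (s * r ^ c)).comp r h2
  have h5 := (h3.const_mul (β * c / 2)).sub ((h2.const_mul (c / 4)).mul h4)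
  refine (h1.mul h5).congr_deriv ?_
  have hrec := jB_recurrence hβ (s * r ^ c)
  rw [Real.rpow_sub hr, Real.rpow_sub hr, Real.rpow_one]
  simp only [Function.comp_apply, Pi.sub_apply, Pi.mul_apply, show β + 1 + 1 = β + 2 by ring]
  have h6 : jB β (s * r ^ c) = (1 + β) * jB (β + 1) (s * r ^ c)
    - s * r ^ c / 4 * jB (β + 2) (s * r ^ c) := by linarith
  rw [h6]
  field_simp
  ring

lemma pos_of_ne_zero_Ioo {f : ℝ → ℝ} (hf : Continuous f) {a b : ℝ} (ha : 0 < f a)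
    (hne : ∀ t ∈ Set.Ioo a b, f t ≠ 0) : ∀ t ∈ Set.Ico a b, 0 < f t := by
  intro t ht
  by_contra hneg
  push Not at hneg
  obtain ⟨u, hu, hu0⟩ := intermediate_value_Icc' ht.1 hf.continuousOn ⟨hneg, ha.le⟩
  have hua : a ≠ u := by rintro rfl; exact ha.ne' hu0
  exact hne u ⟨lt_of_le_of_ne hu.1 hua, hu.2.trans_lt ht.2⟩ hu0

lemma jB_ne_zero_of_besselJ {β r : ℝ} (h : besselJ β r ≠ 0) : jB β (r ^ 2) ≠ 0 := by
  intro h0; exact h (by rw [besselJ_eq, h0, mul_zero])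

lemma jB_eq_zero_of_besselJ {β r : ℝ} (hr : 0 < r) (h : besselJ β r = 0) : jB β (r ^ 2) = 0 := by
  rw [besselJ_eq] at h
  exact (mul_eq_zero.1 h).resolve_left (Real.rpow_pos_of_pos hr β).ne'

lemma sqrt_mem_Ioo {t z : ℝ} (hz : 0 < z) (ht : t ∈ Set.Ioo 0 (z ^ 2)) : √t ∈ Set.Ioo 0 z :=
  ⟨Real.sqrt_pos.2 ht.1, (Real.sqrt_lt' hz).2 ht.2⟩

lemma jB_pos_of_isNthZero_one {β z : ℝ} (hβ : 0 ≤ β) (hz : IsNthZero β 1 z) :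
    ∀ t ∈ Set.Ico 0 (z ^ 2), 0 < jB β t := by
  obtain ⟨hz0, -, hcard⟩ := hz
  have hempty : {r ∈ Set.Ioo 0 z | besselJ β r = 0} = ∅ := by
    rw [← Set.encard_eq_zero, hcard]; simp
  refine pos_of_ne_zero_Ioo (continuous_jB hβ) (jB_zero_pos hβ) fun t ht => ?_
  have hs := sqrt_mem_Ioo hz0 ht
  have : besselJ β √t ≠ 0 := fun h0 => by
    have : √t ∈ ({r ∈ Set.Ioo 0 z | besselJ β r = 0} : Set ℝ) := ⟨hs, h0⟩
    rw [hempty] at this; exact this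
  have h := jB_ne_zero_of_besselJ this
  rwa [Real.sq_sqrt ht.1.le] at h

lemma antitoneOn_bessel_energy :
    AntitoneOn (fun t => t * (-(1 / 4) * jB 1 t) ^ 2 + jB 0 t ^ 2 / 4) (Set.Ici 0) := by
  have hd : ∀ t, HasDerivAt (fun t => t * (-(1 / 4) * jB 1 t) ^ 2 + jB 0 t ^ 2 / 4)
      (-(-(1 / 4) * jB 1 t) ^ 2) t := by
    intro t
    have h0 := hasDerivAt_jB le_rfl t
    have h1 := hasDerivAt_jB zero_le_one t
    have hrec := jB_recurrence le_rfl t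
    norm_num at h0 h1 hrec
    refine (((hasDerivAt_id t).mul ((h1.const_mul (-(1 / 4))).pow 2)).add
      ((h0.pow 2).div_const 4)).congr_deriv ?_
    simp
    linear_combination (-(1 / 8) * jB 1 t) * hrec
  refine antitoneOn_of_deriv_nonpos (convex_Ici 0)
    (fun t _ => (hd t).continuousAt.continuousWithinAt)
    (fun t _ => (hd t).differentiableAt.differentiableWithinAt) fun t _ => ?_
  rw [(hd t).deriv]
  linarith [sq_nonneg (-(1 / 4) * jB 1 t)]

lemma abs_jB_zero_le_one {t : ℝ} (ht : 0 ≤ t) : |jB 0 t| ≤ 1 := by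
  have := antitoneOn_bessel_energy (Set.mem_Ici.2 le_rfl) (Set.mem_Ici.2 ht) ht
  simp only [jB_zero_zero] at this
  rw [← sq_le_one_iff_abs_le_one]
  nlinarith [mul_nonneg ht (sq_nonneg (-(1 / 4) * jB 1 t))]

/-- Sign pattern of `J_0` up to its second zero, in the variable `t = r²`. -/
lemma exists_first_zero {z : ℝ} (hz : IsNthZero 0 2 z) : ∃ T, 0 < T ∧ T < z ^ 2 ∧ jB 0 T = 0 ∧
    (∀ t ∈ Set.Ico 0 T, 0 < jB 0 t) ∧ (∀ t ∈ Set.Ioo T (z ^ 2), jB 0 t < 0) ∧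
    jB 0 (z ^ 2) = 0 := by
  obtain ⟨hz0, hzz, hcard⟩ := hz
  obtain ⟨z1, hz1⟩ := Set.encard_eq_one.1 (hcard.trans (by norm_num))
  have hmem : z1 ∈ ({r ∈ Set.Ioo 0 z | besselJ 0 r = 0} : Set ℝ) := by rw [hz1]; rfl
  obtain ⟨⟨h1, h2⟩, h3⟩ := hmem
  have hT0 := jB_eq_zero_of_besselJ h1 h3
  have hcont := continuous_jB (le_refl (0 : ℝ))
  have hTz : z1 ^ 2 < z ^ 2 := by gcongr
  have hne : ∀ t ∈ Set.Ioo 0 (z ^ 2), t ≠ z1 ^ 2 → jB 0 t ≠ 0 := by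
    intro t ht htne
    have hs := sqrt_mem_Ioo hz0 ht
    have : besselJ 0 √t ≠ 0 := fun h0 => by
      have : √t ∈ ({r ∈ Set.Ioo 0 z | besselJ 0 r = 0} : Set ℝ) := ⟨hs, h0⟩
      rw [hz1, Set.mem_singleton_iff] at this
      exact htne (by rw [← this, Real.sq_sqrt ht.1.le])
    have h := jB_ne_zero_of_besselJ this
    rwa [Real.sq_sqrt ht.1.le] at h
  have hpos : ∀ t ∈ Set.Ico 0 (z1 ^ 2), 0 < jB 0 t :=
    pos_of_ne_zero_Ioo hcont (jB_zero_pos le_rfl) fun t ht =>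
      hne t ⟨ht.1, ht.2.trans hTz⟩ ht.2.ne
  refine ⟨z1 ^ 2, by positivity, hTz, hT0, hpos, ?_, jB_eq_zero_of_besselJ hz0 hzz⟩
  by_contra hcon
  push Not at hcon
  obtain ⟨t0, ht0, hJ0⟩ := hcon
  have hT1 : 0 < z1 ^ 2 := by positivity
  have hJ0' : 0 < jB 0 t0 :=
    lt_of_le_of_ne hJ0 (hne t0 ⟨hT1.trans ht0.1, ht0.2⟩ ht0.1.ne').symm
  have hpos2 : ∀ t ∈ Set.Ioo (z1 ^ 2) t0, 0 < jB 0 t := by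
    intro t ht
    have hc2 : Continuous fun t => jB 0 (-t) := hcont.comp continuous_neg
    have := pos_of_ne_zero_Ioo (f := fun t => jB 0 (-t)) (a := -t0) (b := -z1 ^ 2) hc2
      (by simpa using hJ0') (fun u hu => hne (-u) ⟨by linarith [hu.2], by linarith [hu.1, ht0.2]⟩
        (by linarith [hu.2] : z1 ^ 2 < -u).ne') (-t) ⟨by linarith [ht.2], by linarith [ht.1]⟩
    simpa using this
  have hmin : IsLocalMin (jB 0) (z1 ^ 2) := by
    filter_upwards [Ioo_mem_nhds hT1 ht0.1] with t ht
    rw [hT0]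
    rcases lt_trichotomy t (z1 ^ 2) with h | h | h
    · exact (hpos t ⟨ht.1.le, h⟩).le
    · rw [h, hT0]
    · exact (hpos2 t ⟨h, ht.2⟩).le
  have hder := hmin.hasDerivAt_eq_zero (hasDerivAt_jB le_rfl (z1 ^ 2))
  norm_num at hder
  have := antitoneOn_bessel_energy (Set.mem_Ici.2 hT1.le) (Set.mem_Ici.2 (hT1.trans ht0.1).le)
    ht0.1.le
  simp only [hder, hT0] at this
  nlinarith [mul_nonneg (hT1.trans ht0.1).le (sq_nonneg (-(1 / 4) * jB 1 t0)),
    mul_pos hJ0' hJ0']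

/-- A positive strict radial supersolution in a sector: the radial factor. -/
lemma exists_sector_barrier {α β z ν : ℝ} (hα : 0 ≤ α) (hβ : 0 < β)
    (hz : IsNthZero β 1 z) (hν : (2 + α) * β / 2 < ν) :
    ∃ (b δ ε : ℝ) (K K1 K2 : ℝ → ℝ), 0 < b ∧ b < ν ∧ 0 < δ ∧ 0 < ε ∧ Continuous K ∧
      ∀ r, 0 < r → r ≤ 1 → ε ≤ K r ∧ HasDerivAt K (K1 r) r ∧ HasDerivAt K1 (K2 r) r ∧
        K2 r + K1 r / r - b ^ 2 / r ^ 2 * K r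
          + (((2 + α) / 2 * z) ^ 2 + δ) * r ^ α * K r < 0 := by
  obtain ⟨c, hc⟩ : ∃ c, c = 2 + α := ⟨_, rfl⟩
  have hc0 : 0 < c := by rw [hc]; positivity
  obtain ⟨b0, hb0⟩ : ∃ b0, b0 = β * c / 2 := ⟨_, rfl⟩
  have hb0pos : 0 < b0 := by rw [hb0]; positivity
  have hb0ν : b0 < ν := by rw [hb0, hc, mul_comm β]; exact hν
  obtain ⟨b, hb⟩ : ∃ b, b = (b0 + ν) / 2 := ⟨_, rfl⟩
  have hbpos : 0 < b := by linarith
  obtain ⟨γ, hγ⟩ : ∃ γ, γ = b ^ 2 - b0 ^ 2 := ⟨_, rfl⟩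
  have hγ0 : 0 < γ := by rw [hγ, hb]; nlinarith
  have hz0 := hz.1
  obtain ⟨σ, hσ⟩ : ∃ σ, σ = min (z ^ 2 / 2) (γ / c ^ 2) := ⟨_, rfl⟩
  have hσ0 : 0 < σ := hσ ▸ lt_min (by positivity) (by positivity)
  have hσ1 : σ ≤ z ^ 2 / 2 := hσ ▸ min_le_left _ _
  have hσ2 : σ * c ^ 2 ≤ γ := by
    have := min_le_right (z ^ 2 / 2) (γ / c ^ 2)
    rwa [← hσ, le_div_iff₀ (by positivity)] at this
  obtain ⟨s, hs⟩ : ∃ s, s = z ^ 2 - σ := ⟨_, rfl⟩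
  have hs0 : 0 < s := by have : 0 < z ^ 2 := by positivity
                         linarith
  obtain ⟨Λ, hΛ⟩ : ∃ Λ, Λ = (c / 2 * z) ^ 2 + γ / 4 := ⟨_, rfl⟩
  have hΛ0 : 0 < Λ := by rw [hΛ]; positivity
  set h : ℝ → ℝ := fun r => r ^ b0 * jB β (s * r ^ c) with hh
  have hcont : Continuous h :=
    (Real.continuous_rpow_const hb0pos.le).mul ((continuous_jB hβ.le).comp
      (continuous_const.mul (Real.continuous_rpow_const hc0.le)))
  have hpos : ∀ r, 0 < r → r ≤ 1 → 0 < h r := by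
    intro r hr hr1
    refine mul_pos (Real.rpow_pos_of_pos hr _) (jB_pos_of_isNthZero_one hβ.le hz _ ⟨?_, ?_⟩)
    · positivity
    · have : r ^ c ≤ 1 := Real.rpow_le_one hr.le hr1 hc0.le
      nlinarith
  set P : ℝ → ℝ := fun r => r ^ b0 * (b0 * jB β (s * r ^ c)
        - c / 4 * (s * r ^ c) * jB (β + 1) (s * r ^ c)) with hP
  have hprof : ∀ r, 0 < r → HasDerivAt h (P r / r) r := fun r hr =>
    by rw [hh, hP, hb0]; exact hasDerivAt_profile hβ.le s hr
  have hflux : ∀ r, 0 < r →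
      HasDerivAt P ((b0 ^ 2 - (c / 2) ^ 2 * s * r ^ c) * h r / r) r := fun r hr =>
    by rw [hh, hP, hb0]; exact hasDerivAt_profile_flux hβ.le s hr
  clear_value h P
  obtain ⟨r1, hr1, hr1'⟩ : ∃ r1 > 0, ∀ r, 0 < r → r < r1 → Λ * r ^ c < b ^ 2 := by
    have h1 : Tendsto (fun r : ℝ => Λ * r ^ c) (𝓝 0) (𝓝 0) := by
      have := ((Real.continuous_rpow_const hc0.le).const_mul Λ).tendsto 0
      rwa [Real.zero_rpow hc0.ne', mul_zero] at this
    obtain ⟨r1, hr1, hball⟩ := Metric.eventually_nhds_iff.1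
      (h1.eventually_lt_const (show (0 : ℝ) < b ^ 2 by positivity))
    exact ⟨r1, hr1, fun r hr hrr =>
      hball (by rw [Real.dist_eq, sub_zero, abs_of_pos hr]; exact hrr)⟩
  obtain ⟨h0, hh0, hh0'⟩ : ∃ h0 > 0, ∀ r, r1 ≤ r → r ≤ 1 → h0 ≤ h r := by
    by_cases hne : r1 ≤ 1
    · obtain ⟨q, hq, hmin⟩ := isCompact_Icc.exists_isMinOn (Set.nonempty_Icc.2 hne)
        hcont.continuousOn
      exact ⟨h q, hpos q (hr1.trans_le hq.1) hq.2, fun r h1 h2 => hmin ⟨h1, h2⟩⟩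
    · exact ⟨1, one_pos, fun r h1 h2 => absurd (h1.trans h2) hne⟩
  obtain ⟨ε, hε⟩ : ∃ ε, ε = γ * h0 / (4 * Λ) := ⟨_, rfl⟩
  have hε0 : 0 < ε := by rw [hε]; positivity
  refine ⟨b, γ / 4, ε, fun r => h r + ε, fun r => P r / r,
    fun r => ((b0 ^ 2 - (c / 2) ^ 2 * s * r ^ c) * h r / r * r - P r * 1) / r ^ 2,
    hbpos, by linarith, by positivity, hε0, hcont.add continuous_const, ?_⟩
  rw [← hc, ← hΛ]
  intro r hr hr1
  have hhr := hpos r hr hr1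
  refine ⟨by linarith, (hprof r hr).add_const ε,
    (hflux r hr).fun_div (hasDerivAt_id' r) hr.ne', ?_⟩
  have hrc : r ^ c = r ^ 2 * r ^ α := by
    rw [hc, Real.rpow_add hr, Real.rpow_two]
  have hrc1 : r ^ c ≤ 1 := Real.rpow_le_one hr.le hr1 hc0.le
  have hrc0 : 0 < r ^ c := Real.rpow_pos_of_pos hr c
  have heq : ((b0 ^ 2 - (c / 2) ^ 2 * s * r ^ c) * h r / r * r - P r * 1) / r ^ 2 + P r / r / r
      - b ^ 2 / r ^ 2 * (h r + ε) + Λ * r ^ α * (h r + ε) =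
      ((-γ + (Λ - (c / 2) ^ 2 * s) * r ^ c) * h r + ε * (Λ * r ^ c - b ^ 2)) / r ^ 2 := by
    rw [hrc, hγ]; field_simp; ring
  rw [heq]
  refine div_neg_of_neg_of_pos ?_ (by positivity)
  have h1 : Λ - (c / 2) ^ 2 * s ≤ γ / 2 := by
    rw [hΛ, hs]; nlinarith
  have h2 : (-γ + (Λ - (c / 2) ^ 2 * s) * r ^ c) ≤ -(γ / 2) := by
    have h3 : (Λ - (c / 2) ^ 2 * s) * r ^ c ≤ γ / 2 * r ^ c := by gcongr
    nlinarith
  have h3 : (-γ + (Λ - (c / 2) ^ 2 * s) * r ^ c) * h r ≤ -(γ / 2) * h r := by gcongr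
  by_cases hcase : r < r1
  · have h4 : ε * (Λ * r ^ c - b ^ 2) < 0 :=
      mul_neg_of_pos_of_neg hε0 (by linarith [hr1' r hr hcase])
    linarith [mul_pos hγ0 hhr]
  · push Not at hcase
    have h4 := hh0' r hcase hr1
    have h5 : ε * (Λ * r ^ c - b ^ 2) ≤ ε * Λ := by
      have : Λ * r ^ c - b ^ 2 ≤ Λ := by
        linarith [sq_nonneg b, mul_le_mul_of_nonneg_left hrc1 hΛ0.le]
      gcongr
    have h6 : ε * Λ = γ * h0 / 4 := by rw [hε]; field_simp
    linarith [mul_pos hγ0 hh0, mul_le_mul_of_nonneg_left h4 hγ0.le]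

/-- First radial derivative in polar coordinates. -/
def dRad (u : E2 → ℝ) (r θ : ℝ) : ℝ := fderiv ℝ u (polar r θ) (polar 1 θ)

/-- Second radial derivative in polar coordinates. -/
def dRadRad (u : E2 → ℝ) (r θ : ℝ) : ℝ :=
  fderiv ℝ (fderiv ℝ u) (polar r θ) (polar 1 θ) (polar 1 θ)

/-- First angular derivative in polar coordinates. -/
def dAng (u : E2 → ℝ) (r θ : ℝ) : ℝ := fderiv ℝ u (polar r θ) (polar r (θ + π / 2))

/-- Second angular derivative in polar coordinates. -/
def dAngAng (u : E2 → ℝ) (r θ : ℝ) : ℝ :=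
  fderiv ℝ (fderiv ℝ u) (polar r θ) (polar r (θ + π / 2)) (polar r (θ + π / 2))
    + fderiv ℝ u (polar r θ) (polar r (θ + π))

lemma polar_add_pi (r θ : ℝ) : polar r (θ + π) = -polar r θ := by
  ext i; fin_cases i <;> simp [polar, cos_add_pi, sin_add_pi]

lemma contDiffAt_polar {u : E2 → ℝ} (hu : ContDiffOn ℝ 2 u (ball 0 1)) {r : ℝ} (hr : |r| < 1)
    (θ : ℝ) :
    ContDiffAt ℝ 2 u (polar r θ) :=
  hu.contDiffAt (isOpen_ball.mem_nhds (by rw [mem_ball_zero_iff, norm_polar]; exact hr))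

lemma hasDerivAt_dRad {u : E2 → ℝ} (hu : ContDiffOn ℝ 2 u (ball 0 1)) {r : ℝ} (hr : |r| < 1)
    (θ : ℝ) :
    HasDerivAt (fun r => u (polar r θ)) (dRad u r θ) r :=
  hasDerivAt_comp_curve (γ := fun r => polar r θ) (contDiffAt_polar hu hr θ)
    (hasDerivAt_polar_radius r θ)

lemma hasDerivAt_dRadRad {u : E2 → ℝ} (hu : ContDiffOn ℝ 2 u (ball 0 1)) {r : ℝ} (hr : |r| < 1)
    (θ : ℝ) :
    HasDerivAt (fun r => dRad u r θ) (dRadRad u r θ) r := by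
  have := hasDerivAt_fderiv_comp_curve (γ := fun r => polar r θ) (v := fun _ => polar 1 θ)
    (contDiffAt_polar hu hr θ) (hasDerivAt_polar_radius r θ) (hasDerivAt_const r _)
  simp only [map_zero, add_zero] at this
  exact this

lemma hasDerivAt_dAng {u : E2 → ℝ} (hu : ContDiffOn ℝ 2 u (ball 0 1)) {r : ℝ} (hr : |r| < 1)
    (θ : ℝ) :
    HasDerivAt (fun θ => u (polar r θ)) (dAng u r θ) θ :=
  hasDerivAt_comp_curve (γ := fun θ => polar r θ) (contDiffAt_polar hu hr θ)
    (hasDerivAt_polar_angle r θ)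

lemma hasDerivAt_dAngAng {u : E2 → ℝ} (hu : ContDiffOn ℝ 2 u (ball 0 1)) {r : ℝ} (hr : |r| < 1)
    (θ : ℝ) :
    HasDerivAt (fun θ => dAng u r θ) (dAngAng u r θ) θ := by
  have h1 : HasDerivAt (fun θ => polar r (θ + π / 2)) (polar r (θ + π)) θ := by
    have := (hasDerivAt_polar_angle r (θ + π / 2)).comp_add_const θ (π / 2)
    rwa [show θ + π / 2 + π / 2 = θ + π by ring] at this
  exact hasDerivAt_fderiv_comp_curve (γ := fun θ => polar r θ) (v := fun θ => polar r (θ + π / 2))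
    (contDiffAt_polar hu hr θ) (hasDerivAt_polar_angle r θ) h1

lemma lap_polar {u : E2 → ℝ} (hu : ContDiffOn ℝ 2 u (ball 0 1)) {r : ℝ} (hr : |r| < 1)
    (θ : ℝ) (hr0 : 0 < r) :
    lap u (polar r θ) = dRadRad u r θ + dRad u r θ / r + dAngAng u r θ / r ^ 2 := by
  rw [lap_eq_frame (contDiffAt_polar hu hr θ) θ, dRadRad, dRad, dAngAng, polar_add_pi,
    polar_eq_smul r (θ + π / 2), map_neg]
  have : fderiv ℝ u (polar r θ) (polar r θ) = r * fderiv ℝ u (polar r θ) (polar 1 θ) := by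
    conv_lhs => rw [polar_eq_smul r θ]
    rw [map_smul, ← polar_eq_smul]; rfl
  rw [this]
  simp only [map_smul, smul_apply, smul_eq_mul]
  field_simp
  ring

lemma nInvariant.polar_neg {n : ℕ} {u : E2 → ℝ} (h : nInvariant n u) (r θ : ℝ) :
    u (polar r (-θ)) = u (polar r θ) := by
  rw [← h.1 (polar r θ)]
  congr 1
  ext i; fin_cases i <;> simp [polar, reflX]

lemma nInvariant.polar_add {n : ℕ} {u : E2 → ℝ} (h : nInvariant n u) (r θ : ℝ) :
    u (polar r (θ + 2 * π / n)) = u (polar r θ) := by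
  rw [← h.2 (polar r θ)]
  congr 1
  ext i; fin_cases i <;> simp [polar, rot2, cos_add, sin_add] <;> ring

lemma hasDerivAt_signed_rpow {p : ℝ} (hp : 1 < p) (s : ℝ) :
    HasDerivAt (fun s => |s| ^ (p - 1) * s) (p * |s| ^ (p - 1)) s := by
  rcases lt_trichotomy s 0 with h | rfl | h
  · have h1 := ((hasDerivAt_neg s).rpow_const (p := p - 1)
      (Or.inl (neg_ne_zero.2 h.ne))).mul (hasDerivAt_id s)
    have h2 : (fun s : ℝ => |s| ^ (p - 1) * s) =ᶠ[𝓝 s] ((fun s => (-s) ^ (p - 1)) * id) := by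
      filter_upwards [Iio_mem_nhds h] with t ht
      simp [abs_of_neg (show t < 0 from ht)]
    refine (h1.congr_of_eventuallyEq h2).congr_deriv ?_
    rw [abs_of_neg h, Real.rpow_sub_one (neg_ne_zero.2 h.ne) (p - 1)]
    have := h.ne
    simp only [id]
    field_simp
    ring
  · have hp0 : p - 1 ≠ 0 := by linarith
    rw [abs_zero, Real.zero_rpow hp0, mul_zero, hasDerivAt_iff_tendsto_slope]
    have h1 : Tendsto (fun s : ℝ => |s| ^ (p - 1)) (𝓝[≠] 0) (𝓝 0) := by
      have : Continuous fun s : ℝ => |s| ^ (p - 1) :=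
        (Real.continuous_rpow_const (by linarith)).comp continuous_abs
      have := this.tendsto 0
      rw [abs_zero, Real.zero_rpow hp0] at this
      exact this.mono_left nhdsWithin_le_nhds
    refine h1.congr' ?_
    filter_upwards [self_mem_nhdsWithin] with s hs
    have hs0 : s ≠ 0 := hs
    rw [slope_def_field]
    field_simp
    simp
  · have h1 := ((hasDerivAt_id s).rpow_const (p := p - 1) (Or.inl h.ne')).mul (hasDerivAt_id s)
    have h2 : (fun s : ℝ => |s| ^ (p - 1) * s) =ᶠ[𝓝 s] ((fun s => (id s) ^ (p - 1)) * id) := by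
      filter_upwards [Ioi_mem_nhds h] with t ht
      simp [abs_of_pos (show 0 < t from ht)]
    refine (h1.congr_of_eventuallyEq h2).congr_deriv ?_
    rw [abs_of_pos h, id, Real.rpow_sub_one h.ne' (p - 1)]
    field_simp
    ring

lemma signed_rpow_sub_le {p M a b : ℝ} (hp : 1 < p) (ha : |a| ≤ M) (hb : |b| ≤ M) (hab : b ≤ a) :
    |a| ^ (p - 1) * a - |b| ^ (p - 1) * b ≤ p * M ^ (p - 1) * (a - b) := by
  have hd : ∀ s, HasDerivAt (fun s => p * M ^ (p - 1) * s - |s| ^ (p - 1) * s)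
      (p * M ^ (p - 1) - p * |s| ^ (p - 1)) s := fun s => by
    refine HasDerivAt.sub ?_ (hasDerivAt_signed_rpow hp s)
    simpa using (hasDerivAt_id s).const_mul (p * M ^ (p - 1))
  have hmono : MonotoneOn (fun s => p * M ^ (p - 1) * s - |s| ^ (p - 1) * s) (Set.Icc (-M) M) := by
    refine monotoneOn_of_deriv_nonneg (convex_Icc _ _)
      (fun t _ => (hd t).continuousAt.continuousWithinAt)
      (fun t _ => (hd t).differentiableAt.differentiableWithinAt) fun t ht => ?_
    rw [(hd t).deriv]
    have ht' := interior_subset ht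
    have : |t| ^ (p - 1) ≤ M ^ (p - 1) :=
      Real.rpow_le_rpow (abs_nonneg t) (abs_le.2 ht') (by linarith)
    nlinarith
  have := hmono (abs_le.1 hb) (abs_le.1 ha) hab
  simp only at this
  linarith

lemma continuous_polar : Continuous fun q : ℝ × ℝ => polar q.1 q.2 := by
  have : (fun q : ℝ × ℝ => polar q.1 q.2) = fun q => q.1 • (cos q.2 •
      (EuclideanSpace.single 0 1 : E2) + sin q.2 • EuclideanSpace.single 1 1) := by
    ext1 q; rw [polar_eq_smul, polar_one_eq]
  rw [this]; fun_prop

lemma radial_touching {u : E2 → ℝ} (hreg : ContDiffOn ℝ 2 u (ball 0 1)) {r0 : ℝ}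
    (hr0 : 0 < r0) (hr1 : r0 < 1) (θ φ c κ : ℝ) {K K1 K2 : ℝ → ℝ}
    (hK1 : ∀ r, 0 < r → r ≤ 1 → HasDerivAt K (K1 r) r) (hK2 : HasDerivAt K1 (K2 r0) r0)
    (hmax : IsLocalMax (fun s => u (polar s θ) - u (polar s φ) - c * (K s * κ)) r0) :
    dRad u r0 θ - dRad u r0 φ - c * (K1 r0 * κ) = 0 ∧
      dRadRad u r0 θ - dRadRad u r0 φ - c * (K2 r0 * κ) ≤ 0 := by
  have hrad1 : ∀ s, 0 < s → s < 1 → HasDerivAt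
      (fun s => u (polar s θ) - u (polar s φ) - c * (K s * κ))
      (dRad u s θ - dRad u s φ - c * (K1 s * κ)) s := by
    intro s hs hs1
    have hsabs : |s| < 1 := by rwa [abs_of_pos hs]
    exact ((hasDerivAt_dRad hreg hsabs _).sub (hasDerivAt_dRad hreg hsabs _)).sub
      (((hK1 s hs hs1.le).mul_const κ).const_mul c)
  have hr0abs : |r0| < 1 := by rwa [abs_of_pos hr0]
  have hrad2 : HasDerivAt (fun s => dRad u s θ - dRad u s φ - c * (K1 s * κ))
      (dRadRad u r0 θ - dRadRad u r0 φ - c * (K2 r0 * κ)) r0 :=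
    ((hasDerivAt_dRadRad hreg hr0abs _).sub (hasDerivAt_dRadRad hreg hr0abs _)).sub
      ((hK2.mul_const κ).const_mul c)
  exact ⟨hmax.hasDerivAt_eq_zero (hrad1 r0 hr0 hr1), second_deriv_nonpos
    (by filter_upwards [Ioo_mem_nhds hr0 hr1] with s hs using hrad1 s hs.1 hs.2) hrad2 hmax⟩

lemma angular_touching {u : E2 → ℝ} (hreg : ContDiffOn ℝ 2 u (ball 0 1)) {r0 : ℝ}
    (hr0 : |r0| < 1) (θ t c k b a : ℝ)
    (hmax : IsLocalMax (fun φ => u (polar r0 (φ + t)) - u (polar r0 (φ - t))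
      - c * (k * cos (b * (φ - a)))) θ) :
    dAngAng u r0 (θ + t) - dAngAng u r0 (θ - t) - c * (k * (-(cos (b * (θ - a)) * b) * b)) ≤ 0 := by
  have hlin : ∀ φ : ℝ, HasDerivAt (fun φ => b * (φ - a)) b φ := fun φ => by
    simpa using ((hasDerivAt_id φ).sub_const a).const_mul b
  have hang1 : ∀ φ : ℝ, HasDerivAt
      (fun φ => u (polar r0 (φ + t)) - u (polar r0 (φ - t)) - c * (k * cos (b * (φ - a))))
      (dAng u r0 (φ + t) - dAng u r0 (φ - t) - c * (k * (-sin (b * (φ - a)) * b))) φ := by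
    intro φ
    exact (((hasDerivAt_dAng hreg hr0 (φ + t)).comp_add_const φ t).sub
      ((hasDerivAt_dAng hreg hr0 (φ - t)).comp_sub_const φ t)).sub
      (((hlin φ).cos.const_mul k).const_mul c)
  have hang2 : HasDerivAt
      (fun φ => dAng u r0 (φ + t) - dAng u r0 (φ - t) - c * (k * (-sin (b * (φ - a)) * b)))
      (dAngAng u r0 (θ + t) - dAngAng u r0 (θ - t) - c * (k * (-(cos (b * (θ - a)) * b) * b))) θ :=
    (((hasDerivAt_dAngAng hreg hr0 (θ + t)).comp_add_const θ t).sub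
      ((hasDerivAt_dAngAng hreg hr0 (θ - t)).comp_sub_const θ t)).sub
      ((((hlin θ).sin.neg.mul_const b).const_mul k).const_mul c)
  exact second_deriv_nonpos (Eventually.of_forall hang1) hang2 hmax

lemma touching_absurd {r ra A1 A2 R1 R2 T1 T2 f1 f2 c κ k k1 k2 b Λ : ℝ}
    (hr : 0 < r) (hc : 0 < c) (hκ : 0 < κ)
    (he1 : -(A1 + R1 / r + T1 / r ^ 2) = ra * f1) (he2 : -(A2 + R2 / r + T2 / r ^ 2) = ra * f2)
    (h1 : ra * (f1 - f2) ≤ ra * (Λ * (c * (k * κ))))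
    (hstrict : k2 + k1 / r - b ^ 2 / r ^ 2 * k + Λ * ra * k < 0)
    (hR : R1 - R2 - c * (k1 * κ) = 0) (hA : A1 - A2 - c * (k2 * κ) ≤ 0)
    (hT : T1 - T2 - c * (k * (-(κ * b) * b)) ≤ 0) : False := by
  have h2 : c * κ * (k2 + k1 / r - b ^ 2 / r ^ 2 * k + Λ * ra * k) < 0 :=
    mul_neg_of_pos_of_neg (mul_pos hc hκ) hstrict
  have h4 : (T1 - T2 - c * (k * (-(κ * b) * b))) / r ^ 2 ≤ 0 :=
    div_nonpos_of_nonpos_of_nonneg hT (by positivity)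
  have h5 : (R1 - R2 - c * (k1 * κ)) / r = 0 := by rw [hR, zero_div]
  have e2 : c * κ * (k2 + k1 / r - b ^ 2 / r ^ 2 * k + Λ * ra * k) =
    c * (k2 * κ) + c * κ * (k1 / r) - c * κ * (b ^ 2 / r ^ 2 * k) + ra * (Λ * (c * (k * κ))) := by
    ring
  have e4 : (T1 - T2 - c * (k * (-(κ * b) * b))) / r ^ 2
      = T1 / r ^ 2 - T2 / r ^ 2 + c * κ * (b ^ 2 / r ^ 2 * k) := by ring
  have e5 : (R1 - R2 - c * (k1 * κ)) / r = R1 / r - R2 / r - c * κ * (k1 / r) := by ring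
  rw [e2] at h2
  rw [e4] at h4
  rw [e5] at h5
  rw [mul_sub] at h1
  linarith

/-- Sliding rotations: the rotated difference is nonpositive in a half-period sector. -/
lemma rotated_sub_nonpos {α p M Λ b ε : ℝ} {n : ℕ} (hn : 1 ≤ n) {u : E2 → ℝ} (hp : 1 < p)
    (hu : IsHenonSol α p u) (hinv : nInvariant n u)
    (hM : ∀ x ∈ closedBall (0 : E2) 1, |u x| ≤ M) (hΛ : p * M ^ (p - 1) ≤ Λ)
    (hb : 0 < b) (hbn : b < n) (hε : 0 < ε) {K K1 K2 : ℝ → ℝ} (hK : Continuous K)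
    (hKr : ∀ r, 0 < r → r ≤ 1 → ε ≤ K r ∧ HasDerivAt K (K1 r) r ∧ HasDerivAt K1 (K2 r) r ∧
        K2 r + K1 r / r - b ^ 2 / r ^ 2 * K r + Λ * r ^ α * K r < 0)
    (t : ℝ) {r θ : ℝ} (hr : r ∈ Set.Icc (0 : ℝ) 1) (hθ : θ ∈ Set.Icc 0 (π / n)) :
    u (polar r (θ + t)) - u (polar r (θ - t)) ≤ 0 := by
  obtain ⟨hreg, hcont, heq, hbdry⟩ := hu
  have hn0 : (0 : ℝ) < n := by exact_mod_cast hn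
  have hKε : ∀ r ∈ Set.Icc (0 : ℝ) 1, ε ≤ K r := by
    intro r hr
    rcases hr.1.eq_or_lt with h | h
    · have h1 : Tendsto K (𝓝[>] r) (𝓝 (K r)) := hK.continuousAt.tendsto.mono_left nhdsWithin_le_nhds
      refine ge_of_tendsto h1 ?_
      filter_upwards [Ioo_mem_nhdsGT (show r < 1 by linarith)] with s hs
      exact (hKr s (by linarith [hs.1]) hs.2.le).1
    · exact (hKr r h hr.2).1
  have hcos : ∀ θ ∈ Set.Icc 0 (π / n), 0 < cos (b * (θ - π / (2 * n))) := by
    intro θ hθ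
    have h1 : |θ - π / (2 * n)| ≤ π / (2 * n) := by
      have : π / n = π / (2 * n) + π / (2 * n) := by field_simp; ring
      rw [abs_le]; constructor <;> linarith [hθ.1, hθ.2]
    have h2 : |b * (θ - π / (2 * n))| < π / 2 := by
      rw [abs_mul, abs_of_pos hb]
      calc b * |θ - π / (2 * n)| ≤ b * (π / (2 * n)) := by gcongr
        _ < n * (π / (2 * n)) := by have := pi_pos; gcongr
        _ = π / 2 := by field_simp
    exact cos_pos_of_mem_Ioo ⟨(abs_lt.1 h2).1, (abs_lt.1 h2).2⟩
  obtain ⟨D, hD⟩ : ∃ D : ℝ × ℝ → ℝ,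
    D = fun q => u (polar q.1 (q.2 + t)) - u (polar q.1 (q.2 - t)) := ⟨_, rfl⟩
  obtain ⟨H, hH⟩ : ∃ H : ℝ × ℝ → ℝ,
    H = fun q => K q.1 * cos (b * (q.2 - π / (2 * n))) := ⟨_, rfl⟩
  obtain ⟨S, hS⟩ : ∃ S : Set (ℝ × ℝ), S = Set.Icc (0 : ℝ) 1 ×ˢ Set.Icc 0 (π / n) := ⟨_, rfl⟩
  have hHpos : ∀ q ∈ S, 0 < H q := fun q hq => by
    rw [hS] at hq
    rw [hH]
    exact mul_pos (hε.trans_le (hKε _ hq.1)) (hcos _ hq.2)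
  have hmemb : ∀ q ∈ S, ∀ φ, polar q.1 φ ∈ closedBall (0 : E2) 1 := fun q hq φ => by
    rw [hS] at hq
    rw [mem_closedBall_zero_iff, norm_polar, abs_of_nonneg hq.1.1]; exact hq.1.2
  have hDcont : ContinuousOn D S := by
    rw [hD]
    refine ContinuousOn.sub ?_ ?_
    · refine hcont.comp (f := fun q : ℝ × ℝ => polar q.1 (q.2 + t)) ?_ fun q hq => hmemb q hq _
      exact (continuous_polar.comp (by fun_prop :
        Continuous fun q : ℝ × ℝ => (q.1, q.2 + t))).continuousOn
    · refine hcont.comp (f := fun q : ℝ × ℝ => polar q.1 (q.2 - t)) ?_ fun q hq => hmemb q hq _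
      exact (continuous_polar.comp (by fun_prop :
        Continuous fun q : ℝ × ℝ => (q.1, q.2 - t))).continuousOn
  have hHcont : ContinuousOn H S := by
    have : Continuous H := by rw [hH]; exact (hK.comp continuous_fst).mul (by fun_prop)
    exact this.continuousOn
  have hcomp : IsCompact S := by rw [hS]; exact isCompact_Icc.prod isCompact_Icc
  have hmemS : ∀ s φ, s ∈ Set.Icc (0 : ℝ) 1 → φ ∈ Set.Icc 0 (π / n) → (s, φ) ∈ S :=
    fun s φ h1 h2 => by rw [hS]; exact ⟨h1, h2⟩
  obtain ⟨⟨r0, θ0⟩, hq0, hmax⟩ := hcomp.exists_isMaxOn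
    ⟨(r, θ), hmemS _ _ hr hθ⟩ (hDcont.div hHcont fun q hq => (hHpos q hq).ne')
  obtain ⟨c, hc⟩ : ∃ c, c = D (r0, θ0) / H (r0, θ0) := ⟨_, rfl⟩
  have hle : ∀ q ∈ S, D q ≤ c * H q := fun q hq => by
    have h1 : D q / H q ≤ c := hc ▸ hmax hq
    rwa [div_le_iff₀ (hHpos q hq)] at h1
  have hD0 : D (r0, θ0) = c * H (r0, θ0) := by
    rw [hc, div_mul_cancel₀ _ (hHpos _ hq0).ne']
  suffices hc0 : c ≤ 0 by
    have := (hle _ (hmemS _ _ hr hθ)).trans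
      (mul_nonpos_of_nonpos_of_nonneg hc0 (hHpos _ (hmemS _ _ hr hθ)).le)
    rwa [hD] at this
  by_contra hcpos
  push Not at hcpos
  have hDpos : 0 < D (r0, θ0) := by rw [hD0]; exact mul_pos hcpos (hHpos _ hq0)
  obtain ⟨hr0, hθ0⟩ : r0 ∈ Set.Icc (0 : ℝ) 1 ∧ θ0 ∈ Set.Icc 0 (π / n) := by rwa [hS] at hq0
  have hr0pos : 0 < r0 := by
    refine lt_of_le_of_ne hr0.1 fun h => hDpos.ne' ?_
    simp [hD, ← h, polar]
  have hr0lt : r0 < 1 := by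
    refine lt_of_le_of_ne hr0.2 fun h => hDpos.ne' ?_
    have h1 : ∀ φ, u (polar r0 φ) = 0 := fun φ => hbdry _ (by rw [norm_polar, h, abs_one])
    simp [hD, h1]
  have hθ0pos : 0 < θ0 := by
    refine lt_of_le_of_ne hθ0.1 fun h => hDpos.ne' ?_
    simp only [hD, ← h, zero_add, zero_sub, hinv.polar_neg, sub_self]
  have hθ0lt : θ0 < π / n := by
    refine lt_of_le_of_ne hθ0.2 fun h => hDpos.ne' ?_
    have h1 : π / n + t = -(π / n - t) + 2 * π / n := by ring
    simp only [hD, h]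
    rw [h1, hinv.polar_add, hinv.polar_neg, sub_self]
  have hr0abs : |r0| < 1 := by rwa [abs_of_pos hr0pos]
  obtain ⟨-, -, -, hstrict⟩ := hKr r0 hr0pos hr0lt.le
  have hκpos := hcos _ hθ0
  have hD0' := hD0
  simp only [hD, hH] at hD0'
  have hradmax : IsLocalMax (fun s => u (polar s (θ0 + t)) - u (polar s (θ0 - t))
      - c * (K s * cos (b * (θ0 - π / (2 * n))))) r0 := by
    filter_upwards [Ioo_mem_nhds hr0pos hr0lt] with s hs
    have h1 := hle (s, θ0) (hmemS _ _ ⟨hs.1.le, hs.2.le⟩ hθ0)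
    simp only [hD, hH] at h1
    linarith
  have hangmax : IsLocalMax (fun φ => u (polar r0 (φ + t)) - u (polar r0 (φ - t))
      - c * (K r0 * cos (b * (φ - π / (2 * n))))) θ0 := by
    filter_upwards [Ioo_mem_nhds hθ0pos hθ0lt] with φ hφ
    have h1 := hle (r0, φ) (hmemS _ _ hr0 ⟨hφ.1.le, hφ.2.le⟩)
    simp only [hD, hH] at h1
    linarith
  obtain ⟨hR0, hRR⟩ := radial_touching hreg hr0pos hr0lt _ _ _ _
    (fun r hr hr1 => (hKr r hr hr1).2.1) (hKr r0 hr0pos hr0lt.le).2.2.1 hradmax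
  have hAA := angular_touching hreg hr0abs _ _ _ _ _ _ hangmax
  have hball : ∀ φ, polar r0 φ ∈ ball (0 : E2) 1 := fun φ => by
    rw [mem_ball_zero_iff, norm_polar]; exact hr0abs
  have he1 := heq _ (hball (θ0 + t))
  have he2 := heq _ (hball (θ0 - t))
  rw [norm_polar, abs_of_pos hr0pos, lap_polar hreg hr0abs _ hr0pos, mul_assoc] at he1 he2
  have hlt : u (polar r0 (θ0 - t)) ≤ u (polar r0 (θ0 + t)) := by
    rw [hD] at hDpos
    exact (sub_pos.1 hDpos).le
  have hg := signed_rpow_sub_le hp (hM _ (ball_subset_closedBall (hball (θ0 + t))))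
    (hM _ (ball_subset_closedBall (hball (θ0 - t)))) hlt
  refine touching_absurd hr0pos hcpos hκpos he1 he2 ?_ hstrict hR0 hRR hAA
  rw [← hD0']
  have hrα : 0 ≤ r0 ^ α := (Real.rpow_pos_of_pos hr0pos α).le
  exact mul_le_mul_of_nonneg_left
    (hg.trans (mul_le_mul_of_nonneg_right hΛ (sub_nonneg.2 hlt))) hrα

/-- Radial symmetry when the linearized potential is below the sector barrier. -/
lemma radial_of_barrier {α p M Λ b ε : ℝ} {n : ℕ} (hn : 1 ≤ n) {u : E2 → ℝ} (hp : 1 < p)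
    (hu : IsHenonSol α p u) (hinv : nInvariant n u)
    (hM : ∀ x ∈ closedBall (0 : E2) 1, |u x| ≤ M) (hΛ : p * M ^ (p - 1) ≤ Λ)
    (hb : 0 < b) (hbn : b < n) (hε : 0 < ε) {K K1 K2 : ℝ → ℝ} (hK : Continuous K)
    (hKr : ∀ r, 0 < r → r ≤ 1 → ε ≤ K r ∧ HasDerivAt K (K1 r) r ∧ HasDerivAt K1 (K2 r) r ∧
        K2 r + K1 r / r - b ^ 2 / r ^ 2 * K r + Λ * r ^ α * K r < 0)
    {r : ℝ} (hr : r ∈ Set.Icc (0 : ℝ) 1) (θ : ℝ) : u (polar r θ) = u (polar r 0) := by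
  have hn0 : (0 : ℝ) < n := by exact_mod_cast hn
  have hsym : ∀ φ ∈ Set.Icc 0 (π / n), ∀ t, u (polar r (φ + t)) = u (polar r (φ - t)) := by
    intro φ hφ t
    have h1 := rotated_sub_nonpos hn hp hu hinv hM hΛ hb hbn hε hK hKr t hr hφ
    have h2 := rotated_sub_nonpos hn hp hu hinv hM hΛ hb hbn hε hK hKr (-t) hr hφ
    rw [sub_neg_eq_add, ← sub_eq_add_neg] at h2
    linarith
  have hper : Function.Periodic (fun θ => u (polar r θ)) (2 * π / n) :=
    fun θ => hinv.polar_add r θ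
  have hT : 0 < 2 * π / n := by have := pi_pos; positivity
  obtain ⟨y, hy, hyeq⟩ := hper.exists_mem_Ico₀ hT θ
  have := hsym (y / 2) ⟨by linarith [hy.1], by
    have : π / n = 2 * π / n / 2 := by ring
    linarith [hy.2]⟩ (y / 2)
  have hyeq' : u (polar r θ) = u (polar r y) := hyeq
  rw [hyeq']
  simpa using this

/-- Slope of a truncation of the identity vanishing near the origin. -/
def truncSlope (ε t : ℝ) : ℝ := max 0 (min 1 (|t| / ε - 1))

/-- A `C¹` truncation of the identity vanishing on `[-ε, ε]`. -/
def trunc (ε s : ℝ) : ℝ := ∫ t in (0 : ℝ)..s, truncSlope ε t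

lemma continuous_truncSlope (ε : ℝ) : Continuous (truncSlope ε) := by
  unfold truncSlope; fun_prop

lemma truncSlope_nonneg (ε t : ℝ) : 0 ≤ truncSlope ε t := le_max_left _ _

lemma truncSlope_le_one (ε t : ℝ) : truncSlope ε t ≤ 1 := max_le zero_le_one (min_le_left _ _)

lemma hasDerivAt_trunc (ε s : ℝ) : HasDerivAt (trunc ε) (truncSlope ε s) s :=
  (continuous_truncSlope ε).integral_hasStrictDerivAt 0 s |>.hasDerivAt

lemma trunc_eq_zero {ε s : ℝ} (hε : 0 < ε) (hs : |s| ≤ ε) : trunc ε s = 0 := by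
  have h : Set.EqOn (truncSlope ε) (fun _ => 0) (Set.uIcc 0 s) := by
    intro t ht
    have h1 : |t| ≤ |s| := by simpa using Set.abs_sub_left_of_mem_uIcc ht
    have h2 : |t| / ε ≤ 1 := (div_le_one hε).2 (h1.trans hs)
    exact max_eq_left ((min_le_right _ _).trans (by linarith))
  rw [trunc, intervalIntegral.integral_congr h]; simp

lemma trunc_neg (ε s : ℝ) : trunc ε (-s) = -trunc ε s := by
  have h : ∀ t, truncSlope ε (-t) = truncSlope ε t := fun t => by simp [truncSlope]
  have h1 := intervalIntegral.integral_comp_neg (truncSlope ε) (a := 0) (b := s)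
  simp only [h, neg_zero] at h1
  rw [trunc, trunc, h1, intervalIntegral.integral_symm]

lemma trunc_ge {ε s : ℝ} (hε : 0 < ε) (hs : 0 ≤ s) : s - 2 * ε ≤ trunc ε s := by
  have hi : ∀ a b, IntervalIntegrable (truncSlope ε) volume a b :=
    fun a b => (continuous_truncSlope ε).intervalIntegrable a b
  rcases le_total s (2 * ε) with h | h
  · have : 0 ≤ trunc ε s := intervalIntegral.integral_nonneg hs fun t _ => truncSlope_nonneg ε t
    linarith
  · have h1 : 0 ≤ ∫ t in (0 : ℝ)..(2 * ε), truncSlope ε t :=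
      intervalIntegral.integral_nonneg (by linarith) fun t _ => truncSlope_nonneg ε t
    have h2 : ∫ t in (2 * ε)..s, truncSlope ε t = s - 2 * ε := by
      have h : Set.EqOn (truncSlope ε) (fun _ => 1) (Set.uIcc (2 * ε) s) := by
        intro t ht
        rw [Set.uIcc_of_le h] at ht
        have h2 : 2 ≤ |t| / ε := by rw [le_div_iff₀ hε]; exact ht.1.trans (le_abs_self t)
        simp only [truncSlope]
        rw [min_eq_left (by linarith), max_eq_right zero_le_one]
      rw [intervalIntegral.integral_congr h]; simp
    rw [trunc, ← intervalIntegral.integral_add_adjacent_intervals (hi 0 (2 * ε)) (hi _ s), h2]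
    linarith

lemma trunc_mul_self_ge {ε : ℝ} (hε : 0 < ε) (s : ℝ) : s ^ 2 - 2 * ε * |s| ≤ trunc ε s * s := by
  rcases le_total 0 s with h | h
  · have := mul_le_mul_of_nonneg_right (trunc_ge hε h) h
    rw [abs_of_nonneg h]; linarith
  · have h1 : 0 ≤ -s := by linarith
    have := mul_le_mul_of_nonneg_right (trunc_ge hε h1) h1
    rw [trunc_neg] at this
    rw [abs_of_nonpos h]; linarith

lemma contDiff_trunc (ε : ℝ) : ContDiff ℝ 1 (trunc ε) := by
  rw [contDiff_one_iff_deriv]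
  refine ⟨fun s => (hasDerivAt_trunc ε s).differentiableAt, ?_⟩
  rw [show deriv (trunc ε) = truncSlope ε from funext fun s => (hasDerivAt_trunc ε s).deriv]
  exact continuous_truncSlope ε

lemma continuous_mul_of_tsupport_subset {X : Type*} [TopologicalSpace X] {f g : X → ℝ} {s : Set X}
    (hs : IsOpen s) (hf : Continuous f) (hfs : tsupport f ⊆ s) (hg : ContinuousOn g s) :
    Continuous fun x => f x * g x := by
  rw [continuous_iff_continuousAt]
  intro x
  by_cases hx : x ∈ s
  · exact hf.continuousAt.mul (hg.continuousAt (hs.mem_nhds hx))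
  · have h0 : f =ᶠ[𝓝 x] 0 := notMem_tsupport_iff_eventuallyEq.1 fun h => hx (hfs h)
    have : (fun x => f x * g x) =ᶠ[𝓝 x] fun _ => 0 := by
      filter_upwards [h0] with y hy; simp [hy]
    exact continuousAt_const.congr this.symm

lemma integrable_mul_of_tsupport_subset {f g : E2 → ℝ} {s : Set E2} (hs : IsOpen s)
    (hf : Continuous f) (hc : HasCompactSupport f) (hfs : tsupport f ⊆ s) (hg : ContinuousOn g s) :
    Integrable fun x => f x * g x :=
  (continuous_mul_of_tsupport_subset hs hf hfs hg).integrable_of_hasCompactSupport hc.mul_right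

/-- Green's formula against a compactly supported test function. -/
lemma integral_mul_lap {u ψ : E2 → ℝ} (hu : ContDiffOn ℝ 2 u (ball 0 1)) (hψ : ContDiff ℝ 1 ψ)
    (hs : tsupport ψ ⊆ ball 0 1) :
    ∫ x, ψ x * lap u x = -∫ x, ∑ i : Fin 2, fderiv ℝ ψ x (EuclideanSpace.single i 1) *
      fderiv ℝ u x (EuclideanSpace.single i 1) := by
  have hc : HasCompactSupport ψ :=
    (isCompact_closedBall (0 : E2) 1).of_isClosed_subset (isClosed_tsupport _)
      (hs.trans ball_subset_closedBall)
  have h2 : ∀ x ∈ ball (0 : E2) 1, ContDiffAt ℝ 2 u x :=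
    fun x hx => hu.contDiffAt (isOpen_ball.mem_nhds hx)
  have hd : ∀ i : Fin 2, ∀ x ∈ ball (0 : E2) 1, ContDiffAt ℝ 1
      (fun y => fderiv ℝ u y (EuclideanSpace.single i 1)) x := fun i x hx =>
    ((h2 x hx).fderiv_right (m := 1) (by norm_num)).clm_apply contDiffAt_const
  have hdd : ∀ i : Fin 2, ContinuousOn (fun x => fderiv ℝ
      (fun y => fderiv ℝ u y (EuclideanSpace.single i 1)) x (EuclideanSpace.single i 1))
      (ball 0 1) := fun i x hx =>
    (((hd i x hx).fderiv_right (m := 0) (by norm_num)).clm_apply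
      contDiffAt_const).continuousAt.continuousWithinAt
  have hψ' : ∀ i : Fin 2, Continuous fun x => fderiv ℝ ψ x (EuclideanSpace.single i 1) := fun i =>
    (hψ.continuous_fderiv (by norm_num)).clm_apply continuous_const
  have hsub : ∀ i : Fin 2, tsupport (fun x => fderiv ℝ ψ x (EuclideanSpace.single i 1))
      ⊆ tsupport ψ := fun i => tsupport_fderiv_apply_subset ℝ _
  have hcf : ∀ i : Fin 2, HasCompactSupport
      (fun x => fderiv ℝ ψ x (EuclideanSpace.single i 1)) := fun i =>
    hc.of_isClosed_subset (isClosed_tsupport _) (hsub i)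
  have hi1 : ∀ i : Fin 2, Integrable fun x => fderiv ℝ ψ x (EuclideanSpace.single i 1) *
      fderiv ℝ u x (EuclideanSpace.single i 1) := fun i =>
    integrable_mul_of_tsupport_subset isOpen_ball (hψ' i) (hcf i) ((hsub i).trans hs)
      fun x hx => (hd i x hx).continuousAt.continuousWithinAt
  have hi2 : ∀ i : Fin 2, Integrable fun x => ψ x * fderiv ℝ
      (fun y => fderiv ℝ u y (EuclideanSpace.single i 1)) x (EuclideanSpace.single i 1) := fun i =>
    integrable_mul_of_tsupport_subset isOpen_ball hψ.continuous hc hs (hdd i)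
  have hi3 : ∀ i : Fin 2, Integrable fun x => ψ x * fderiv ℝ u x (EuclideanSpace.single i 1) :=
    fun i => integrable_mul_of_tsupport_subset isOpen_ball hψ.continuous hc hs
      fun x hx => (hd i x hx).continuousAt.continuousWithinAt
  have key : ∀ i : Fin 2, ∫ x, ψ x * fderiv ℝ
      (fun y => fderiv ℝ u y (EuclideanSpace.single i 1)) x (EuclideanSpace.single i 1) =
      -∫ x, fderiv ℝ ψ x (EuclideanSpace.single i 1) *
        fderiv ℝ u x (EuclideanSpace.single i 1) := fun i =>
    integral_mul_fderiv_eq_neg_fderiv_mul_of_integrable (hi1 i) (hi2 i) (hi3 i)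
      (fun x _ => hψ.differentiable (by norm_num) x)
      fun x hx => (hd i x (hs hx)).differentiableAt (by norm_num)
  simp only [lap, Finset.mul_sum]
  rw [integral_finsetSum _ fun i _ => hi2 i, integral_finsetSum _ fun i _ => hi1 i,
    ← Finset.sum_neg_distrib]
  exact Finset.sum_congr rfl fun i _ => key i

lemma norm_sq_fderiv_eq_sum (L : E2 →L[ℝ] ℝ) :
    ‖L‖ ^ 2 = ∑ i : Fin 2, L (EuclideanSpace.single i 1) * L (EuclideanSpace.single i 1) := by
  obtain ⟨y, rfl⟩ := (InnerProductSpace.toDual ℝ E2).surjective L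
  rw [LinearIsometryEquiv.norm_map, EuclideanSpace.norm_sq_eq]
  refine Finset.sum_congr rfl fun i _ => ?_
  rw [InnerProductSpace.toDual_apply_apply, EuclideanSpace.inner_single_right]
  simp [sq]

lemma abs_rpow_mul_self_mul_self {p : ℝ} (hp : 1 < p) (s : ℝ) :
    |s| ^ (p - 1) * s ^ 2 = |s| ^ (p + 1) := by
  rcases eq_or_ne s 0 with rfl | h
  · simp [Real.zero_rpow (show p + 1 ≠ 0 by linarith)]
  · rw [← sq_abs, ← Real.rpow_natCast, ← Real.rpow_add (abs_pos.2 h)]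
    norm_num; congr 1; ring

lemma continuousOn_hasCompactClosure_integrableOn {f : E2 → ℝ}
    (hf : ContinuousOn f (closedBall 0 1)) : IntegrableOn f (ball 0 1) :=
  (hf.integrableOn_compact (isCompact_closedBall _ _)).mono_set ball_subset_closedBall

lemma continuousOn_potential {α q : ℝ} (hα : 0 ≤ α) (hq : 0 ≤ q) {u : E2 → ℝ} {s : Set E2}
    (hu : ContinuousOn u s) : ContinuousOn (fun x => ‖x‖ ^ α * |u x| ^ q) s :=
  ((Real.continuous_rpow_const hα).comp continuous_norm).continuousOn.mul
    ((Real.continuous_rpow_const hq).comp_continuousOn (continuous_abs.comp_continuousOn hu))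

lemma truncated_energy_identity {α p ε : ℝ} (hε : 0 < ε) {u : E2 → ℝ} (hu : IsHenonSol α p u) :
    ∫ x in ball (0 : E2) 1, truncSlope ε (u x) * ‖fderiv ℝ u x‖ ^ 2 =
      ∫ x in ball (0 : E2) 1, trunc ε (u x) * (‖x‖ ^ α * |u x| ^ (p - 1) * u x) := by
  obtain ⟨hreg, hcont, heq, hbdry⟩ := hu
  obtain ⟨ψ, hψ⟩ : ∃ ψ : E2 → ℝ, ψ = (ball (0 : E2) 1).indicator fun x => trunc ε (u x) :=
    ⟨_, rfl⟩
  have hψin : ∀ x ∈ ball (0 : E2) 1, ψ =ᶠ[𝓝 x] fun x => trunc ε (u x) := fun x hx => by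
    filter_upwards [isOpen_ball.mem_nhds hx] with y hy
    rw [hψ, Set.indicator_of_mem hy]
  have hsupp : tsupport ψ ⊆ ball 0 1 := by
    have hcl : IsClosed {x ∈ closedBall (0 : E2) 1 | ε ≤ |u x|} :=
      (continuous_abs.comp_continuousOn hcont).preimage_isClosed_of_isClosed
        isClosed_closedBall isClosed_Ici
    refine (closure_minimal (fun x hx => ?_) hcl).trans fun x hx => ?_
    · have hxb : x ∈ ball (0 : E2) 1 := by
        by_contra h
        exact hx (by rw [hψ, Set.indicator_of_notMem h])
      refine ⟨ball_subset_closedBall hxb, ?_⟩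
      by_contra h
      push Not at h
      exact hx (by rw [hψ, Set.indicator_of_mem hxb, trunc_eq_zero hε h.le])
    · rw [mem_ball_zero_iff]
      refine lt_of_le_of_ne (mem_closedBall_zero_iff.1 hx.1) fun h => ?_
      have := hx.2
      rw [hbdry x h, abs_zero] at this
      linarith
  have hsmooth : ContDiff ℝ 1 ψ := by
    rw [contDiff_iff_contDiffAt]
    intro x
    by_cases hx : x ∈ ball (0 : E2) 1
    · refine ContDiffAt.congr_of_eventuallyEq ?_ (hψin x hx)
      exact (contDiff_trunc ε).contDiffAt.comp x
        ((hreg.contDiffAt (isOpen_ball.mem_nhds hx)).of_le (by norm_num))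
    · have h0 : ψ =ᶠ[𝓝 x] fun _ => 0 := notMem_tsupport_iff_eventuallyEq.1 fun h => hx (hsupp h)
      exact contDiffAt_const.congr_of_eventuallyEq h0
  have hder : ∀ x ∈ ball (0 : E2) 1, fderiv ℝ ψ x = truncSlope ε (u x) • fderiv ℝ u x :=
    fun x hx => by
      rw [(hψin x hx).fderiv_eq]
      have := (hasDerivAt_trunc ε (u x)).comp_hasFDerivAt x
        ((hreg.contDiffAt (isOpen_ball.mem_nhds hx)).differentiableAt (by norm_num)).hasFDerivAt
      exact this.fderiv
  have hG := integral_mul_lap hreg hsmooth hsupp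
  have e1 : ∫ x, ψ x * lap u x = ∫ x in ball (0 : E2) 1, ψ x * lap u x := by
    refine (setIntegral_eq_integral_of_forall_compl_eq_zero fun x hx => ?_).symm
    rw [hψ, Set.indicator_of_notMem hx, zero_mul]
  have e2 : ∫ x, ∑ i : Fin 2, fderiv ℝ ψ x (EuclideanSpace.single i 1) *
      fderiv ℝ u x (EuclideanSpace.single i 1) = ∫ x in ball (0 : E2) 1,
      ∑ i : Fin 2, fderiv ℝ ψ x (EuclideanSpace.single i 1) *
      fderiv ℝ u x (EuclideanSpace.single i 1) := by
    refine (setIntegral_eq_integral_of_forall_compl_eq_zero fun x hx => ?_).symm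
    have h0 : fderiv ℝ ψ x = 0 := by
      by_contra h
      exact hx (hsupp (support_fderiv_subset ℝ h))
    simp [h0]
  rw [e1, e2, ← integral_neg, ] at hG
  have e3 : ∫ x in ball (0 : E2) 1, ψ x * lap u x = ∫ x in ball (0 : E2) 1,
      -(trunc ε (u x) * (‖x‖ ^ α * |u x| ^ (p - 1) * u x)) := by
    refine setIntegral_congr_fun measurableSet_ball fun x hx => ?_
    rw [← heq x hx, hψ, Set.indicator_of_mem hx]; ring
  have e4 : ∫ x in ball (0 : E2) 1, -∑ i : Fin 2, fderiv ℝ ψ x (EuclideanSpace.single i 1) *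
      fderiv ℝ u x (EuclideanSpace.single i 1) = ∫ x in ball (0 : E2) 1,
      -(truncSlope ε (u x) * ‖fderiv ℝ u x‖ ^ 2) := by
    refine setIntegral_congr_fun measurableSet_ball fun x hx => ?_
    rw [norm_sq_fderiv_eq_sum, hder x hx, Finset.mul_sum]
    simp [smul_apply, mul_assoc]
  rw [e3, e4, integral_neg, integral_neg] at hG
  linarith

/-- The nonlinear potential energy is at most the Dirichlet integral. -/
lemma potential_le_dirichlet {α p M L : ℝ} (hα : 0 ≤ α) (hp : 1 < p) {u : E2 → ℝ}
    (hu : IsHenonSol α p u) (hM : ∀ x ∈ closedBall (0 : E2) 1, |u x| ≤ M)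
    (hL : ∀ x ∈ ball (0 : E2) 1, ‖fderiv ℝ u x‖ ≤ L) :
    ∫ x in ball (0 : E2) 1, ‖x‖ ^ α * |u x| ^ (p + 1) ≤
      ∫ x in ball (0 : E2) 1, ‖fderiv ℝ u x‖ ^ 2 := by
  have hcont := hu.2.1
  have hM0 : 0 ≤ M := (abs_nonneg _).trans (hM 0 (by simp))
  have hvol : volume (ball (0 : E2) 1) ≠ ⊤ := measure_ball_lt_top.ne
  have hiD : IntegrableOn (fun x => ‖fderiv ℝ u x‖ ^ 2) (ball (0 : E2) 1) := by
    refine Measure.integrableOn_of_bounded (M := L ^ 2) hvol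
      ((measurable_fderiv ℝ u).norm.pow_const 2).aestronglyMeasurable ?_
    filter_upwards [ae_restrict_mem measurableSet_ball] with x hx
    rw [norm_pow, norm_norm]
    exact pow_le_pow_left₀ (norm_nonneg _) (hL x hx) 2
  have hiN : IntegrableOn (fun x => ‖x‖ ^ α * |u x| ^ (p + 1)) (ball (0 : E2) 1) :=
    continuousOn_hasCompactClosure_integrableOn (continuousOn_potential hα (by linarith) hcont)
  have key : ∀ ε : ℝ, 0 < ε → ∫ x in ball (0 : E2) 1, ‖x‖ ^ α * |u x| ^ (p + 1) ≤
      (∫ x in ball (0 : E2) 1, ‖fderiv ℝ u x‖ ^ 2)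
        + ε * (2 * M ^ (p - 1) * M * volume.real (ball (0 : E2) 1)) := by
    intro ε hε
    have hct : ContinuousOn (fun x => trunc ε (u x) * (‖x‖ ^ α * |u x| ^ (p - 1) * u x))
        (closedBall 0 1) :=
      ((contDiff_trunc ε).continuous.comp_continuousOn hcont).mul
        ((continuousOn_potential hα (by linarith) hcont).mul hcont)
    have h1 : ∫ x in ball (0 : E2) 1, (‖x‖ ^ α * |u x| ^ (p + 1) - 2 * ε * M ^ (p - 1) * M) ≤
        ∫ x in ball (0 : E2) 1, trunc ε (u x) * (‖x‖ ^ α * |u x| ^ (p - 1) * u x) := by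
      refine setIntegral_mono_on (hiN.sub (integrableOn_const hvol))
        (continuousOn_hasCompactClosure_integrableOn hct) measurableSet_ball fun x hx => ?_
      have hx1 : ‖x‖ ^ α ≤ 1 :=
        Real.rpow_le_one (norm_nonneg _) (mem_ball_zero_iff.1 hx).le hα
      have hu1 := hM x (ball_subset_closedBall hx)
      have hu2 : |u x| ^ (p - 1) ≤ M ^ (p - 1) :=
        Real.rpow_le_rpow (abs_nonneg _) hu1 (by linarith)
      have hq : 0 ≤ |u x| ^ (p - 1) := Real.rpow_nonneg (abs_nonneg _) _
      have hx0 : 0 ≤ ‖x‖ ^ α := Real.rpow_nonneg (norm_nonneg _) _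
      have h2 := mul_le_mul_of_nonneg_left (trunc_mul_self_ge hε (u x)) (mul_nonneg hx0 hq)
      have h3 : ‖x‖ ^ α * |u x| ^ (p - 1) * |u x| ≤ 1 * M ^ (p - 1) * M := by gcongr
      have h4 := mul_le_mul_of_nonneg_left h3 (show 0 ≤ 2 * ε by linarith)
      have h5 := abs_rpow_mul_self_mul_self hp (u x)
      calc ‖x‖ ^ α * |u x| ^ (p + 1) - 2 * ε * M ^ (p - 1) * M
          ≤ ‖x‖ ^ α * |u x| ^ (p + 1) - 2 * ε * (‖x‖ ^ α * |u x| ^ (p - 1) * |u x|) := by linarith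
        _ = ‖x‖ ^ α * |u x| ^ (p - 1) * (u x ^ 2 - 2 * ε * |u x|) := by rw [← h5]; ring
        _ ≤ _ := h2
        _ = _ := by ring
    rw [← truncated_energy_identity hε hu, integral_sub hiN (integrableOn_const hvol),
      setIntegral_const] at h1
    have h2 : ∫ x in ball (0 : E2) 1, truncSlope ε (u x) * ‖fderiv ℝ u x‖ ^ 2 ≤
        ∫ x in ball (0 : E2) 1, ‖fderiv ℝ u x‖ ^ 2 := by
      refine integral_mono_of_nonneg (Eventually.of_forall fun x =>
        mul_nonneg (truncSlope_nonneg _ _) (sq_nonneg _)) hiD (Eventually.of_forall fun x => ?_)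
      exact mul_le_of_le_one_left (sq_nonneg _) (truncSlope_le_one _ _)
    rw [smul_eq_mul] at h1
    linarith
  refine le_of_forall_pos_le_add fun η hη => ?_
  obtain ⟨A, hA⟩ : ∃ A, A = 2 * M ^ (p - 1) * M * volume.real (ball (0 : E2) 1) := ⟨_, rfl⟩
  have hA0 : 0 ≤ A := by rw [hA]; positivity
  refine (key (η / (A + 1)) (by positivity)).trans ?_
  rw [← hA]
  have : η / (A + 1) * A ≤ η := by
    rw [div_mul_eq_mul_div, div_le_iff₀ (by positivity)]; nlinarith
  linarith

lemma signed_rpow_sub_self_le {p : ℝ} (hp : 1 < p) {s : ℝ} (hs : |s| ≤ 1) :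
    |(|s| ^ (p - 1) * s - s)| ≤ p - 1 := by
  have e : |s| ^ (p - 1) * s - s = -((1 - |s| ^ (p - 1)) * s) := by ring
  have h1 : |s| ^ (p - 1) ≤ 1 := Real.rpow_le_one (abs_nonneg _) hs (by linarith)
  rw [e, abs_neg, abs_mul, abs_of_nonneg (sub_nonneg.2 h1)]
  rcases eq_or_ne s 0 with rfl | h0
  · rw [abs_zero, mul_zero]; linarith
  · have hpos : 0 < |s| := abs_pos.2 h0
    have h2 : 1 + (p - 1) * Real.log |s| ≤ |s| ^ (p - 1) := by
      rw [Real.rpow_def_of_pos hpos]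
      have := Real.add_one_le_exp (Real.log |s| * (p - 1))
      linarith
    have h3 : -Real.log |s| * |s| ≤ 1 := by
      have := Real.log_le_sub_one_of_pos (inv_pos.2 hpos)
      rw [Real.log_inv] at this
      have h4 := mul_le_mul_of_nonneg_right this hpos.le
      rw [sub_mul, inv_mul_cancel₀ hpos.ne'] at h4
      linarith
    have h5 : (1 - |s| ^ (p - 1)) * |s| ≤ (-((p - 1) * Real.log |s|)) * |s| :=
      mul_le_mul_of_nonneg_right (by linarith) hpos.le
    have h6 := mul_le_mul_of_nonneg_left h3 (show 0 ≤ p - 1 by linarith)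
    linarith

lemma finrank_E2 : Module.finrank ℝ E2 = 2 := by simp

lemma measurableSet_annulus (a b : ℝ) : MeasurableSet {x : E2 | ‖x‖ ∈ Set.Ioo a b} :=
  measurableSet_Ioo.preimage measurable_norm

/-- Integration of a radial function over an annulus. -/
lemma integral_annulus (F : ℝ → ℝ) {a b : ℝ} (ha : 0 ≤ a) (hab : a ≤ b) :
    ∫ x in {x : E2 | ‖x‖ ∈ Set.Ioo a b}, F ‖x‖ =
      2 * volume.real (ball (0 : E2) 1) * ∫ r in a..b, r * F r := by
  have h1 : ∫ x in {x : E2 | ‖x‖ ∈ Set.Ioo a b}, F ‖x‖ =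
      ∫ x : E2, (Set.Ioo a b).indicator F ‖x‖ := by
    rw [← integral_indicator (measurableSet_annulus a b)]
    rfl
  have h2 : ∀ r : ℝ, r ^ (Module.finrank ℝ E2 - 1) • (Set.Ioo a b).indicator F r =
      (Set.Ioo a b).indicator (fun r => r * F r) r := fun r => by
    rw [finrank_E2]
    by_cases hr : r ∈ Set.Ioo a b <;> simp [hr]
  rw [h1, integral_fun_norm_addHaar volume]
  simp only [h2]
  rw [finrank_E2, setIntegral_indicator measurableSet_Ioo,
    Set.inter_eq_right.2
      (show Set.Ioo a b ⊆ Set.Ioi 0 from fun r hr => lt_of_le_of_lt ha hr.1),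
    intervalIntegral.integral_of_le hab, integral_Ioc_eq_integral_Ioo]
  simp [mul_assoc]

lemma ae_norm_ne (a : ℝ) : ∀ᵐ x : E2, ‖x‖ ≠ a := by
  have h : volume (sphere (0 : E2) a) = 0 := Measure.addHaar_sphere _ _ _
  rw [ae_iff]
  convert h using 2
  ext x; simp

lemma norm_fderiv_radial {h : ℝ → ℝ} {h' : ℝ} {x : E2} (hx : x ≠ 0)
    (hd : HasDerivAt h h' ‖x‖) : ‖fderiv ℝ (fun y : E2 => h ‖y‖) x‖ = |h'| := by
  have hn : DifferentiableAt ℝ (fun y : E2 => ‖y‖) x :=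
    (contDiffAt_norm ℝ hx).differentiableAt (n := 1) (by norm_num)
  have := (hd.comp_hasFDerivAt x hn.hasFDerivAt).fderiv
  rw [show (fun y : E2 => h ‖y‖) = h ∘ fun y : E2 => ‖y‖ from rfl, this, norm_smul,
    norm_fderiv_norm hn, mul_one, Real.norm_eq_abs]

/-- A radial function is positive exactly on an annulus of the disc. -/
structure PositiveOnAnnulus (h h' : ℝ → ℝ) (a b : ℝ) : Prop where
  nonneg : 0 ≤ a
  lt : a < b
  le_one : b ≤ 1
  deriv : ∀ r, HasDerivAt h (h' r) r
  pos : ∀ r ∈ Set.Ioo a b, 0 < h r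
  neg : ∀ r ∈ Set.Ioo 0 1, r ∉ Set.Icc a b → h r < 0

lemma PositiveOnAnnulus.cases {h h' : ℝ → ℝ} {a b : ℝ} (H : PositiveOnAnnulus h h' a b) :
    ∀ᵐ x : E2, x ∈ ball (0 : E2) 1 → x ≠ 0 ∧ (‖x‖ ∈ Set.Ioo a b ∧ 0 < h ‖x‖ ∨
      ‖x‖ ∉ Set.Ioo a b ∧ h ‖x‖ < 0) := by
  filter_upwards [ae_norm_ne 0, ae_norm_ne a, ae_norm_ne b] with x h0 h1 h2 hx
  rw [mem_ball_zero_iff] at hx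
  refine ⟨norm_ne_zero_iff.1 h0, ?_⟩
  by_cases hx' : ‖x‖ ∈ Set.Ioo a b
  · exact Or.inl ⟨hx', H.pos _ hx'⟩
  · refine Or.inr ⟨hx', H.neg _ ⟨lt_of_le_of_ne (norm_nonneg _) (Ne.symm h0), hx⟩ fun h => hx' ?_⟩
    exact ⟨lt_of_le_of_ne h.1 (Ne.symm h1), lt_of_le_of_ne h.2 h2⟩

lemma PositiveOnAnnulus.annulus_subset {h h' : ℝ → ℝ} {a b : ℝ} (H : PositiveOnAnnulus h h' a b) :
    {x : E2 | ‖x‖ ∈ Set.Ioo a b} ⊆ ball 0 1 := fun x hx => by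
  rw [mem_ball_zero_iff]; exact hx.2.trans_le H.le_one

lemma PositiveOnAnnulus.continuous {h h' : ℝ → ℝ} {a b : ℝ} (H : PositiveOnAnnulus h h' a b) :
    Continuous h := continuous_iff_continuousAt.2 fun r => (H.deriv r).continuousAt

lemma PositiveOnAnnulus.fderiv_posPart {h h' : ℝ → ℝ} {a b : ℝ} (H : PositiveOnAnnulus h h' a b) :
    ∀ᵐ x : E2, x ∈ ball (0 : E2) 1 → ‖fderiv ℝ (fun y : E2 => max (h ‖y‖) 0) x‖ ^ 2 =
      {x : E2 | ‖x‖ ∈ Set.Ioo a b}.indicator (fun x => h' ‖x‖ ^ 2) x := by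
  filter_upwards [H.cases] with x hx hxb
  obtain ⟨hx0, ⟨hx1, hx2⟩ | ⟨hx1, hx2⟩⟩ := hx hxb
  · have hc : (fun y : E2 => max (h ‖y‖) 0) =ᶠ[𝓝 x] fun y : E2 => h ‖y‖ := by
      filter_upwards [(H.continuous.comp continuous_norm).continuousAt.eventually
        (lt_mem_nhds hx2)] with y hy
      exact max_eq_left (le_of_lt hy)
    rw [hc.fderiv_eq, norm_fderiv_radial hx0 (H.deriv _), Set.indicator_of_mem
      (show x ∈ {x : E2 | ‖x‖ ∈ Set.Ioo a b} from hx1), sq_abs]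
  · have hc : (fun y : E2 => max (h ‖y‖) 0) =ᶠ[𝓝 x] fun y : E2 => 0 := by
      filter_upwards [(H.continuous.comp continuous_norm).continuousAt.eventually
        (gt_mem_nhds hx2)] with y hy
      exact max_eq_right (le_of_lt hy)
    rw [hc.fderiv_eq, Set.indicator_of_notMem
      (show x ∉ {x : E2 | ‖x‖ ∈ Set.Ioo a b} from hx1)]
    simp

lemma PositiveOnAnnulus.dirichlet {h h' : ℝ → ℝ} {a b : ℝ} (H : PositiveOnAnnulus h h' a b) :
    ∫ x in ball (0 : E2) 1, ‖fderiv ℝ (fun y : E2 => max (h ‖y‖) 0) x‖ ^ 2 =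
      2 * volume.real (ball (0 : E2) 1) * ∫ r in a..b, r * h' r ^ 2 := by
  rw [setIntegral_congr_ae measurableSet_ball H.fderiv_posPart,
    setIntegral_indicator (measurableSet_annulus a b), Set.inter_eq_right.2 H.annulus_subset]
  exact integral_annulus (fun r => h' r ^ 2) H.nonneg H.lt.le

lemma PositiveOnAnnulus.potential {h h' : ℝ → ℝ} {a b : ℝ} (H : PositiveOnAnnulus h h' a b)
    {α q : ℝ} (hq : 0 < q) :
    ∫ x in ball (0 : E2) 1, ‖x‖ ^ α * max (h ‖x‖) 0 ^ q =
      2 * volume.real (ball (0 : E2) 1) * ∫ r in a..b, r * (r ^ α * |h r| ^ q) := by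
  have h1 : ∀ᵐ x : E2, x ∈ ball (0 : E2) 1 → ‖x‖ ^ α * max (h ‖x‖) 0 ^ q =
      {x : E2 | ‖x‖ ∈ Set.Ioo a b}.indicator (fun x => ‖x‖ ^ α * |h ‖x‖| ^ q) x := by
    filter_upwards [H.cases] with x hx hxb
    obtain ⟨-, ⟨hx1, hx2⟩ | ⟨hx1, hx2⟩⟩ := hx hxb
    · rw [Set.indicator_of_mem (show x ∈ {x : E2 | ‖x‖ ∈ Set.Ioo a b} from hx1),
        max_eq_left hx2.le, abs_of_pos hx2]
    · rw [Set.indicator_of_notMem (show x ∉ {x : E2 | ‖x‖ ∈ Set.Ioo a b} from hx1),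
        max_eq_right hx2.le, Real.zero_rpow hq.ne', mul_zero]
  rw [setIntegral_congr_ae measurableSet_ball h1,
    setIntegral_indicator (measurableSet_annulus a b), Set.inter_eq_right.2 H.annulus_subset]
  exact integral_annulus (fun r => r ^ α * |h r| ^ q) H.nonneg H.lt.le

lemma PositiveOnAnnulus.integrableOn {h h' : ℝ → ℝ} {a b : ℝ} (H : PositiveOnAnnulus h h' a b)
    (hc : Continuous h') :
    IntegrableOn (fun x : E2 => ‖fderiv ℝ (fun y : E2 => max (h ‖y‖) 0) x‖ ^ 2) (ball 0 1) := by
  have h1 : IntegrableOn ({x : E2 | ‖x‖ ∈ Set.Ioo a b}.indicator (fun x => h' ‖x‖ ^ 2))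
      (ball (0 : E2) 1) :=
    (continuousOn_hasCompactClosure_integrableOn
      ((hc.comp continuous_norm).pow 2).continuousOn).indicator (measurableSet_annulus a b)
  refine h1.congr ?_
  rw [EventuallyEq, ae_restrict_iff' measurableSet_ball]
  filter_upwards [H.fderiv_posPart] with x hx hxb using (hx hxb).symm

lemma nInvariant_radial (n : ℕ) (V : ℝ → ℝ) : nInvariant n fun x => V ‖x‖ := by
  refine ⟨fun q => ?_, fun q => ?_⟩
  · refine congrArg V ?_
    rw [EuclideanSpace.norm_eq, EuclideanSpace.norm_eq]
    simp [reflX, Fin.sum_univ_two]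
  · refine congrArg V ?_
    rw [EuclideanSpace.norm_eq, EuclideanSpace.norm_eq]
    congr 1
    simp only [rot2, Fin.sum_univ_two, Real.norm_eq_abs, sq_abs]
    have := Real.sin_sq_add_cos_sq (2 * π / n)
    simp
    linear_combination (q 0 ^ 2 + q 1 ^ 2) * this

lemma lipschitzOnWith_radial {h h' : ℝ → ℝ} (hd : ∀ r, HasDerivAt h (h' r) r)
    (hc : Continuous h') : ∃ K : NNReal, ∀ x ∈ closedBall (0 : E2) 1, ∀ y ∈ closedBall (0 : E2) 1,
      |h ‖x‖ - h ‖y‖| ≤ K * ‖x - y‖ := by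
  obtain ⟨K, hK⟩ := isCompact_Icc.exists_bound_of_continuousOn (s := Set.Icc (0 : ℝ) 1)
    hc.continuousOn
  have hK0 : 0 ≤ K := (norm_nonneg _).trans (hK 0 ⟨le_rfl, zero_le_one⟩)
  refine ⟨⟨K, hK0⟩, fun x hx y hy => ?_⟩
  have h1 := (convex_Icc (0 : ℝ) 1).norm_image_sub_le_of_norm_hasDerivWithin_le
    (fun r _ => (hd r).hasDerivWithinAt) hK ⟨norm_nonneg y, mem_closedBall_zero_iff.1 hy⟩
    ⟨norm_nonneg x, mem_closedBall_zero_iff.1 hx⟩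
  refine h1.trans ?_
  exact mul_le_mul_of_nonneg_left (abs_norm_sub_norm_le x y) hK0

lemma max_two_phase {s t y : ℝ} (hs : 0 ≤ s) (ht : 0 ≤ t) :
    max (s * max y 0 - t * max (-y) 0) 0 = s * max y 0 ∧
      max (-(s * max y 0 - t * max (-y) 0)) 0 = t * max (-y) 0 := by
  rcases le_total 0 y with h | h
  · have := mul_nonneg hs h
    rw [max_eq_left h, max_eq_right (neg_nonpos.2 h)]
    constructor
    · rw [mul_zero, sub_zero, max_eq_left this]
    · rw [mul_zero, sub_zero, max_eq_right (by linarith)]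
  · have := mul_nonneg ht (neg_nonneg.2 h)
    rw [max_eq_right h, max_eq_left (neg_nonneg.2 h)]
    constructor
    · rw [mul_zero, zero_sub, max_eq_right (by linarith)]
    · rw [mul_zero, zero_sub, neg_neg, max_eq_left this]

lemma norm_fderiv_const_mul_sq (s : ℝ) (f : E2 → ℝ) (x : E2) :
    ‖fderiv ℝ (fun y => s * f y) x‖ ^ 2 = s ^ 2 * ‖fderiv ℝ f x‖ ^ 2 := by
  have : fderiv ℝ (fun y => s * f y) x = s • fderiv ℝ f x :=
    congrFun (fderiv_const_smul_field (𝕜 := ℝ) (R := ℝ) (f := f) s) x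
  rw [this, norm_smul, mul_pow, Real.norm_eq_abs, sq_abs]

lemma dirichlet_const_mul (s : ℝ) (f : E2 → ℝ) :
    ∫ x in ball (0 : E2) 1, ‖fderiv ℝ (fun y => s * f y) x‖ ^ 2 =
      s ^ 2 * ∫ x in ball (0 : E2) 1, ‖fderiv ℝ f x‖ ^ 2 := by
  rw [← integral_const_mul]
  simp only [norm_fderiv_const_mul_sq]

lemma potential_const_mul {α q s : ℝ} (hs : 0 ≤ s) {f : E2 → ℝ} (hf : ∀ x, 0 ≤ f x) :
    ∫ x in ball (0 : E2) 1, ‖x‖ ^ α * (s * f x) ^ q =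
      s ^ q * ∫ x in ball (0 : E2) 1, ‖x‖ ^ α * f x ^ q := by
  rw [← integral_const_mul]
  refine integral_congr_ae (Eventually.of_forall fun x => ?_)
  simp only [Real.mul_rpow hs (hf x)]
  ring

/-- Two-phase radial competitors built from a radial profile with prescribed scalings. -/
lemma two_phase_competitor {α p : ℝ} {h h' : ℝ → ℝ} {a : ℝ} (hα : 0 ≤ α) (hp : 1 < p) (n : ℕ)
    (H1 : PositiveOnAnnulus h h' 0 a)
    (H2 : PositiveOnAnnulus (fun r => -h r) (fun r => -h' r) a 1)
    (hc : Continuous h') (h1 : h 1 = 0) {s t A1 A2 B1 B2 : ℝ} (hs : 0 < s) (ht : 0 < t)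
    (hA1 : ∫ x in ball (0 : E2) 1, ‖fderiv ℝ (fun y : E2 => max (h ‖y‖) 0) x‖ ^ 2 = A1)
    (hA2 : ∫ x in ball (0 : E2) 1, ‖fderiv ℝ (fun y : E2 => max (-h ‖y‖) 0) x‖ ^ 2 = A2)
    (hB1 : ∫ x in ball (0 : E2) 1, ‖x‖ ^ α * max (h ‖x‖) 0 ^ (p + 1) = B1)
    (hB2 : ∫ x in ball (0 : E2) 1, ‖x‖ ^ α * max (-h ‖x‖) 0 ^ (p + 1) = B2)
    (hsA : s ^ 2 * A1 = s ^ (p + 1) * B1) (htA : t ^ 2 * A2 = t ^ (p + 1) * B2) :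
    ∃ v, IsNehariCompetitor α p n v ∧
      energy α p v = (1 / 2 - 1 / (p + 1)) * (s ^ (p + 1) * B1 + t ^ (p + 1) * B2) := by
  obtain ⟨v, hv⟩ : ∃ v : E2 → ℝ,
    v = fun x => s * max (h ‖x‖) 0 - t * max (-h ‖x‖) 0 := ⟨_, rfl⟩
  have ha0 := H1.lt
  have ha1 := H2.lt
  have hvp : (fun x => max (v x) 0) = fun x => s * max (h ‖x‖) 0 := by
    rw [hv]; exact funext fun x => (max_two_phase hs.le ht.le).1
  have hvn : (fun x => max (-v x) 0) = fun x => t * max (-h ‖x‖) 0 := by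
    rw [hv]; exact funext fun x => (max_two_phase hs.le ht.le).2
  have hvp' : ∀ x, max (v x) 0 = s * max (h ‖x‖) 0 := congrFun hvp
  have hvn' : ∀ x, max (-v x) 0 = t * max (-h ‖x‖) 0 := congrFun hvn
  have eA1 : ∫ x in ball (0 : E2) 1, ‖fderiv ℝ (fun y => max (v y) 0) x‖ ^ 2 = s ^ 2 * A1 := by
    rw [hvp, dirichlet_const_mul, hA1]
  have eA2 : ∫ x in ball (0 : E2) 1, ‖fderiv ℝ (fun y => max (-v y) 0) x‖ ^ 2 = t ^ 2 * A2 := by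
    rw [hvn, dirichlet_const_mul, hA2]
  have eB1 : ∫ x in ball (0 : E2) 1, ‖x‖ ^ α * max (v x) 0 ^ (p + 1) = s ^ (p + 1) * B1 := by
    simp only [hvp']
    rw [potential_const_mul hs.le fun x => le_max_right _ _, hB1]
  have eB2 : ∫ x in ball (0 : E2) 1, ‖x‖ ^ α * max (-v x) 0 ^ (p + 1) = t ^ (p + 1) * B2 := by
    simp only [hvn']
    rw [potential_const_mul ht.le fun x => le_max_right _ _, hB2]
  have hvcont : Continuous v := by
    rw [hv]
    have := H1.continuous
    fun_prop
  refine ⟨v, ⟨?_, ?_, ?_, ?_, ?_, ?_, ?_⟩, ?_⟩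
  · rw [hv]; exact nInvariant_radial n fun r => s * max (h r) 0 - t * max (-h r) 0
  · obtain ⟨K, hK⟩ := lipschitzOnWith_radial H1.deriv hc
    refine ⟨⟨s + t, by positivity⟩ * K, LipschitzOnWith.of_dist_le_mul fun x hx y hy => ?_⟩
    rw [Real.dist_eq, dist_eq_norm]
    have h1 := hK x hx y hy
    have h2 : |max (h ‖x‖) 0 - max (h ‖y‖) 0| ≤ |h ‖x‖ - h ‖y‖| := abs_max_sub_max_le_abs _ _ _
    have h3 : |max (-h ‖x‖) 0 - max (-h ‖y‖) 0| ≤ |h ‖x‖ - h ‖y‖| := by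
      refine (abs_max_sub_max_le_abs _ _ _).trans (le_of_eq ?_)
      rw [abs_sub_comm]; congr 1; ring
    calc |v x - v y| = |s * (max (h ‖x‖) 0 - max (h ‖y‖) 0)
          - t * (max (-h ‖x‖) 0 - max (-h ‖y‖) 0)| := by rw [hv]; congr 1; ring
      _ ≤ |s * (max (h ‖x‖) 0 - max (h ‖y‖) 0)| + |t * (max (-h ‖x‖) 0 - max (-h ‖y‖) 0)| :=
          abs_sub _ _
      _ = s * |max (h ‖x‖) 0 - max (h ‖y‖) 0| + t * |max (-h ‖x‖) 0 - max (-h ‖y‖) 0| := by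
          rw [abs_mul, abs_mul, abs_of_pos hs, abs_of_pos ht]
      _ ≤ s * (K * ‖x - y‖) + t * (K * ‖x - y‖) := by
          gcongr
          exacts [h2.trans h1, h3.trans h1]
      _ = (s + t) * K * ‖x - y‖ := by ring
  · intro x hx
    simp [hv, hx, h1]
  · have hr := H1.pos (a / 2) ⟨by linarith, by linarith⟩
    refine ⟨polar (a / 2) 0, ?_, ?_⟩
    · rw [mem_ball_zero_iff, norm_polar, abs_of_pos (by linarith)]; linarith
    · simp only [hv]
      rw [norm_polar, abs_of_pos (by linarith), max_eq_left hr.le, max_eq_right (by linarith)]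
      simp only [mul_zero, sub_zero]
      exact mul_pos hs hr
  · have hr := H2.pos ((a + 1) / 2) ⟨by linarith, by linarith⟩
    refine ⟨polar ((a + 1) / 2) 0, ?_, ?_⟩
    · rw [mem_ball_zero_iff, norm_polar, abs_of_pos (by linarith)]; linarith
    · simp only [hv]
      rw [norm_polar, abs_of_pos (by linarith), max_eq_left hr.le, max_eq_right (by linarith)]
      simp only [mul_zero, zero_sub]
      exact neg_neg_of_pos (mul_pos ht hr)
  · rw [eA1, eB1, hsA]
  · rw [eA2, eB2, htA]
  · have hD : ∫ x in ball (0 : E2) 1, ‖fderiv ℝ v x‖ ^ 2 = s ^ 2 * A1 + t ^ 2 * A2 := by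
      have hi1 := H1.integrableOn hc
      have hi2 := H2.integrableOn hc.neg
      rw [← eA1, ← eA2]
      have hi1' : IntegrableOn (fun x => ‖fderiv ℝ (fun y => max (v y) 0) x‖ ^ 2) (ball 0 1) := by
        rw [hvp]
        refine (hi1.const_mul (s ^ 2)).congr (Eventually.of_forall fun x => ?_)
        exact (norm_fderiv_const_mul_sq _ _ x).symm
      have hi2' : IntegrableOn (fun x => ‖fderiv ℝ (fun y => max (-v y) 0) x‖ ^ 2) (ball 0 1) := by
        rw [hvn]
        refine (hi2.const_mul (t ^ 2)).congr (Eventually.of_forall fun x => ?_)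
        exact (norm_fderiv_const_mul_sq _ _ x).symm
      rw [← integral_add hi1' hi2']
      refine setIntegral_congr_ae measurableSet_ball ?_
      filter_upwards [H1.cases] with x hx hxb
      obtain ⟨-, ⟨-, hx2⟩ | ⟨-, hx2⟩⟩ := hx hxb
      · have hvx : 0 < v x := by
          simp only [hv]
          rw [max_eq_left hx2.le, max_eq_right (by linarith)]
          simpa using mul_pos hs hx2
        have e1 : (fun y => max (v y) 0) =ᶠ[𝓝 x] v := by
          filter_upwards [hvcont.continuousAt.eventually (lt_mem_nhds hvx)] with y hy
          exact max_eq_left hy.le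
        have e2 : (fun y => max (-v y) 0) =ᶠ[𝓝 x] fun _ => 0 := by
          filter_upwards [hvcont.continuousAt.eventually (lt_mem_nhds hvx)] with y hy
          exact max_eq_right (by linarith)
        rw [e1.fderiv_eq, e2.fderiv_eq]; simp
      · have hvx : v x < 0 := by
          simp only [hv]
          rw [max_eq_right hx2.le, max_eq_left (by linarith)]
          have := mul_pos ht (neg_pos.2 hx2)
          linarith
        have e1 : (fun y => max (-v y) 0) =ᶠ[𝓝 x] fun y => -v y := by
          filter_upwards [hvcont.continuousAt.eventually (gt_mem_nhds hvx)] with y hy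
          exact max_eq_left (by linarith)
        have e2 : (fun y => max (v y) 0) =ᶠ[𝓝 x] fun _ => 0 := by
          filter_upwards [hvcont.continuousAt.eventually (gt_mem_nhds hvx)] with y hy
          exact max_eq_right hy.le
        rw [e1.fderiv_eq, e2.fderiv_eq, fderiv_fun_neg]; simp
    have hN : ∫ x in ball (0 : E2) 1, ‖x‖ ^ α * |v x| ^ (p + 1) =
        s ^ (p + 1) * B1 + t ^ (p + 1) * B2 := by
      rw [← eB1, ← eB2]
      have hp1 : 0 ≤ p + 1 := by linarith
      have hi : ∀ f : E2 → ℝ, Continuous f → (∀ x, 0 ≤ f x) →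
          IntegrableOn (fun x => ‖x‖ ^ α * f x ^ (p + 1)) (ball 0 1) := fun f hf hf0 => by
        have := continuousOn_hasCompactClosure_integrableOn
          (continuousOn_potential hα hp1 (hf.continuousOn (s := closedBall 0 1)))
        simpa only [abs_of_nonneg (hf0 _)] using this
      rw [← integral_add
        (hi _ (show Continuous fun x => max (v x) 0 by fun_prop) fun x => le_max_right _ _)
        (hi _ (show Continuous fun x => max (-v x) 0 by fun_prop) fun x => le_max_right _ _)]
      refine setIntegral_congr_fun measurableSet_ball fun x _ => ?_
      have hz : (0 : ℝ) ^ (p + 1) = 0 := Real.zero_rpow (by linarith)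
      rcases le_total 0 (v x) with hx | hx
      · simp [max_eq_left hx, max_eq_right (neg_nonpos.2 hx), abs_of_nonneg hx, hz]
      · simp [max_eq_right hx, max_eq_left (neg_nonneg.2 hx), abs_of_nonpos hx, hz]
    rw [energy, hD, hN, hsA, htA]
    ring

/-- The radial profile `r ↦ J_0(z r^{(2+α)/2})`. -/
def radialProfile (z α r : ℝ) : ℝ := jB 0 (z ^ 2 * r ^ (2 + α))

/-- The derivative of the radial profile. -/
def radialProfileDeriv (z α r : ℝ) : ℝ :=
  -(1 / 4) * jB (0 + 1) (z ^ 2 * r ^ (2 + α)) * (z ^ 2 * ((2 + α) * r ^ (2 + α - 1)))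

lemma hasDerivAt_radialProfile {z α : ℝ} (hα : 0 ≤ α) (r : ℝ) :
    HasDerivAt (radialProfile z α) (radialProfileDeriv z α r) r :=
  (hasDerivAt_jB le_rfl _).comp r
    ((Real.hasDerivAt_rpow_const (p := 2 + α) (Or.inr (by linarith))).const_mul (z ^ 2))

lemma continuous_radialProfileDeriv {z α : ℝ} (hα : 0 ≤ α) :
    Continuous (radialProfileDeriv z α) := by
  have h1 := Real.continuous_rpow_const (q := 2 + α) (by linarith)
  have h2 := Real.continuous_rpow_const (q := 2 + α - 1) (by linarith)
  have h3 := continuous_jB (β := 0 + 1) (by norm_num)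
  unfold radialProfileDeriv
  fun_prop

lemma continuous_radialProfile {z α : ℝ} (hα : 0 ≤ α) : Continuous (radialProfile z α) :=
  continuous_iff_continuousAt.2 fun r => (hasDerivAt_radialProfile hα r).continuousAt

lemma hasDerivAt_radialFlux {z α r : ℝ} (hr : 0 < r) :
    HasDerivAt (fun r => r * radialProfileDeriv z α r)
      (-(((2 + α) / 2 * z) ^ 2 * r ^ (1 + α) * radialProfile z α r)) r := by
  have h1 := hasDerivAt_profile_flux (β := 0) (c := 2 + α) le_rfl (z ^ 2) hr
  refine (h1.congr_of_eventuallyEq ?_).congr_deriv ?_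
  · filter_upwards [lt_mem_nhds hr] with s hs
    have : s * s ^ (2 + α - 1) = s ^ (2 + α) := by
      rw [Real.rpow_sub hs, Real.rpow_one]; field_simp
    simp only [radialProfileDeriv, zero_mul, zero_div, Real.rpow_zero, one_mul, zero_sub]
    rw [← this]
    ring
  · have : r ^ (2 + α) = r * r ^ (1 + α) := by
      rw [show 2 + α = (1 + α) + 1 by ring, Real.rpow_add_one hr.ne', mul_comm]
    simp only [radialProfile, zero_mul, zero_div, Real.rpow_zero, one_mul]
    rw [this]
    field_simp
    ring

lemma hasDerivAt_radialProfile_flux {z α r : ℝ} (hα : 0 ≤ α) (hr : 0 < r) :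
    HasDerivAt (fun r => r * radialProfileDeriv z α r * radialProfile z α r)
      (r * radialProfileDeriv z α r ^ 2 -
        ((2 + α) / 2 * z) ^ 2 * (r * (r ^ α * |radialProfile z α r| ^ (2 : ℝ)))) r := by
  refine ((hasDerivAt_radialFlux hr).fun_mul (hasDerivAt_radialProfile hα r)).congr_deriv ?_
  have h3 : r ^ (1 + α) = r * r ^ α := by rw [Real.rpow_add hr, Real.rpow_one]
  rw [Real.rpow_two, sq_abs, h3]
  ring

lemma integral_radialProfileDeriv_sq {z α a b : ℝ} (hα : 0 ≤ α) (ha : 0 ≤ a) (hab : a < b)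
    (hYa : a = 0 ∨ radialProfile z α a = 0) (hYb : radialProfile z α b = 0) :
    ∫ r in a..b, r * radialProfileDeriv z α r ^ 2 =
      ((2 + α) / 2 * z) ^ 2 * ∫ r in a..b, r * (r ^ α * |radialProfile z α r| ^ (2 : ℝ)) := by
  have c1 := continuous_radialProfileDeriv (z := z) hα
  have c2 := continuous_radialProfile (z := z) hα
  have c3 := Real.continuous_rpow_const (q := α) hα
  have c4 : Continuous fun r => |radialProfile z α r| ^ (2 : ℝ) :=
    c2.abs.rpow_const fun _ => Or.inr (by norm_num)
  have i1 : Continuous fun r => r * radialProfileDeriv z α r ^ 2 := by fun_prop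
  have i2 : Continuous fun r => ((2 + α) / 2 * z) ^ 2 *
      (r * (r ^ α * |radialProfile z α r| ^ (2 : ℝ))) := by fun_prop
  have h := intervalIntegral.integral_eq_sub_of_hasDerivAt_of_le hab.le
    (f := fun r => r * radialProfileDeriv z α r * radialProfile z α r)
    (by fun_prop) (fun r hr => hasDerivAt_radialProfile_flux hα (ha.trans_lt hr.1))
    ((i1.sub i2).intervalIntegrable _ _)
  rw [intervalIntegral.integral_sub (i1.intervalIntegrable _ _) (i2.intervalIntegrable _ _),
    intervalIntegral.integral_const_mul] at h
  have e : a * radialProfileDeriv z α a * radialProfile z α a = 0 := by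
    rcases hYa with h | h <;> simp [h]
  rw [hYb, e, mul_zero, sub_zero] at h
  linarith

lemma radial_potential_bounds {α a b : ℝ} {Y : ℝ → ℝ} (hα : 0 ≤ α) (hY : Continuous Y)
    (ha : 0 ≤ a) (hab : a < b) (hb : b ≤ 1) (h1 : ∀ r ∈ Set.Icc a b, |Y r| ≤ 1)
    (h0 : ∀ r ∈ Set.Ioo a b, Y r ≠ 0) :
    0 < ∫ r in a..b, r * (r ^ α * |Y r| ^ (2 : ℝ)) ∧ ∀ p : ℝ, 1 < p →
      (∫ r in a..b, r * (r ^ α * |Y r| ^ (2 : ℝ))) - (p - 1) ≤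
        ∫ r in a..b, r * (r ^ α * |Y r| ^ (p + 1)) := by
  have c3 := Real.continuous_rpow_const (q := α) hα
  have c4 : ∀ q : ℝ, 0 ≤ q → Continuous fun r => r * (r ^ α * |Y r| ^ q) := fun q hq => by
    have : Continuous fun r => |Y r| ^ q := hY.abs.rpow_const fun _ => Or.inr hq
    fun_prop
  refine ⟨intervalIntegral.intervalIntegral_pos_of_pos_on
    ((c4 2 (by norm_num)).intervalIntegrable _ _) (fun r hr => ?_) hab, fun p hp => ?_⟩
  · have := abs_pos.2 (h0 r hr)
    have := ha.trans_lt hr.1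
    positivity
  have h2 : ∫ r in a..b, (r * (r ^ α * |Y r| ^ (2 : ℝ)) - (p - 1)) ≤
      ∫ r in a..b, r * (r ^ α * |Y r| ^ (p + 1)) := by
    refine intervalIntegral.integral_mono_on hab.le
      (((c4 2 (by norm_num)).sub continuous_const).intervalIntegrable _ _)
      ((c4 (p + 1) (by linarith)).intervalIntegrable _ _) fun r hr => ?_
    have hr0 : 0 ≤ r := ha.trans hr.1
    have hr1 : r ≤ 1 := hr.2.trans hb
    have e1 := signed_rpow_sub_self_le hp (h1 r hr)
    have e2 : |Y r| ^ (2 : ℝ) - |Y r| ^ (p + 1) = -((|Y r| ^ (p - 1) * Y r - Y r) * Y r) := by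
      rw [Real.rpow_two, ← abs_rpow_mul_self_mul_self hp, sq_abs]; ring
    have e3 : |Y r| ^ (2 : ℝ) - |Y r| ^ (p + 1) ≤ p - 1 := by
      rw [e2]
      refine (neg_le_abs _).trans ?_
      rw [abs_mul]
      calc _ ≤ (p - 1) * 1 := mul_le_mul e1 (h1 r hr) (abs_nonneg _) (by linarith)
        _ = p - 1 := mul_one _
    have e4 : r * r ^ α ≤ 1 := by
      have := Real.rpow_le_one hr0 hr1 hα
      calc r * r ^ α ≤ 1 * 1 := by gcongr
        _ = 1 := one_mul 1
    have e5 : 0 ≤ r * r ^ α := by positivity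
    have e6 := mul_le_mul_of_nonneg_left e3 e5
    have e7 := mul_le_mul_of_nonneg_right e4 (show 0 ≤ p - 1 by linarith)
    nlinarith
  rw [intervalIntegral.integral_sub ((c4 2 (by norm_num)).intervalIntegrable _ _)
    (continuous_const.intervalIntegrable _ _), intervalIntegral.integral_const] at h2
  refine le_trans (sub_le_sub_left ?_ _) h2
  rw [smul_eq_mul]
  exact mul_le_of_le_one_left (by linarith) (by linarith)

lemma exists_nehari_scaling {L δ b κ p B : ℝ} (hL : 0 < L) (hδ : 0 < δ) (hb : 0 < b)
    (hκ : 0 < κ) (hp : 1 < p) (hpδ : (p - 1) * (L + δ) < δ * b) (hB : b - (p - 1) ≤ B) :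
    ∃ s, 0 < s ∧ s ^ 2 * (κ * (L * b)) = s ^ (p + 1) * (κ * B) ∧
      s ^ (p + 1) * (κ * B) ≤ κ * L * b * (L + δ) ^ (2 / (p - 1)) := by
  have hp1 : 0 < p - 1 := by linarith
  have h1 : L * b < (L + δ) * B := by nlinarith
  have hB0 : 0 < B := by
    have : 0 < (L + δ) * B := lt_trans (mul_pos hL hb) h1
    exact pos_of_mul_pos_right this (by linarith)
  have hq : 0 < L * b / B := by positivity
  have e1 : ((L * b / B) ^ (1 / (p - 1))) ^ (p + 1) * B =
      ((L * b / B) ^ (1 / (p - 1))) ^ 2 * (L * b) := by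
    have : ((L * b / B) ^ (1 / (p - 1))) ^ (p + 1) =
        ((L * b / B) ^ (1 / (p - 1))) ^ 2 * (L * b / B) := by
      rw [show p + 1 = 2 + (p - 1) by ring, Real.rpow_add (by positivity), Real.rpow_two]
      congr 1
      rw [← Real.rpow_mul hq.le, one_div_mul_cancel hp1.ne', Real.rpow_one]
    rw [this]
    field_simp
  refine ⟨(L * b / B) ^ (1 / (p - 1)), by positivity, by linear_combination -κ * e1, ?_⟩
  have e2 : ((L * b / B) ^ (1 / (p - 1))) ^ 2 ≤ (L + δ) ^ (2 / (p - 1)) := by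
    rw [← Real.rpow_two, ← Real.rpow_mul hq.le, show 1 / (p - 1) * 2 = 2 / (p - 1) by ring]
    refine Real.rpow_le_rpow hq.le ?_ (by positivity)
    rw [div_le_iff₀ hB0]; exact h1.le
  have e3 : 0 ≤ κ * L * b := by positivity
  nlinarith [mul_le_mul_of_nonneg_left e2 e3]

lemma exists_nehari_competitor {α z : ℝ} (hα : 0 ≤ α) (hz : IsNthZero 0 2 z) (n : ℕ) :
    ∃ C, 0 < C ∧ ∀ δ, 0 < δ → ∀ᶠ p in 𝓝[>] (1 : ℝ), ∃ v, IsNehariCompetitor α p n v ∧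
      energy α p v ≤
        (1 / 2 - 1 / (p + 1)) * (C * (((2 + α) / 2 * z) ^ 2 + δ) ^ (2 / (p - 1))) := by
  have hz0 : 0 < z := hz.1
  obtain ⟨T, hT0, hTz, hT, hpos, hneg, hzz⟩ := exists_first_zero hz
  have hc : 0 < 2 + α := by linarith
  obtain ⟨a, ha⟩ : ∃ a, a = (T / z ^ 2) ^ (1 / (2 + α)) := ⟨_, rfl⟩
  have hTq : 0 < T / z ^ 2 := by positivity
  have ha0 : 0 < a := by rw [ha]; positivity
  have hac : z ^ 2 * a ^ (2 + α) = T := by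
    rw [ha, ← Real.rpow_mul hTq.le, one_div_mul_cancel hc.ne', Real.rpow_one]
    field_simp
  have ha1 : a < 1 := by
    rw [ha]
    refine Real.rpow_lt_one hTq.le ?_ (by positivity)
    rw [div_lt_one (by positivity)]; exact hTz
  have hYa : radialProfile z α a = 0 := by rw [radialProfile, hac, hT]
  have hY1 : radialProfile z α 1 = 0 := by rw [radialProfile, Real.one_rpow, mul_one, hzz]
  have hYpos : ∀ r ∈ Set.Ico 0 a, 0 < radialProfile z α r := fun r hr => by
    refine hpos _ ⟨mul_nonneg (sq_nonneg z) (Real.rpow_nonneg hr.1 _), ?_⟩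
    rw [← hac]
    have := Real.rpow_lt_rpow hr.1 hr.2 hc
    gcongr
  have hYneg : ∀ r ∈ Set.Ioo a 1, radialProfile z α r < 0 := fun r hr => by
    have hr0 : 0 < r := ha0.trans hr.1
    refine hneg _ ⟨?_, ?_⟩
    · rw [← hac]
      have := Real.rpow_lt_rpow ha0.le hr.1 hc
      gcongr
    · have := Real.rpow_lt_one hr0.le hr.2 hc
      have h2 : 0 < z ^ 2 := by positivity
      nlinarith
  have H1 : PositiveOnAnnulus (radialProfile z α) (radialProfileDeriv z α) 0 a :=
    ⟨le_rfl, ha0, ha1.le, hasDerivAt_radialProfile hα, fun r hr => hYpos r ⟨hr.1.le, hr.2⟩,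
      fun r hr hra => hYneg r ⟨lt_of_not_ge fun h => hra ⟨hr.1.le, h⟩, hr.2⟩⟩
  have H2 : PositiveOnAnnulus (fun r => -radialProfile z α r)
      (fun r => -radialProfileDeriv z α r) a 1 :=
    ⟨ha0.le, ha1, le_rfl, fun r => (hasDerivAt_radialProfile hα r).fun_neg,
      fun r hr => neg_pos.2 (hYneg r hr),
      fun r hr hra => neg_neg_of_pos (hYpos r ⟨hr.1.le,
        lt_of_not_ge fun h => hra ⟨h, hr.2.le⟩⟩)⟩
  have hYle : ∀ r, 0 ≤ r → |radialProfile z α r| ≤ 1 := fun r hr =>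
    abs_jB_zero_le_one (mul_nonneg (sq_nonneg z) (Real.rpow_nonneg hr _))
  have hYc := continuous_radialProfile (z := z) hα
  obtain ⟨hb1, hb1'⟩ := radial_potential_bounds hα hYc le_rfl ha0 ha1.le
    (fun r hr => hYle r hr.1) fun r hr => (hYpos r ⟨hr.1.le, hr.2⟩).ne'
  obtain ⟨hb2, hb2'⟩ := radial_potential_bounds hα hYc ha0.le ha1 le_rfl
    (fun r hr => hYle r (ha0.le.trans hr.1)) fun r hr => (hYneg r hr).ne
  obtain ⟨κ, hκ⟩ : ∃ κ, κ = 2 * volume.real (ball (0 : E2) 1) := ⟨_, rfl⟩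
  have hκ0 : 0 < κ := by
    rw [hκ]
    have : 0 < volume.real (ball (0 : E2) 1) :=
      ENNReal.toReal_pos (measure_ball_pos _ _ one_pos).ne' measure_ball_lt_top.ne
    positivity
  obtain ⟨L, hL⟩ : ∃ L, L = ((2 + α) / 2 * z) ^ 2 := ⟨_, rfl⟩
  have hL0 : 0 < L := by rw [hL]; positivity
  have hA1 := H1.dirichlet
  have hA2 := H2.dirichlet
  simp only [neg_sq] at hA2
  rw [integral_radialProfileDeriv_sq hα le_rfl ha0 (Or.inl rfl) hYa, ← hκ, ← hL] at hA1
  rw [integral_radialProfileDeriv_sq hα ha0.le ha1 (Or.inr hYa) hY1, ← hκ, ← hL] at hA2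
  obtain ⟨b1, e1⟩ : ∃ b1, b1 = ∫ r in (0 : ℝ)..a, r * (r ^ α * |radialProfile z α r| ^ (2 : ℝ)) :=
    ⟨_, rfl⟩
  obtain ⟨b2, e2⟩ : ∃ b2, b2 = ∫ r in a..1, r * (r ^ α * |radialProfile z α r| ^ (2 : ℝ)) :=
    ⟨_, rfl⟩
  rw [← e1] at hb1 hb1' hA1
  rw [← e2] at hb2 hb2' hA2
  rw [← hL]
  refine ⟨κ * L * b1 + κ * L * b2, by positivity, fun δ hδ => ?_⟩
  have ev : ∀ b : ℝ, 0 < b → ∀ᶠ p in 𝓝[>] (1 : ℝ), (p - 1) * (L + δ) < δ * b := fun b hb => by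
    have hc : Continuous fun p : ℝ => (p - 1) * (L + δ) := by fun_prop
    refine nhdsWithin_le_nhds (hc.continuousAt.eventually (gt_mem_nhds ?_))
    show (1 - 1) * (L + δ) < δ * b
    rw [sub_self, zero_mul]; positivity
  filter_upwards [ev b1 hb1, ev b2 hb2, self_mem_nhdsWithin] with p hp1 hp2 hp
  have hp : 1 < p := hp
  obtain ⟨s, hs, hs1, hs2⟩ := exists_nehari_scaling hL0 hδ hb1 hκ0 hp hp1 (hb1' p hp)
  obtain ⟨t, ht, ht1, ht2⟩ := exists_nehari_scaling hL0 hδ hb2 hκ0 hp hp2 (hb2' p hp)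
  have hB1 := H1.potential (α := α) (q := p + 1) (by linarith)
  have hB2 := H2.potential (α := α) (q := p + 1) (by linarith)
  simp only [abs_neg] at hB2
  rw [← hκ] at hB1 hB2
  obtain ⟨v, hv, hE⟩ := two_phase_competitor hα hp n H1 H2
    (continuous_radialProfileDeriv hα) hY1 hs ht hA1 hA2 hB1 hB2 hs1 ht1
  refine ⟨v, hv, hE.le.trans (mul_le_mul_of_nonneg_left ?_ ?_)⟩
  · linarith
  · rw [sub_nonneg]
    exact one_div_le_one_div_of_le (by norm_num) (by linarith)

lemma lap_const_mul (s : ℝ) (u : E2 → ℝ) (x : E2) : lap (fun y => s * u y) x = s * lap u x := by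
  have h1 : fderiv ℝ (fun y => s * u y) = s • fderiv ℝ u :=
    fderiv_const_smul_field (𝕜 := ℝ) (R := ℝ) (f := u) s
  have h2 : ∀ v : E2, fderiv ℝ (fun y => (s • fderiv ℝ u) y v) x =
      s • fderiv ℝ (fun y => fderiv ℝ u y v) x := fun v =>
    congrFun (fderiv_const_smul_field (𝕜 := ℝ) (R := ℝ) (f := fun y => fderiv ℝ u y v) s) x
  simp only [lap, h1, h2, Finset.mul_sum, smul_apply, smul_eq_mul]

/-- A solution of the Hénon problem rescaled to have sup norm one. -/
structure IsNormalizedSol (α p Λ : ℝ) (w : E2 → ℝ) : Prop where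
  alpha_nonneg : 0 ≤ α
  one_lt : 1 < p
  pos : 0 < Λ
  contDiffOn : ContDiffOn ℝ 2 w (ball 0 1)
  continuousOn : ContinuousOn w (closedBall 0 1)
  eq : ∀ x ∈ ball (0 : E2) 1, -lap w x = Λ * (‖x‖ ^ α * (|w x| ^ (p - 1) * w x))
  eq_zero : ∀ x : E2, ‖x‖ = 1 → w x = 0
  le_one : ∀ x ∈ closedBall (0 : E2) 1, |w x| ≤ 1
  exists_eq_one : ∃ x ∈ ball (0 : E2) 1, |w x| = 1

lemma IsHenonSol.normalize {α p : ℝ} {u : E2 → ℝ} (hα : 0 ≤ α) (hp : 1 < p)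
    (hu : IsHenonSol α p u) (h0 : ∃ x ∈ ball (0 : E2) 1, 0 < u x) :
    IsNormalizedSol α p (supN u ^ (p - 1)) (fun x => u x / supN u) ∧ 0 < supN u ∧
      ∀ x ∈ closedBall (0 : E2) 1, |u x| ≤ supN u := by
  obtain ⟨hreg, hcont, heq, hbdry⟩ := hu
  obtain ⟨x1, hx1, hux1⟩ := h0
  obtain ⟨x0, hx0, hmax⟩ := (isCompact_closedBall (0 : E2) 1).exists_isMaxOn ⟨0, by simp⟩
    hcont.abs
  have hS : IsGreatest ((fun x => |u x|) '' closedBall 0 1) |u x0| :=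
    ⟨⟨x0, hx0, rfl⟩, by rintro _ ⟨x, hx, rfl⟩; exact hmax hx⟩
  have hM : supN u = |u x0| := hS.csSup_eq
  have hle : ∀ x ∈ closedBall (0 : E2) 1, |u x| ≤ supN u := fun x hx => hM ▸ hmax hx
  have hM0 : 0 < supN u :=
    (abs_pos.2 hux1.ne').trans_le (hle x1 (ball_subset_closedBall hx1))
  have hx0b : x0 ∈ ball (0 : E2) 1 := by
    rw [mem_ball_zero_iff]
    refine lt_of_le_of_ne (mem_closedBall_zero_iff.1 hx0) fun h => ?_
    rw [hM, hbdry x0 h, abs_zero] at hM0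
    exact lt_irrefl _ hM0
  have e : (fun x => u x / supN u) = fun x => (supN u)⁻¹ * u x := by
    ext x; rw [div_eq_inv_mul]
  refine ⟨⟨hα, hp, Real.rpow_pos_of_pos hM0 _, hreg.div_const _, hcont.div_const _,
    fun x hx => ?_, fun x hx => by rw [hbdry x hx, zero_div], fun x hx => ?_,
    ⟨x0, hx0b, ?_⟩⟩, hM0, hle⟩
  · rw [e, lap_const_mul, ← mul_neg, heq x hx, abs_div, abs_of_pos hM0,
      Real.div_rpow (abs_nonneg _) hM0.le]
    have := (Real.rpow_pos_of_pos hM0 (p - 1)).ne'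
    field_simp
  · rw [abs_div, abs_of_pos hM0, div_le_one hM0]; exact hle x hx
  · rw [abs_div, abs_of_pos hM0, ← hM, div_self hM0.ne']

namespace IsNormalizedSol

variable {α p Λ : ℝ} {w : E2 → ℝ}

lemma abs_lap_le (H : IsNormalizedSol α p Λ w) {x : E2} (hx : x ∈ ball (0 : E2) 1) :
    |lap w x| ≤ Λ := by
  have h1 := H.le_one x (ball_subset_closedBall hx)
  have h2 : ‖x‖ ^ α ≤ 1 :=
    Real.rpow_le_one (norm_nonneg _) (mem_ball_zero_iff.1 hx).le H.alpha_nonneg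
  have h3 : |w x| ^ (p - 1) ≤ 1 :=
    Real.rpow_le_one (abs_nonneg _) h1 (by linarith [H.one_lt])
  have h4 := H.pos
  rw [← abs_neg, H.eq x hx, abs_mul, abs_mul, abs_mul, abs_of_pos H.pos,
    abs_of_nonneg (Real.rpow_nonneg (norm_nonneg _) _),
    abs_of_nonneg (Real.rpow_nonneg (abs_nonneg _) _)]
  calc Λ * (‖x‖ ^ α * (|w x| ^ (p - 1) * |w x|)) ≤ Λ * (1 * (1 * 1)) := by gcongr
    _ = Λ := by ring

lemma abs_sub_le (H : IsNormalizedSol α p Λ w) {x y : E2} (hx : x ∈ closedBall (0 : E2) 1)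
    (hy : y ∈ closedBall (0 : E2) 1) : |w x - w y| ≤ 2 * Λ * ‖x - y‖ := by
  have h := fun {x y} => sub_le_of_lap_bounded (x := x) (y := y) H.pos H.contDiffOn
    H.continuousOn H.eq_zero fun x hx => H.abs_lap_le hx
  refine abs_sub_le_iff.2 ⟨h hx hy, ?_⟩
  rw [norm_sub_rev]; exact h hy hx

lemma neg (H : IsNormalizedSol α p Λ w) : IsNormalizedSol α p Λ fun x => -w x where
  alpha_nonneg := H.alpha_nonneg
  one_lt := H.one_lt
  pos := H.pos
  contDiffOn := H.contDiffOn.neg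
  continuousOn := H.continuousOn.neg
  eq x hx := by
    have h1 : lap (fun y => -w y) x = -lap w x := by
      simpa using lap_const_mul (-1) w x
    rw [h1, H.eq x hx, abs_neg]
    have h2 := H.eq x hx
    linarith
  eq_zero x hx := by rw [H.eq_zero x hx, neg_zero]
  le_one x hx := by rw [abs_neg]; exact H.le_one x hx
  exists_eq_one := by simpa only [abs_neg] using H.exists_eq_one

/-- A lower bound for the potential energy of a normalized solution. -/
lemma le_integral (H : IsNormalizedSol α p Λ w) (hp : p ≤ 2) :
    1 / 8 * (1 / 16) ^ α * (1 / 16) ^ 2 * volume.real (ball (0 : E2) 1) / Λ ^ (2 + α) ≤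
      ∫ x in ball (0 : E2) 1, ‖x‖ ^ α * |w x| ^ (p + 1) := by
  have hΛ := H.pos
  have hp1 := H.one_lt
  have hα := H.alpha_nonneg
  obtain ⟨x0, hx0, h1⟩ := H.exists_eq_one
  obtain ⟨θ, hθ⟩ := exists_polar x0
  have hn0 := norm_nonneg x0
  have hn1 := mem_ball_zero_iff.1 hx0
  have hpol : ∀ r s : ℝ, ‖polar r θ - polar s θ‖ = |r - s| := fun r s => by
    rw [polar_eq_smul, polar_eq_smul s, ← sub_smul, norm_smul, norm_polar, abs_one, mul_one,
      Real.norm_eq_abs]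
  obtain ⟨ρ, hρ⟩ : ∃ ρ, ρ = 1 / (4 * Λ) := ⟨_, rfl⟩
  have hρ0 : 0 < ρ := by rw [hρ]; positivity
  have hρΛ : Λ * ρ = 1 / 4 := by rw [hρ]; field_simp
  have hgap : 2 * ρ ≤ 1 - ‖x0‖ := by
    have h2 := H.abs_sub_le (ball_subset_closedBall hx0)
      (show polar 1 θ ∈ closedBall (0 : E2) 1 by simp [norm_polar])
    rw [H.eq_zero (polar 1 θ) (by simp [norm_polar]), sub_zero, h1] at h2
    nth_rewrite 1 [hθ] at h2
    rw [hpol, abs_of_neg (by linarith)] at h2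
    have h3 : Λ * (2 * ρ) ≤ Λ * (1 - ‖x0‖) := by linarith
    exact le_of_mul_le_mul_left h3 hΛ
  have hball : ∀ y ∈ ball (polar (‖x0‖ + ρ / 2) θ) (ρ / 4),
      y ∈ ball (0 : E2) 1 ∧ ρ / 4 ≤ ‖y‖ ∧ 1 / 2 ≤ |w y| := by
    intro y hy
    rw [mem_ball, dist_eq_norm] at hy
    have hn : ‖polar (‖x0‖ + ρ / 2) θ‖ = ‖x0‖ + ρ / 2 := by
      rw [norm_polar, abs_of_nonneg (by linarith)]
    have h2 : ‖y‖ < 1 := by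
      have := norm_le_norm_add_norm_sub' y (polar (‖x0‖ + ρ / 2) θ)
      linarith
    have h3 : ρ / 4 ≤ ‖y‖ := by
      have := norm_le_norm_add_norm_sub' (polar (‖x0‖ + ρ / 2) θ) y
      rw [norm_sub_rev] at this
      linarith
    have h4 : ‖x0 - y‖ ≤ ρ := by
      have h5 := norm_sub_le_norm_sub_add_norm_sub x0 (polar (‖x0‖ + ρ / 2) θ) y
      have h6 : ‖x0 - polar (‖x0‖ + ρ / 2) θ‖ = ρ / 2 := by
        nth_rewrite 1 [hθ]
        rw [hpol, abs_sub_comm, add_sub_cancel_left, abs_of_pos (by linarith)]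
      rw [norm_sub_rev (polar (‖x0‖ + ρ / 2) θ) y] at h5
      linarith
    have hyb : y ∈ ball (0 : E2) 1 := mem_ball_zero_iff.2 h2
    refine ⟨hyb, h3, ?_⟩
    have h7 := H.abs_sub_le (ball_subset_closedBall hx0) (ball_subset_closedBall hyb)
    have h8 := mul_le_mul_of_nonneg_left h4 hΛ.le
    have h9 := abs_sub_abs_le_abs_sub (w x0) (w y)
    linarith
  have hintg := continuousOn_hasCompactClosure_integrableOn
    (continuousOn_potential hα (show 0 ≤ p + 1 by linarith) H.continuousOn)
  have h2 : ∫ x in ball (polar (‖x0‖ + ρ / 2) θ) (ρ / 4), (ρ / 4) ^ α * (1 / 8 : ℝ) ≤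
      ∫ x in ball (0 : E2) 1, ‖x‖ ^ α * |w x| ^ (p + 1) := by
    refine le_trans (setIntegral_mono_on (integrableOn_const measure_ball_lt_top.ne)
      (hintg.mono_set fun y hy => (hball y hy).1) measurableSet_ball fun y hy => ?_)
      (setIntegral_mono_set hintg (Eventually.of_forall fun x => by positivity)
        (LE.le.eventuallyLE fun y hy => (hball y hy).1))
    obtain ⟨-, h3, h4⟩ := hball y hy
    have h5 : (1 / 2 : ℝ) ^ (3 : ℝ) ≤ (1 / 2) ^ (p + 1) :=
      Real.rpow_le_rpow_of_exponent_ge (by norm_num) (by norm_num) (by linarith)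
    have h6 : (1 / 2 : ℝ) ^ (p + 1) ≤ |w y| ^ (p + 1) :=
      Real.rpow_le_rpow (by norm_num) h4 (by linarith)
    have h7 : (1 / 2 : ℝ) ^ (3 : ℝ) = 1 / 8 := by norm_num
    have h8 : (ρ / 4) ^ α ≤ ‖y‖ ^ α := Real.rpow_le_rpow (by positivity) h3 hα
    gcongr
    linarith
  rw [setIntegral_const, smul_eq_mul] at h2
  have h3 : volume.real (ball (polar (‖x0‖ + ρ / 2) θ) (ρ / 4)) =
      (ρ / 4) ^ 2 * volume.real (ball (0 : E2) 1) := by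
    rw [measureReal_def, Measure.addHaar_ball _ _ (by positivity), finrank_E2, ENNReal.toReal_mul,
      ENNReal.toReal_ofReal (by positivity), measureReal_def]
  rw [h3] at h2
  refine le_trans (le_of_eq ?_) h2
  have h4 : ρ / 4 = (1 / 16) / Λ := by rw [hρ]; field_simp; norm_num
  rw [h4, Real.div_rpow (by norm_num) hΛ.le, Real.rpow_add hΛ, Real.rpow_two]
  field_simp

end IsNormalizedSol

lemma IsHenonSol.potential_le_dirichlet {α p : ℝ} (hα : 0 ≤ α) (hp : 1 < p) {u : E2 → ℝ}
    (hu : IsHenonSol α p u) (h0 : ∃ x ∈ ball (0 : E2) 1, 0 < u x) :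
    ∫ x in ball (0 : E2) 1, ‖x‖ ^ α * |u x| ^ (p + 1) ≤
      ∫ x in ball (0 : E2) 1, ‖fderiv ℝ u x‖ ^ 2 := by
  obtain ⟨H, hM, hle⟩ := hu.normalize hα hp h0
  refine _root_.potential_le_dirichlet hα hp hu hle (fun x hx => ?_)
    (L := supN u * (2 * supN u ^ (p - 1)))
  have hΛ := H.pos
  refine norm_fderiv_le_of_lip' ℝ (by positivity) ?_
  filter_upwards [isOpen_ball.mem_nhds hx] with y hy
  have h := H.abs_sub_le (ball_subset_closedBall hy) (ball_subset_closedBall hx)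
  rw [← sub_div, abs_div, abs_of_pos hM, div_le_iff₀ hM] at h
  rw [Real.norm_eq_abs]
  linarith

lemma IsHenonSol.le_potential {α p : ℝ} (hα : 0 ≤ α) (hp : 1 < p) (hp2 : p ≤ 2) {u : E2 → ℝ}
    (hu : IsHenonSol α p u) (h0 : ∃ x ∈ ball (0 : E2) 1, 0 < u x) :
    1 / 8 * (1 / 16) ^ α * (1 / 16) ^ 2 * volume.real (ball (0 : E2) 1) *
      (supN u ^ (p - 1)) ^ (2 / (p - 1) - (1 + α)) ≤
      ∫ x in ball (0 : E2) 1, ‖x‖ ^ α * |u x| ^ (p + 1) := by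
  obtain ⟨H, hM, -⟩ := hu.normalize hα hp h0
  have h1 := H.le_integral hp2
  have hp1 : 0 < p - 1 := by linarith
  have e1 : ∫ x in ball (0 : E2) 1, ‖x‖ ^ α * |u x| ^ (p + 1) = supN u ^ (p + 1) *
      ∫ x in ball (0 : E2) 1, ‖x‖ ^ α * |u x / supN u| ^ (p + 1) := by
    rw [← integral_const_mul]
    refine setIntegral_congr_fun measurableSet_ball fun x _ => ?_
    rw [abs_div, abs_of_pos hM, Real.div_rpow (abs_nonneg _) hM.le]
    have := (Real.rpow_pos_of_pos hM (p + 1)).ne'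
    field_simp
  have e2 : supN u ^ (p + 1) = (supN u ^ (p - 1)) ^ (2 / (p - 1)) * supN u ^ (p - 1) := by
    rw [← Real.rpow_mul hM.le, mul_div_cancel₀ _ hp1.ne', ← Real.rpow_add hM]
    congr 1; ring
  have h2 := mul_le_mul_of_nonneg_left h1 (Real.rpow_nonneg hM.le (p + 1))
  rw [← e1, e2] at h2
  refine le_trans (le_of_eq ?_) h2
  have hΛ := H.pos
  obtain ⟨Λ, hΛ'⟩ : ∃ Λ, Λ = supN u ^ (p - 1) := ⟨_, rfl⟩
  rw [← hΛ'] at hΛ ⊢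
  rw [Real.rpow_sub hΛ, show 2 + α = 1 + (1 + α) by ring, Real.rpow_add hΛ 1 (1 + α),
    Real.rpow_one]
  field_simp

lemma eventually_supN_rpow_le {α z D : ℝ} (hα : 0 ≤ α) (hz : IsNthZero 0 2 z) (n : ℕ)
    (hD : ((2 + α) / 2 * z) ^ 2 < D) :
    ∀ᶠ p in 𝓝[>] (1 : ℝ), ∀ u, IsLeastEnergyNInvNodal α p n u → supN u ^ (p - 1) ≤ D := by
  obtain ⟨C, hC, hcomp⟩ := exists_nehari_competitor hα hz n
  obtain ⟨D0, hD0⟩ : ∃ D0, D0 = (((2 + α) / 2 * z) ^ 2 + D) / 2 := ⟨_, rfl⟩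
  have hL : 0 ≤ ((2 + α) / 2 * z) ^ 2 := sq_nonneg _
  have hD0pos : 0 < D0 := by linarith
  have hD0D : D0 < D := by linarith
  have hev := hcomp (D0 - ((2 + α) / 2 * z) ^ 2) (by linarith)
  simp only [add_sub_cancel] at hev
  obtain ⟨c0, hc0⟩ : ∃ c0, c0 = 1 / 8 * (1 / 16 : ℝ) ^ α * (1 / 16) ^ 2 *
    volume.real (ball (0 : E2) 1) := ⟨_, rfl⟩
  have hc0pos : 0 < c0 := by
    rw [hc0]
    have : 0 < volume.real (ball (0 : E2) 1) :=
      ENNReal.toReal_pos (measure_ball_pos _ _ one_pos).ne' measure_ball_lt_top.ne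
    positivity
  have hlim : Tendsto (fun p : ℝ => 2 / (p - 1) - (1 + α)) (𝓝[>] 1) atTop := by
    have h1 : Tendsto (fun p : ℝ => p - 1) (𝓝[>] 1) (𝓝[>] 0) := by
      refine tendsto_nhdsWithin_iff.2 ⟨?_, ?_⟩
      · have : Continuous fun p : ℝ => p - 1 := by fun_prop
        simpa using (this.tendsto 1).mono_left nhdsWithin_le_nhds
      · filter_upwards [self_mem_nhdsWithin] with p hp
        exact sub_pos.2 (Set.mem_Ioi.1 hp)
    have h2 := (tendsto_inv_nhdsGT_zero.comp h1).const_mul_atTop (show (0 : ℝ) < 2 by norm_num)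
    exact tendsto_atTop_add_const_right _ (-(1 + α)) h2
  have hgrow := (tendsto_rpow_atTop_of_base_gt_one (D / D0) ((one_lt_div hD0pos).2 hD0D)).comp hlim
  have hp2 : ∀ᶠ p in 𝓝[>] (1 : ℝ), p < 2 := nhdsWithin_le_nhds (gt_mem_nhds (by norm_num))
  filter_upwards [hev, hgrow.eventually_gt_atTop (C / c0 * D0 ^ (1 + α)),
    hlim.eventually_gt_atTop 0,
    hp2, self_mem_nhdsWithin] with p hp3 hp4 hp5 hp2 hp u hu
  have hp : 1 < p := hp
  obtain ⟨v, hv, hE⟩ := hp3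
  obtain ⟨hsol, -, hpos, -, -, hmin⟩ := hu
  have h1 := (hmin v hv).trans hE
  have h2 := hsol.potential_le_dirichlet hα hp hpos
  have h3 := hsol.le_potential hα hp hp2.le hpos
  rw [← hc0] at h3
  have hk : 0 < 1 / 2 - 1 / (p + 1) := by
    rw [sub_pos]; exact one_div_lt_one_div_of_lt (by norm_num) (by linarith)
  have h4 : (1 / 2 - 1 / (p + 1)) * ∫ x in ball (0 : E2) 1, ‖x‖ ^ α * |u x| ^ (p + 1) ≤
      (1 / 2 - 1 / (p + 1)) * (C * D0 ^ (2 / (p - 1))) := by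
    refine le_trans ?_ h1
    rw [energy]
    linarith
  have h5 := h3.trans (le_of_mul_le_mul_left h4 hk)
  by_contra hcon
  push Not at hcon
  obtain ⟨Λ, hΛ⟩ : ∃ Λ, Λ = supN u ^ (p - 1) := ⟨_, rfl⟩
  rw [← hΛ] at h5 hcon
  obtain ⟨k, hk'⟩ : ∃ k, k = 2 / (p - 1) - (1 + α) := ⟨_, rfl⟩
  simp only [Function.comp_apply] at hp4
  rw [← hk'] at h5 hp4 hp5
  have e1 : D0 ^ (2 / (p - 1)) = D0 ^ k * D0 ^ (1 + α) := by
    rw [← Real.rpow_add hD0pos, hk']; congr 1; ring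
  have h6 : (D / D0) ^ k ≤ Λ ^ k / D0 ^ k := by
    rw [← Real.div_rpow (by linarith) hD0pos.le]
    exact Real.rpow_le_rpow (div_nonneg (by linarith) hD0pos.le) (by gcongr) hp5.le
  have h7 : 0 < D0 ^ k := Real.rpow_pos_of_pos hD0pos _
  have h8 := hp4.trans_le h6
  rw [lt_div_iff₀ h7, div_mul_eq_mul_div, div_mul_eq_mul_div, div_lt_iff₀ hc0pos] at h8
  rw [e1] at h5
  linarith

lemma abs_le_of_flux_bound {α C : ℝ} {P P' : ℝ → ℝ} (hα : 0 ≤ α) (hP : ContinuousOn P (Set.Ico 0 1))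
    (hP0 : P 0 = 0) (hP' : ∀ r ∈ Set.Ioo (0 : ℝ) 1, HasDerivAt P (P' r) r)
    (hC : ∀ r ∈ Set.Ioo (0 : ℝ) 1, |P' r| ≤ C * r ^ (1 + α)) {r : ℝ} (hr : r ∈ Set.Ioo (0 : ℝ) 1) :
    |P r| ≤ C * r ^ (2 + α) := by
  obtain ⟨c, hc, he⟩ := exists_hasDerivAt_eq_slope P P' hr.1
    (hP.mono fun s hs => ⟨hs.1, hs.2.trans_lt hr.2⟩) fun s hs => hP' s ⟨hs.1, hs.2.trans hr.2⟩
  have hr0 := hr.1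
  have hc1 := hC c ⟨hc.1, hc.2.trans hr.2⟩
  rw [hP0, sub_zero, sub_zero, eq_div_iff hr.1.ne'] at he
  have hc0 : 0 < c ^ (1 + α) := Real.rpow_pos_of_pos hc.1 _
  have hC0 : 0 ≤ C := by
    by_contra h
    push Not at h
    have := mul_neg_of_neg_of_pos h hc0
    linarith [abs_nonneg (P' c)]
  have h1 : c ^ (1 + α) ≤ r ^ (1 + α) := Real.rpow_le_rpow hc.1.le hc.2.le (by linarith)
  rw [← he, abs_mul, abs_of_pos hr0, show 2 + α = (1 + α) + 1 by ring, Real.rpow_add_one hr0.ne',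
    ← mul_assoc]
  gcongr
  exact hc1.trans (by gcongr)

/-- A Lyapunov estimate for perturbations of the radial eigenvalue equation in flux form. -/
lemma flux_stability {α Λ η : ℝ} {d P e : ℝ → ℝ} (hα : 0 ≤ α) (hΛ : 0 < Λ)
    (hd : ContinuousOn d (Set.Icc 0 1)) (hP : ContinuousOn P (Set.Ico 0 1)) (hP0 : P 0 = 0)
    (hd' : ∀ r ∈ Set.Ioo (0 : ℝ) 1, HasDerivAt d (P r / r) r)
    (hP' : ∀ r ∈ Set.Ioo (0 : ℝ) 1, HasDerivAt P (-(Λ * r ^ (1 + α) * (d r + e r))) r)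
    (he : ∀ r ∈ Set.Ioo (0 : ℝ) 1, |e r| ≤ η) {r : ℝ} (hr : r ∈ Set.Icc (0 : ℝ) 1) :
    d r ^ 2 ≤ d 0 ^ 2 + Λ * η ^ 2 := by
  obtain ⟨C0, hC0⟩ := isCompact_Icc.exists_bound_of_continuousOn hd
  have hPb : ∀ s ∈ Set.Ioo (0 : ℝ) 1, |P s| ≤ Λ * (C0 + η) * s ^ (2 + α) := fun s hs => by
    refine abs_le_of_flux_bound hα hP hP0 hP' (fun s hs => ?_) hs
    have h1 := hC0 s ⟨hs.1.le, hs.2.le⟩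
    rw [Real.norm_eq_abs] at h1
    have h2 := he s hs
    have h3 : |d s + e s| ≤ C0 + η := (abs_add_le _ _).trans (add_le_add h1 h2)
    have h4 : 0 < s ^ (1 + α) := Real.rpow_pos_of_pos hs.1 _
    rw [abs_neg, abs_mul, abs_of_pos (mul_pos hΛ h4)]
    calc Λ * s ^ (1 + α) * |d s + e s| ≤ Λ * s ^ (1 + α) * (C0 + η) := by gcongr
      _ = Λ * (C0 + η) * s ^ (1 + α) := by ring
  have key : ∀ s r : ℝ, 0 < s → s < r → r < 1 →
      Λ * d r ^ 2 ≤ (Λ * (C0 + η)) ^ 2 * s ^ (2 + α) + Λ * d s ^ 2 + Λ ^ 2 * η ^ 2 := by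
    intro s r hs hsr hr1
    have hF : ∀ t ∈ Set.Ioo (0 : ℝ) 1, HasDerivAt (fun t => P t ^ 2 * t ^ (-(2 + α)) + Λ * d t ^ 2)
        (-(2 * Λ * (P t / t) * e t) - (2 + α) * (P t / t) ^ 2 * t ^ (-(1 + α))) t := by
      intro t ht
      have ht0 := ht.1.ne'
      have h1 := ((hP' t ht).fun_pow 2).fun_mul
        (Real.hasDerivAt_rpow_const (p := -(2 + α)) (Or.inl ht0))
      have h2 := ((hd' t ht).fun_pow 2).const_mul Λ
      refine (h1.fun_add h2).congr_deriv ?_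
      have h3 : 0 < t ^ α := Real.rpow_pos_of_pos ht.1 _
      rw [show -(2 + α) - 1 = -(3 + α) by ring, Real.rpow_neg ht.1.le, Real.rpow_neg ht.1.le,
        Real.rpow_neg ht.1.le, Real.rpow_add ht.1, Real.rpow_add ht.1, Real.rpow_add ht.1,
        Real.rpow_one, Real.rpow_two, show (3 : ℝ) = ((3 : ℕ) : ℝ) by norm_num, Real.rpow_natCast]
      field_simp
      ring
    obtain ⟨c, hc, hcd⟩ := exists_hasDerivAt_eq_slope _ _ hsr
      (fun t ht => (hF t ⟨hs.trans_le ht.1, ht.2.trans_lt hr1⟩).continuousAt.continuousWithinAt)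
      fun t ht => hF t ⟨hs.trans ht.1, ht.2.trans hr1⟩
    have hc0 : 0 < c := hs.trans hc.1
    have hcI : c ∈ Set.Ioo (0 : ℝ) 1 := ⟨hc0, hc.2.trans hr1⟩
    rw [eq_div_iff (sub_pos.2 hsr).ne'] at hcd
    have h1 : 1 ≤ c ^ (-(1 + α)) :=
      Real.one_le_rpow_of_pos_of_le_one_of_nonpos hc0 hcI.2.le (by linarith)
    have h2 : -(2 * Λ * (P c / c) * e c) - (2 + α) * (P c / c) ^ 2 * c ^ (-(1 + α)) ≤
        Λ ^ 2 * η ^ 2 := by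
      obtain ⟨X, hX⟩ : ∃ X, X = P c / c := ⟨_, rfl⟩
      rw [← hX]
      have h3 : e c ^ 2 ≤ η ^ 2 := sq_le_sq' (abs_le.1 (he c hcI)).1 (abs_le.1 (he c hcI)).2
      have h4 : X ^ 2 ≤ (2 + α) * X ^ 2 * c ^ (-(1 + α)) := by
        have : 1 * 1 ≤ (2 + α) * c ^ (-(1 + α)) := by gcongr; linarith
        nlinarith [mul_le_mul_of_nonneg_right this (sq_nonneg X)]
      nlinarith [sq_nonneg (X + Λ * e c), mul_le_mul_of_nonneg_left h3 (sq_nonneg Λ)]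
    have h5 : (-(2 * Λ * (P c / c) * e c) - (2 + α) * (P c / c) ^ 2 * c ^ (-(1 + α))) * (r - s) ≤
        Λ ^ 2 * η ^ 2 :=
      (mul_le_mul_of_nonneg_right h2 (by linarith)).trans
        (mul_le_of_le_one_right (by positivity) (by linarith))
    have h6 : P s ^ 2 * s ^ (-(2 + α)) ≤ (Λ * (C0 + η)) ^ 2 * s ^ (2 + α) := by
      have h7 : 0 < s ^ (2 + α) := Real.rpow_pos_of_pos hs _
      rw [Real.rpow_neg hs.le, ← div_eq_mul_inv, div_le_iff₀ h7]
      have h8 := pow_le_pow_left₀ (abs_nonneg _) (hPb s ⟨hs, hsr.trans hr1⟩) 2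
      rw [sq_abs] at h8
      exact h8.trans (le_of_eq (by ring))
    have h9 : 0 ≤ P r ^ 2 * r ^ (-(2 + α)) :=
      mul_nonneg (sq_nonneg _) (Real.rpow_nonneg (hs.trans hsr).le _)
    linarith
  have hlt : ∀ r ∈ Set.Ioo (0 : ℝ) 1, d r ^ 2 ≤ d 0 ^ 2 + Λ * η ^ 2 := by
    intro r hr
    have h1 : Tendsto d (𝓝[>] 0) (𝓝 (d 0)) := by
      have := (hd 0 ⟨le_rfl, zero_le_one⟩).mono_of_mem_nhdsWithin
        (Icc_mem_nhdsGT (zero_lt_one (α := ℝ)))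
      exact this
    have h2 : Tendsto (fun s : ℝ => s ^ (2 + α)) (𝓝[>] 0) (𝓝 0) := by
      have := (Real.continuous_rpow_const (q := 2 + α) (by linarith)).tendsto 0
      rw [Real.zero_rpow (by linarith)] at this
      exact this.mono_left nhdsWithin_le_nhds
    have h3 := ((h2.const_mul ((Λ * (C0 + η)) ^ 2)).add ((h1.pow 2).const_mul Λ)).add_const
      (Λ ^ 2 * η ^ 2)
    have h4 := ge_of_tendsto h3 (b := Λ * d r ^ 2) (by
      filter_upwards [Ioo_mem_nhdsGT hr.1] with s hs using key s r hs.1 hs.2 hr.2)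
    have h5 : Λ * d r ^ 2 ≤ Λ * (d 0 ^ 2 + Λ * η ^ 2) := by linarith
    exact le_of_mul_le_mul_left h5 hΛ
  rcases eq_or_lt_of_le hr.1 with h | h
  · rw [← h]; nlinarith [sq_nonneg η]
  rcases eq_or_lt_of_le hr.2 with h' | h'
  · have h1 : Tendsto d (𝓝[<] 1) (𝓝 (d 1)) :=
      (hd 1 ⟨zero_le_one, le_rfl⟩).mono_of_mem_nhdsWithin (Icc_mem_nhdsLT (zero_lt_one (α := ℝ)))
    rw [h']
    refine le_of_tendsto (h1.pow 2) ?_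
    filter_upwards [Ioo_mem_nhdsLT (zero_lt_one (α := ℝ))] with s hs using hlt s hs
  · exact hlt r ⟨h, h'⟩

namespace IsNormalizedSol

variable {α p Λ : ℝ} {w : E2 → ℝ}

lemma hasDerivAt_radial_flux (H : IsNormalizedSol α p Λ w)
    (hrad : ∀ r ∈ Set.Icc (0 : ℝ) 1, ∀ θ, w (polar r θ) = w (polar r 0)) {r : ℝ}
    (hr : r ∈ Set.Ioo (0 : ℝ) 1) :
    HasDerivAt (fun r => r * dRad w r 0)
      (-(Λ * r ^ (1 + α) * (|w (polar r 0)| ^ (p - 1) * w (polar r 0)))) r := by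
  have hr1 : |r| < 1 := by rw [abs_of_pos hr.1]; exact hr.2
  have hreg := H.contDiffOn
  have h1 : ∀ θ, dAng w r θ = 0 := fun θ => by
    refine (hasDerivAt_dAng hreg hr1 θ).unique ?_
    simp only [hrad r ⟨hr.1.le, hr.2.le⟩]
    exact hasDerivAt_const _ _
  have h2 : dAngAng w r 0 = 0 := by
    refine (hasDerivAt_dAngAng hreg hr1 0).unique ?_
    simp only [h1]
    exact hasDerivAt_const _ _
  have h3 := lap_polar hreg hr1 0 hr.1
  have h4 := H.eq (polar r 0) (by rw [mem_ball_zero_iff, norm_polar]; exact hr1)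
  rw [norm_polar, abs_of_pos hr.1, h3, h2] at h4
  refine ((hasDerivAt_id' r).fun_mul (hasDerivAt_dRadRad hreg hr1 0)).congr_deriv ?_
  have hr0 := hr.1.ne'
  have e : r ^ (1 + α) = r * r ^ α := by rw [Real.rpow_add hr.1, Real.rpow_one]
  rw [e]
  have h5 : r * (dRadRad w r 0 + dRad w r 0 / r + 0 / r ^ 2) =
      1 * dRad w r 0 + r * dRadRad w r 0 := by field_simp; ring
  linear_combination -r * h4 - h5

lemma radial_stability (H : IsNormalizedSol α p Λ w)
    (hrad : ∀ r ∈ Set.Icc (0 : ℝ) 1, ∀ θ, w (polar r θ) = w (polar r 0)) {z : ℝ}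
    (hz : ((2 + α) / 2 * z) ^ 2 = Λ) (σ : ℝ) {r : ℝ} (hr : r ∈ Set.Icc (0 : ℝ) 1) :
    (w (polar r 0) - σ * radialProfile z α r) ^ 2 ≤ (w 0 - σ) ^ 2 + Λ * (p - 1) ^ 2 := by
  have hα := H.alpha_nonneg
  have hY0 : radialProfile z α 0 = 1 := by
    rw [radialProfile, Real.zero_rpow (by linarith), mul_zero, jB_zero_zero]
  have hp0 : polar 0 0 = (0 : E2) := by rw [← norm_eq_zero, norm_polar, abs_zero]
  have hmaps : ∀ s ∈ Set.Icc (0 : ℝ) 1, polar s 0 ∈ closedBall (0 : E2) 1 := fun s hs => by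
    rw [mem_closedBall_zero_iff, norm_polar, abs_of_nonneg hs.1]; exact hs.2
  have hcont : ContinuousOn (fun s => w (polar s 0)) (Set.Icc 0 1) :=
    H.continuousOn.comp (continuous_iff_continuousAt.2 fun s =>
      (hasDerivAt_polar_radius s 0).continuousAt).continuousOn hmaps
  have hfl : ContinuousOn (fun s => dRad w s 0) (Set.Ico 0 1) := fun s hs =>
    (hasDerivAt_dRadRad H.contDiffOn (by rw [abs_of_nonneg hs.1]; exact hs.2)
      0).continuousAt.continuousWithinAt
  have c1 := continuous_radialProfileDeriv (z := z) hα
  have c2 := continuous_radialProfile (z := z) hα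
  have h := flux_stability (α := α) (Λ := Λ) (η := p - 1)
    (d := fun s => w (polar s 0) - σ * radialProfile z α s)
    (P := fun s => s * dRad w s 0 - σ * (s * radialProfileDeriv z α s))
    (e := fun s => |w (polar s 0)| ^ (p - 1) * w (polar s 0) - w (polar s 0)) hα H.pos
    (hcont.sub (by fun_prop)) (by fun_prop) (by simp) (fun s hs => ?_) (fun s hs => ?_)
    (fun s hs => signed_rpow_sub_self_le H.one_lt (H.le_one _ (hmaps s ⟨hs.1.le, hs.2.le⟩))) hr
  · simpa only [hp0, hY0, mul_one] using h
  · have hs0 := hs.1.ne'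
    refine ((hasDerivAt_dRad H.contDiffOn (by rw [abs_of_pos hs.1]; exact hs.2) 0).fun_sub
      ((hasDerivAt_radialProfile hα s).const_mul σ)).congr_deriv ?_
    field_simp
  · refine ((H.hasDerivAt_radial_flux hrad hs).fun_sub
      ((hasDerivAt_radialFlux hs.1).const_mul σ)).congr_deriv ?_
    rw [hz]
    ring

/-- A radial normalized solution is close to plus or minus the Bessel profile. -/
lemma exists_sign_close (H : IsNormalizedSol α p Λ w)
    (hrad : ∀ r ∈ Set.Icc (0 : ℝ) 1, ∀ θ, w (polar r θ) = w (polar r 0)) {z : ℝ}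
    (hz : ((2 + α) / 2 * z) ^ 2 = Λ) : ∃ σ : ℝ, (σ = 1 ∨ σ = -1) ∧
      ∀ x ∈ closedBall (0 : E2) 1, (w x - σ * radialProfile z α ‖x‖) ^ 2 ≤
        (Λ * (p - 1) ^ 2) ^ 2 + Λ * (p - 1) ^ 2 := by
  have hw : ∀ x ∈ closedBall (0 : E2) 1, ‖x‖ ∈ Set.Icc (0 : ℝ) 1 ∧ w x = w (polar ‖x‖ 0) :=
    fun x hx => by
      have hx1 : ‖x‖ ∈ Set.Icc (0 : ℝ) 1 := ⟨norm_nonneg x, mem_closedBall_zero_iff.1 hx⟩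
      obtain ⟨θ, hθ⟩ := exists_polar x
      refine ⟨hx1, ?_⟩
      rw [← hrad _ hx1 θ, ← hθ]
  have h1 : 1 - |w 0| ≤ Λ * (p - 1) ^ 2 := by
    obtain ⟨x0, hx0, hx1⟩ := H.exists_eq_one
    obtain ⟨h2, h3⟩ := hw x0 (ball_subset_closedBall hx0)
    have h4 := H.radial_stability hrad hz 0 h2
    rw [← h3, zero_mul, sub_zero, sub_zero, ← sq_abs, hx1, ← sq_abs (w 0), one_pow] at h4
    have h5 := H.le_one 0 (by simp)
    nlinarith [abs_nonneg (w 0)]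
  have h2 : 0 ≤ 1 - |w 0| := sub_nonneg.2 (H.le_one 0 (by simp))
  have h3 : (1 - |w 0|) ^ 2 ≤ (Λ * (p - 1) ^ 2) ^ 2 := pow_le_pow_left₀ h2 h1 2
  obtain ⟨σ, hσ, hσ0⟩ : ∃ σ : ℝ, (σ = 1 ∨ σ = -1) ∧ (w 0 - σ) ^ 2 = (1 - |w 0|) ^ 2 := by
    rcases le_total 0 (w 0) with h | h
    · exact ⟨1, Or.inl rfl, by rw [abs_of_nonneg h]; ring⟩
    · exact ⟨-1, Or.inr rfl, by rw [abs_of_nonpos h]; ring⟩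
  refine ⟨σ, hσ, fun x hx => ?_⟩
  obtain ⟨h4, h5⟩ := hw x hx
  rw [h5]
  have := H.radial_stability hrad hz σ h4
  linarith

end IsNormalizedSol

/-- A normalized solution that is nonnegative on a disc of radius `ρ` close to one has no sign
change. -/
lemma IsNormalizedSol.le_of_neg {α p Λ ρ : ℝ} {w : E2 → ℝ} (H : IsNormalizedSol α p Λ w)
    (hneg : ∃ x ∈ ball (0 : E2) 1, w x < 0)
    (hρ0 : 0 ≤ ρ) (hρ : ∀ x ∈ ball (0 : E2) 1, ‖x‖ ≤ ρ → 0 ≤ w x) : 3 ≤ Λ * (1 - ρ ^ 2) := by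
  have hΛ := H.pos
  have hp := H.one_lt
  obtain ⟨η, hη⟩ : ∃ η, η = 1 / Λ := ⟨_, rfl⟩
  have hη0 : 0 < η := by rw [hη]; positivity
  have hΛη : Λ * η = 1 := by rw [hη]; field_simp
  have hden : ∀ x ∈ closedBall (0 : E2) 1, 0 < 1 + η - ‖x‖ ^ 2 := fun x hx => by
    have h1 := mem_closedBall_zero_iff.1 hx
    nlinarith [norm_nonneg x]
  have hcont : ContinuousOn (fun x => -w x / (1 + η - ‖x‖ ^ 2)) (closedBall 0 1) :=
    H.continuousOn.neg.div (by fun_prop) fun x hx => (hden x hx).ne'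
  obtain ⟨x0, hx0, hmax⟩ := (isCompact_closedBall (0 : E2) 1).exists_isMaxOn ⟨0, by simp⟩ hcont
  obtain ⟨x1, hx1, hw1⟩ := hneg
  obtain ⟨κ, hκ⟩ : ∃ κ, κ = -w x0 / (1 + η - ‖x0‖ ^ 2) := ⟨_, rfl⟩
  have hκ0 : 0 < κ := by
    have h1 := hmax (ball_subset_closedBall hx1)
    have h2 : 0 < -w x1 / (1 + η - ‖x1‖ ^ 2) :=
      div_pos (neg_pos.2 hw1) (hden x1 (ball_subset_closedBall hx1))
    rw [hκ]; exact h2.trans_le h1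
  have hle : ∀ x ∈ closedBall (0 : E2) 1, -w x - κ * (1 + η - ‖x‖ ^ 2) ≤ 0 := fun x hx => by
    have h1 : -w x / (1 + η - ‖x‖ ^ 2) ≤ κ := by rw [hκ]; exact hmax hx
    rw [div_le_iff₀ (hden x hx)] at h1
    linarith
  have heq : -w x0 = κ * (1 + η - ‖x0‖ ^ 2) := by
    rw [hκ, div_mul_cancel₀ _ (hden x0 hx0).ne']
  have hw0 : 0 < -w x0 := by rw [heq]; exact mul_pos hκ0 (hden x0 hx0)
  have hx0b : x0 ∈ ball (0 : E2) 1 := by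
    rw [mem_ball_zero_iff]
    refine lt_of_le_of_ne (mem_closedBall_zero_iff.1 hx0) fun h => ?_
    rw [H.eq_zero x0 h] at hw0
    linarith
  have hρx : ρ < ‖x0‖ := by
    by_contra h
    linarith [hρ x0 hx0b (not_lt.1 h)]
  have hlap := lap_nonpos_of_isLocalMax_sub (u := fun x => -w x) (c := κ) (k := 1 + η)
    (eventually_contDiffAt H.contDiffOn.neg hx0b) (by
      filter_upwards [isOpen_ball.mem_nhds hx0b] with y hy
      have := hle y (ball_subset_closedBall hy)
      linarith)
  have hN := H.neg.eq x0 hx0b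
  have h1 : ‖x0‖ ^ α * (|-w x0| ^ (p - 1) * -w x0) ≤ 1 * (1 * -w x0) := by
    have h2 : ‖x0‖ ^ α ≤ 1 :=
      Real.rpow_le_one (norm_nonneg _) (mem_ball_zero_iff.1 hx0b).le H.alpha_nonneg
    have h3 : |-w x0| ^ (p - 1) ≤ 1 :=
      Real.rpow_le_one (abs_nonneg _) (H.neg.le_one x0 hx0) (by linarith)
    gcongr
  have h2 := mul_le_mul_of_nonneg_left h1 hΛ.le
  rw [← hN, one_mul, one_mul, heq] at h2
  have h3 : ρ ^ 2 ≤ ‖x0‖ ^ 2 := pow_le_pow_left₀ hρ0 hρx.le 2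
  have h4 : κ * 4 ≤ κ * (Λ * (1 + η - ρ ^ 2)) := by
    have : κ * (Λ * ρ ^ 2) ≤ κ * (Λ * ‖x0‖ ^ 2) := by gcongr
    linarith
  have h5 := le_of_mul_le_mul_left h4 hκ0
  linarith

section Limit

variable {ι : Type*} {l : Filter ι} {α : ℝ} {p Λ : ι → ℝ} {w : ι → E2 → ℝ}

lemma eventually_exists_sign_close {D : ℝ}
    (hw : ∀ᶠ i in l, IsNormalizedSol α (p i) (Λ i) (w i) ∧
      ∀ r ∈ Set.Icc (0 : ℝ) 1, ∀ θ, w i (polar r θ) = w i (polar r 0))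
    (hp : Tendsto p l (𝓝 1)) (hΛ : ∀ᶠ i in l, Λ i ≤ D) {ε : ℝ} (hε : 0 < ε) :
    ∀ᶠ i in l, ∃ σ : ℝ, (σ = 1 ∨ σ = -1) ∧ ∀ x ∈ closedBall (0 : E2) 1,
      |w i x - σ * jB 0 (Λ i / ((2 + α) / 2) ^ 2 * ‖x‖ ^ (2 + α))| < ε := by
  have h1 : Tendsto (fun i => (D * (p i - 1) ^ 2) ^ 2 + D * (p i - 1) ^ 2) l (𝓝 0) := by
    have hc : Continuous fun q : ℝ => (D * (q - 1) ^ 2) ^ 2 + D * (q - 1) ^ 2 := by fun_prop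
    have h := (hc.tendsto 1).comp hp
    simp only [sub_self, ne_eq, OfNat.ofNat_ne_zero, not_false_eq_true, zero_pow, mul_zero,
      add_zero] at h
    exact h
  filter_upwards [hw, hΛ, h1.eventually (gt_mem_nhds (pow_pos hε 2))] with i hi hD he
  obtain ⟨H, hrad⟩ := hi
  have hΛ0 := H.pos
  have hα := H.alpha_nonneg
  have hz : ((2 + α) / 2 * (√(Λ i) / ((2 + α) / 2))) ^ 2 = Λ i := by
    rw [mul_div_cancel₀ _ (by linarith), Real.sq_sqrt hΛ0.le]
  obtain ⟨σ, hσ, h⟩ := H.exists_sign_close hrad hz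
  refine ⟨σ, hσ, fun x hx => ?_⟩
  have h2 := h x hx
  rw [radialProfile, div_pow, Real.sq_sqrt hΛ0.le] at h2
  refine lt_of_pow_lt_pow_left₀ 2 hε.le ?_
  rw [sq_abs]
  refine h2.trans_lt (lt_of_le_of_lt ?_ he)
  gcongr

/-- The scaled exponent cannot converge to the first zero along sign-changing solutions. -/
lemma not_tendsto_first_zero [l.NeBot] {T : ℝ} (hT : 0 < T) (hpos : ∀ t ∈ Set.Ico 0 T, 0 < jB 0 t)
    (hw : ∀ᶠ i in l, IsNormalizedSol α (p i) (Λ i) (w i) ∧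
      ∀ r ∈ Set.Icc (0 : ℝ) 1, ∀ θ, w i (polar r θ) = w i (polar r 0))
    (hsign : ∀ᶠ i in l, (∃ x ∈ ball (0 : E2) 1, 0 < w i x) ∧ ∃ x ∈ ball (0 : E2) 1, w i x < 0)
    (hp : Tendsto p l (𝓝 1))
    (hlim : Tendsto (fun i => Λ i / ((2 + α) / 2) ^ 2) l (𝓝 T)) : False := by
  have hα : 0 ≤ α := by
    obtain ⟨i, hi⟩ := hw.exists
    exact hi.1.alpha_nonneg
  have hm : 0 < ((2 + α) / 2) ^ 2 := by positivity
  have hΛlim : Tendsto Λ l (𝓝 (T * ((2 + α) / 2) ^ 2)) := by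
    have := hlim.mul_const (((2 + α) / 2) ^ 2)
    simpa only [div_mul_cancel₀ _ hm.ne'] using this
  obtain ⟨ρ, hρ1, hρ⟩ : ∃ ρ : ℝ, ρ ∈ Set.Ioo (0 : ℝ) 1 ∧
      T * ((2 + α) / 2) ^ 2 * (1 - ρ ^ 2) < 3 := by
    have hc : Continuous fun ρ : ℝ => T * ((2 + α) / 2) ^ 2 * (1 - ρ ^ 2) := by fun_prop
    have h1 : ∀ᶠ ρ in 𝓝[<] (1 : ℝ), T * ((2 + α) / 2) ^ 2 * (1 - ρ ^ 2) < 3 :=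
      nhdsWithin_le_nhds (hc.continuousAt.eventually (gt_mem_nhds (by norm_num)))
    obtain ⟨ρ, h2, h3⟩ := (h1.and (Ioo_mem_nhdsLT (zero_lt_one (α := ℝ)))).exists
    exact ⟨ρ, h3, h2⟩
  have hρc0 : 0 < ρ ^ (2 + α) := Real.rpow_pos_of_pos hρ1.1 _
  have hρc : ρ ^ (2 + α) < 1 := Real.rpow_lt_one hρ1.1.le hρ1.2 (by linarith)
  obtain ⟨s, hs1, hs2⟩ := exists_between (show T * ρ ^ (2 + α) < T from by nlinarith)
  have hs0 : 0 < s := lt_trans (by positivity) hs1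
  obtain ⟨t0, ht0, hmin⟩ := isCompact_Icc.exists_isMinOn (Set.nonempty_Icc.2 hs0.le)
    (continuous_jB (le_refl (0 : ℝ))).continuousOn
  have hμ : 0 < jB 0 t0 := hpos t0 ⟨ht0.1, ht0.2.trans_lt hs2⟩
  have hclose := eventually_exists_sign_close hw hp
    (hΛlim.eventually (Iic_mem_nhds (lt_add_one _))) hμ
  obtain ⟨i, hi1, hi2, hi3, ⟨σ, hσ, hi4⟩, hi5⟩ :=
    (((hΛlim.mul_const (1 - ρ ^ 2)).eventually (gt_mem_nhds hρ)).and <|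
      ((hlim.mul_const (ρ ^ (2 + α))).eventually (gt_mem_nhds hs1)).and <|
      hw.and <| hclose.and hsign).exists
  obtain ⟨H, -⟩ := hi3
  have hbound : ∀ x ∈ ball (0 : E2) 1, ‖x‖ ≤ ρ →
      jB 0 t0 ≤ jB 0 (Λ i / ((2 + α) / 2) ^ 2 * ‖x‖ ^ (2 + α)) := fun x _ hx => by
    have hΛ0 := H.pos
    have h1 : ‖x‖ ^ (2 + α) ≤ ρ ^ (2 + α) :=
      Real.rpow_le_rpow (norm_nonneg _) hx (by linarith)
    refine hmin ⟨by positivity, le_trans ?_ hi2.le⟩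
    gcongr
  rcases hσ with rfl | rfl
  · have := H.le_of_neg hi5.2 hρ1.1.le fun x hx hxρ => by
      have h1 := (abs_lt.1 (hi4 x (ball_subset_closedBall hx))).1
      linarith [hbound x hx hxρ]
    linarith
  · obtain ⟨x1, hx1, hw1⟩ := hi5.1
    have := H.neg.le_of_neg ⟨x1, hx1, neg_neg_of_pos hw1⟩ hρ1.1.le fun x hx hxρ => by
      have h1 := (abs_lt.1 (hi4 x (ball_subset_closedBall hx))).2
      linarith [hbound x hx hxρ]
    linarith

lemma tendsto_exponent {z : ℝ} (hα : 0 ≤ α) (hz : IsNthZero 0 2 z)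
    (hw : ∀ᶠ i in l, IsNormalizedSol α (p i) (Λ i) (w i) ∧
      ∀ r ∈ Set.Icc (0 : ℝ) 1, ∀ θ, w i (polar r θ) = w i (polar r 0))
    (hsign : ∀ᶠ i in l, (∃ x ∈ ball (0 : E2) 1, 0 < w i x) ∧ ∃ x ∈ ball (0 : E2) 1, w i x < 0)
    (hp : Tendsto p l (𝓝 1))
    (hΛ : ∀ D, ((2 + α) / 2 * z) ^ 2 < D → ∀ᶠ i in l, Λ i ≤ D) :
    Tendsto Λ l (𝓝 (((2 + α) / 2 * z) ^ 2)) := by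
  obtain ⟨T, hT0, hTz, hT, hpos, hneg, -⟩ := exists_first_zero hz
  have hm : 0 < ((2 + α) / 2) ^ 2 := by positivity
  refine (tendsto_iff_ultrafilter _ _ _).2 fun g hg => ?_
  have hup := hΛ _ (lt_add_one (((2 + α) / 2 * z) ^ 2))
  have hmem : ∀ᶠ i in (g : Filter ι), Λ i ∈ Set.Icc 0 (((2 + α) / 2 * z) ^ 2 + 1) := by
    filter_upwards [hg hw, hg hup] with i h1 h2 using ⟨h1.1.pos.le, h2⟩
  obtain ⟨L, hL, hgL⟩ := isCompact_Icc.ultrafilter_le_nhds (g.map Λ)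
    (le_principal_iff.2 hmem)
  have hlim : Tendsto Λ g (𝓝 L) := hgL
  have hL1 : L ≤ ((2 + α) / 2 * z) ^ 2 :=
    le_of_forall_gt_imp_ge_of_dense fun D hD => le_of_tendsto hlim (hg (hΛ D hD))
  have hq := hlim.div_const (((2 + α) / 2) ^ 2)
  have hpg := hp.mono_left hg
  have hzero : jB 0 (L / ((2 + α) / 2) ^ 2) = 0 := by
    have h1 : Tendsto (fun i => |jB 0 (Λ i / ((2 + α) / 2) ^ 2)|) g
        (𝓝 |jB 0 (L / ((2 + α) / 2) ^ 2)|) :=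
      (((continuous_jB (le_refl (0 : ℝ))).tendsto _).comp hq).abs
    refine abs_nonpos_iff.1 (le_of_forall_gt_imp_ge_of_dense fun ε hε => le_of_tendsto h1 ?_)
    filter_upwards [eventually_exists_sign_close (hg hw) hpg (hg hup) hε, hg hw] with i hi hH
    obtain ⟨σ, hσ, hi⟩ := hi
    have h2 := hi (polar 1 0) (by simp [norm_polar])
    rw [hH.1.eq_zero (polar 1 0) (by simp [norm_polar]), norm_polar, abs_one, Real.one_rpow,
      mul_one, zero_sub, abs_neg, abs_mul] at h2
    have h3 : |σ| = 1 := by rcases hσ with rfl | rfl <;> simp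
    rw [h3, one_mul] at h2
    exact h2.le
  have hne : L / ((2 + α) / 2) ^ 2 ≠ T := fun h => by
    rw [h] at hq
    exact not_tendsto_first_zero hT0 hpos (hg hw) (hg hsign) hpg hq
  have hLz : L / ((2 + α) / 2) ^ 2 = z ^ 2 := by
    have h0 : 0 ≤ L / ((2 + α) / 2) ^ 2 := div_nonneg hL.1 hm.le
    have h1 : L / ((2 + α) / 2) ^ 2 ≤ z ^ 2 := by
      rw [div_le_iff₀ hm]; linarith [mul_pow ((2 + α) / 2) z 2]
    rcases lt_trichotomy (L / ((2 + α) / 2) ^ 2) T with h | h | h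
    · exact absurd hzero (hpos _ ⟨h0, h⟩).ne'
    · exact absurd h hne
    · by_contra h2
      exact absurd hzero (hneg _ ⟨h, lt_of_le_of_ne h1 h2⟩).ne
  have : ((2 + α) / 2 * z) ^ 2 = L := by
    rw [mul_pow, ← hLz, mul_div_cancel₀ _ hm.ne']
  rw [this]
  exact hlim

end Limit

/-- Closeness of normalized radial solutions to the limit profile, up to a sign. -/
lemma exists_signs_uniform_close {ι : Type*} {l : Filter ι} {α z : ℝ} {p Λ : ι → ℝ}
    {w : ι → E2 → ℝ} (hα : 0 ≤ α)
    (hw : ∀ᶠ i in l, IsNormalizedSol α (p i) (Λ i) (w i) ∧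
      ∀ r ∈ Set.Icc (0 : ℝ) 1, ∀ θ, w i (polar r θ) = w i (polar r 0))
    (hp : Tendsto p l (𝓝 1)) (hΛ : Tendsto Λ l (𝓝 (((2 + α) / 2 * z) ^ 2))) :
    ∃ σ : ι → ℝ, (∀ i, σ i = 1 ∨ σ i = -1) ∧ ∀ ε > 0, ∀ᶠ i in l,
      ∀ x ∈ closedBall (0 : E2) 1, |w i x - σ i * jB 0 (z ^ 2 * ‖x‖ ^ (2 + α))| < ε := by
  have key : ∀ i, ∃ s : ℝ, (s = 1 ∨ s = -1) ∧
      ((IsNormalizedSol α (p i) (Λ i) (w i) ∧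
        ∀ r ∈ Set.Icc (0 : ℝ) 1, ∀ θ, w i (polar r θ) = w i (polar r 0)) →
      ∀ x ∈ closedBall (0 : E2) 1,
        (w i x - s * jB 0 (Λ i / ((2 + α) / 2) ^ 2 * ‖x‖ ^ (2 + α))) ^ 2 ≤
          (Λ i * (p i - 1) ^ 2) ^ 2 + Λ i * (p i - 1) ^ 2) := by
    intro i
    by_cases hi : IsNormalizedSol α (p i) (Λ i) (w i) ∧
        ∀ r ∈ Set.Icc (0 : ℝ) 1, ∀ θ, w i (polar r θ) = w i (polar r 0)
    · have hΛ0 := hi.1.pos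
      have hz : ((2 + α) / 2 * (√(Λ i) / ((2 + α) / 2))) ^ 2 = Λ i := by
        rw [mul_div_cancel₀ _ (by linarith), Real.sq_sqrt hΛ0.le]
      obtain ⟨s, hs, h⟩ := hi.1.exists_sign_close hi.2 hz
      refine ⟨s, hs, fun _ x hx => ?_⟩
      have h2 := h x hx
      rwa [radialProfile, div_pow, Real.sq_sqrt hΛ0.le] at h2
    · exact ⟨1, Or.inl rfl, fun h => absurd h hi⟩
  choose σ hσ hclose using key
  refine ⟨σ, hσ, fun ε hε => ?_⟩
  have hm : 0 < ((2 + α) / 2) ^ 2 := by positivity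
  have hT : Tendsto (fun i => Λ i / ((2 + α) / 2) ^ 2) l (𝓝 (z ^ 2)) := by
    have h := hΛ.div_const (((2 + α) / 2) ^ 2)
    rwa [mul_pow, mul_div_cancel_left₀ _ hm.ne'] at h
  have h1 : Tendsto (fun i => (Λ i * (p i - 1) ^ 2) ^ 2 + Λ i * (p i - 1) ^ 2) l (𝓝 0) := by
    have h2 : Tendsto (fun i => Λ i * (p i - 1) ^ 2) l (𝓝 0) := by
      have h := hΛ.mul ((hp.sub_const 1).pow 2)
      simpa using h
    simpa using (h2.pow 2).add h2
  have huc : UniformContinuousOn (jB 0) (Set.Icc 0 (z ^ 2 + 1)) :=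
    isCompact_Icc.uniformContinuousOn_of_continuous (continuous_jB le_rfl).continuousOn
  obtain ⟨δ, hδ, hd⟩ := Metric.uniformContinuousOn_iff.1 huc (ε / 2) (half_pos hε)
  filter_upwards [hw, h1.eventually (gt_mem_nhds (pow_pos (half_pos hε) 2)),
    Metric.tendsto_nhds.1 hT δ hδ, hT.eventually (gt_mem_nhds (lt_add_one (z ^ 2)))]
    with i hi he hdi hle x hx
  have hx1 : ‖x‖ ≤ 1 := by simpa using hx
  have ht0 : 0 ≤ ‖x‖ ^ (2 + α) := by positivity
  have ht1 : ‖x‖ ^ (2 + α) ≤ 1 := Real.rpow_le_one (norm_nonneg _) hx1 (by linarith)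
  have hq0 : 0 ≤ Λ i / ((2 + α) / 2) ^ 2 := div_nonneg hi.1.pos.le hm.le
  have hA : |w i x - σ i * jB 0 (Λ i / ((2 + α) / 2) ^ 2 * ‖x‖ ^ (2 + α))| < ε / 2 := by
    refine lt_of_pow_lt_pow_left₀ 2 (half_pos hε).le ?_
    rw [sq_abs]
    exact (hclose i hi x hx).trans_lt he
  have hB : |jB 0 (Λ i / ((2 + α) / 2) ^ 2 * ‖x‖ ^ (2 + α)) - jB 0 (z ^ 2 * ‖x‖ ^ (2 + α))|
      < ε / 2 := by
    refine hd _ ⟨by positivity, ?_⟩ _ ⟨by positivity, ?_⟩ ?_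
    · exact (mul_le_of_le_one_right hq0 ht1).trans hle.le
    · exact (mul_le_of_le_one_right (sq_nonneg z) ht1).trans (by linarith)
    · rw [Real.dist_eq, ← sub_mul, abs_mul, abs_of_nonneg ht0]
      exact (mul_le_of_le_one_right (abs_nonneg _) ht1).trans_lt hdi
  have hs : |σ i| = 1 := by rcases hσ i with h | h <;> simp [h]
  have hC : |σ i * (jB 0 (Λ i / ((2 + α) / 2) ^ 2 * ‖x‖ ^ (2 + α)) -
      jB 0 (z ^ 2 * ‖x‖ ^ (2 + α)))| < ε / 2 := by
    rwa [abs_mul, hs, one_mul]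
  calc _ = |(w i x - σ i * jB 0 (Λ i / ((2 + α) / 2) ^ 2 * ‖x‖ ^ (2 + α))) +
        σ i * (jB 0 (Λ i / ((2 + α) / 2) ^ 2 * ‖x‖ ^ (2 + α)) -
          jB 0 (z ^ 2 * ‖x‖ ^ (2 + α)))| := by congr 1; ring
    _ ≤ _ := abs_add_le _ _
    _ < ε := by linarith

lemma besselJ_zero_radial (z α : ℝ) (x : E2) :
    besselJ 0 (z * ‖x‖ ^ ((2 + α) / 2)) = jB 0 (z ^ 2 * ‖x‖ ^ (2 + α)) := by
  rw [besselJ_eq, Real.rpow_zero, one_mul, mul_pow, ← Real.rpow_natCast (‖x‖ ^ ((2 + α) / 2)),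
    ← Real.rpow_mul (norm_nonneg _)]
  congr 3
  push_cast
  ring

/-- Least energy `n`-invariant nodal solutions, once normalized, are eventually radial. -/
lemma eventually_normalized_radial {α : ℝ} (hα : 0 ≤ α) {n : ℕ} (hn : 1 ≤ n) {β z : ℝ}
    (hβ : 0 < β) (hz : IsNthZero 0 2 z) (hβz : IsNthZero β 1 z)
    (hlarge : (2 + α) * β / 2 < (n : ℝ)) :
    ∀ᶠ p in 𝓝[>] (1 : ℝ), ∀ u, IsLeastEnergyNInvNodal α p n u →
      (IsNormalizedSol α p (supN u ^ (p - 1)) (fun x => u x / supN u) ∧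
        ∀ r ∈ Set.Icc (0 : ℝ) 1, ∀ θ,
          u (polar r θ) / supN u = u (polar r 0) / supN u) ∧
      (∃ x ∈ ball (0 : E2) 1, 0 < u x / supN u) ∧
        ∃ x ∈ ball (0 : E2) 1, u x / supN u < 0 := by
  obtain ⟨b, δ, ε, K, K1, K2, hb, hbn, hδ, hε, hK, hKr⟩ :=
    exists_sector_barrier hα hβ hβz hlarge
  have hz0 : 0 < ((2 + α) / 2 * z) ^ 2 := by
    have := hz.1
    positivity
  have hpD : ∀ᶠ p in 𝓝[>] (1 : ℝ),
      p * (((2 + α) / 2 * z) ^ 2 + δ / 2) < ((2 + α) / 2 * z) ^ 2 + δ := by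
    have hc : Continuous fun p : ℝ => p * (((2 + α) / 2 * z) ^ 2 + δ / 2) := by fun_prop
    refine nhdsWithin_le_nhds (hc.continuousAt.eventually (gt_mem_nhds ?_))
    linarith
  filter_upwards [eventually_supN_rpow_le hα hz n
    (show ((2 + α) / 2 * z) ^ 2 < ((2 + α) / 2 * z) ^ 2 + δ / 2 by linarith), hpD,
    self_mem_nhdsWithin] with p hbd hpd hp1 u hu
  have hp1 : 1 < p := hp1
  have hbu := hbd u hu
  obtain ⟨hsol, hinv, hpos, hneg, -, -⟩ := hu
  obtain ⟨hnorm, hM, hle⟩ := hsol.normalize hα hp1 hpos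
  have hΛ : p * supN u ^ (p - 1) ≤ ((2 + α) / 2 * z) ^ 2 + δ :=
    (mul_le_mul_of_nonneg_left hbu (by linarith)).trans hpd.le
  refine ⟨⟨hnorm, fun r hr θ => ?_⟩, ?_, ?_⟩
  · rw [radial_of_barrier hn hp1 hsol hinv hle hΛ hb hbn hε hK hKr hr θ]
  · obtain ⟨x, hx, h⟩ := hpos
    exact ⟨x, hx, div_pos h hM⟩
  · obtain ⟨x, hx, h⟩ := hneg
    exact ⟨x, hx, div_neg_of_neg_of_pos h hM⟩

/-- asymptotic profile of least energy `n`-invariant nodal solutions as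
`p → 1`, in the case `n > (2+α)β/2` (where `z_1(β) = z_2(0)`): the limit profile is the
radial eigenfunction `J_0(z_2(0) |x|^{(2+α)/2})`. -/
theorem stmt_16 (α : ℝ) (hα : 0 ≤ α) (n : ℕ) (hn : 1 ≤ n)
    (β : ℝ) (hβ : 0 < β) (z20 : ℝ) (hz20 : IsNthZero 0 2 z20) (hβz : IsNthZero β 1 z20)
    (hlarge : (2 + α) * β / 2 < (n : ℝ))
    (p0 : ℝ) (hp0 : 1 < p0) (U : ℝ → E2 → ℝ)
    (hU : ∀ p ∈ Set.Ioo (1 : ℝ) p0, IsLeastEnergyNInvNodal α p n (U p)) :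
    Tendsto (fun p => supN (U p) ^ (p - 1)) (𝓝[Set.Ioo (1 : ℝ) p0] 1)
      (𝓝 (((2 + α) / 2 * z20) ^ 2)) ∧
    ∀ pk : ℕ → ℝ, (∀ k, pk k ∈ Set.Ioo (1 : ℝ) p0) → Tendsto pk atTop (𝓝 1) →
      ∃ φ : ℕ → ℕ, StrictMono φ ∧ ∃ ε : ℝ, (ε = 1 ∨ ε = -1) ∧
        TendstoUniformlyOn (fun k x => U (pk (φ k)) x / supN (U (pk (φ k))))
          (fun x => ε * besselJ 0 (z20 * ‖x‖ ^ ((2 + α) / 2))) atTop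
          (closedBall 0 1) := by
  have hle : 𝓝[Set.Ioo (1 : ℝ) p0] 1 ≤ 𝓝[>] 1 := nhdsWithin_mono _ Set.Ioo_subset_Ioi_self
  have hmem : ∀ᶠ p in 𝓝[Set.Ioo (1 : ℝ) p0] 1, p ∈ Set.Ioo (1 : ℝ) p0 := self_mem_nhdsWithin
  have hev : ∀ᶠ p in 𝓝[Set.Ioo (1 : ℝ) p0] 1,
      (IsNormalizedSol α p (supN (U p) ^ (p - 1)) (fun x => U p x / supN (U p)) ∧
        ∀ r ∈ Set.Icc (0 : ℝ) 1, ∀ θ,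
          U p (polar r θ) / supN (U p) = U p (polar r 0) / supN (U p)) ∧
      (∃ x ∈ ball (0 : E2) 1, 0 < U p x / supN (U p)) ∧
        ∃ x ∈ ball (0 : E2) 1, U p x / supN (U p) < 0 := by
    filter_upwards [hle (eventually_normalized_radial hα hn hβ hz20 hβz hlarge), hmem] with p h hp
    exact h _ (hU p hp)
  have hlim : Tendsto (fun p => supN (U p) ^ (p - 1)) (𝓝[Set.Ioo (1 : ℝ) p0] 1)
      (𝓝 (((2 + α) / 2 * z20) ^ 2)) := by
    refine tendsto_exponent (p := fun p => p) (w := fun p x => U p x / supN (U p)) hα hz20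
      (hev.mono fun p h => h.1) (hev.mono fun p h => h.2)
      (tendsto_id.mono_left nhdsWithin_le_nhds) fun D hD => ?_
    filter_upwards [hle (eventually_supN_rpow_le hα hz20 n hD), hmem] with p h hp
    exact h _ (hU p hp)
  refine ⟨hlim, fun pk hpk hpk1 => ?_⟩
  have hpk' : Tendsto pk atTop (𝓝[Set.Ioo (1 : ℝ) p0] 1) :=
    tendsto_nhdsWithin_iff.2 ⟨hpk1, Eventually.of_forall hpk⟩
  obtain ⟨σ, hσ, hclose⟩ := exists_signs_uniform_close
    (w := fun k x => U (pk k) x / supN (U (pk k))) hα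
    ((hpk'.eventually hev).mono fun k h => h.1) hpk1 (hlim.comp hpk')
  obtain ⟨s, hs, hfreq⟩ : ∃ s : ℝ, (s = 1 ∨ s = -1) ∧ ∃ᶠ k in atTop, σ k = s := by
    have h : ∃ᶠ k in atTop, σ k = 1 ∨ σ k = -1 := (Eventually.of_forall hσ).frequently
    rcases frequently_or_distrib.1 h with h | h
    · exact ⟨1, Or.inl rfl, h⟩
    · exact ⟨-1, Or.inr rfl, h⟩
  obtain ⟨φ, hφ, hφs⟩ := extraction_of_frequently_atTop hfreq
  refine ⟨φ, hφ, s, hs, Metric.tendstoUniformlyOn_iff.2 fun η hη => ?_⟩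
  filter_upwards [hφ.tendsto_atTop.eventually (hclose η hη)] with k hk x hx
  rw [besselJ_zero_radial, dist_comm, Real.dist_eq, ← hφs k]
  exact hk x hx
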